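/- Let d ≥ 2 and α = d. There exist C < ∞ and ρ₁ < ∞ such that for every intensity ρ ≥ ρ₁ and every i ∈ {1,2,3}, the mixing time satisfies τ^i(L) ≤ C·L², P_{*,ρ}-a.s. for all sufficiently large L. -/

import Mathlib

open MeasureTheory Filter
open scoped ENNReal

noncomputable section

abbrev Pt (d : ℕ) := EuclideanSpace ℝ (Fin d)
abbrev Config (d : ℕ) := Set (Pt d)

def IsLocallyFinite {d : ℕ} (ξ : Config d) : Prop :=
  ∀ A : Set (Pt d), Bornology.IsBounded A → (ξ ∩ A).Finite

instance configMS (d : ℕ) : MeasurableSpace (Config d) :=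
  MeasurableSpace.generateFrom
    { E | ∃ (A : Set (Pt d)) (n : ℕ), Bornology.IsBounded A ∧ MeasurableSet A ∧
        E = {ξ : Config d | (ξ ∩ A).ncard = n} }

def IsPointProcess {d : ℕ} (P : Measure (Config d)) : Prop :=
  IsProbabilityMeasure P ∧ ∀ᵐ ξ ∂P, IsLocallyFinite ξ

def cube (d : ℕ) (L : ℝ) : Set (Pt d) := {p | ∀ i, |p i| ≤ L / 2}

/-- The cube `B_x = Kx + [0,K)^d`. -/
def Kcube (d : ℕ) (K : ℝ) (x : Fin d → ℤ) : Set (Pt d) :=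
  {p | ∀ i, K * x i ≤ p i ∧ p i < K * x i + K}

/-- Bernoulli(p) i.i.d. field on `ℤ^d`, characterized by its cylinder probabilities. -/
def IsBernoulliField (d : ℕ) (p : ℝ) (ν : Measure ((Fin d → ℤ) → Bool)) : Prop :=
  IsProbabilityMeasure ν ∧
  ∀ (S : Finset (Fin d → ℤ)) (b : (Fin d → ℤ) → Bool),
    ν {ω | ∀ x ∈ S, ω x = b x} = ∏ x ∈ S, ENNReal.ofReal (if b x then p else 1 - p)

/-- Assumption (A1): for every p < 1 there is K such that the good-box field
dominates an i.i.d. Bernoulli(p) field, in the sense of a monotone coupling. -/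
def AssumptionA1 {d : ℕ} (P : Measure (Config d)) : Prop :=
  ∀ p : ℝ, 0 < p → p < 1 → ∃ K : ℝ, 0 < K ∧
    ∃ (μ : Measure (Config d × ((Fin d → ℤ) → Bool))) (ν : Measure ((Fin d → ℤ) → Bool)),
      IsProbabilityMeasure μ ∧ IsBernoulliField d p ν ∧
      μ.map Prod.fst = P ∧ μ.map Prod.snd = ν ∧
      ∀ᵐ ω ∂μ, ∀ x : Fin d → ℤ, ω.2 x = true → (ω.1 ∩ Kcube d K x).Nonempty

/-- `R_A(ξ) = Σ_{x ∈ ξ∩A} Σ_{y ∈ ξ} exp(-|x-y|^α)` (valued in `ℝ≥0∞`). -/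
def Rfun {d : ℕ} (α : ℝ) (A : Set (Pt d)) (ξ : Config d) : ℝ≥0∞ :=
  ∑' (x : ↥(ξ ∩ A)) (y : ↥ξ), ENNReal.ofReal (Real.exp (-(dist (x : Pt d) (y : Pt d)) ^ α))

/-- The cube `V_x = L^ε x + [0, L^ε)^d`. -/
def Vcube (d : ℕ) (L : ℕ) (ε : ℝ) (x : Fin d → ℤ) : Set (Pt d) :=
  {p | ∀ i, (L : ℝ) ^ ε * x i ≤ p i ∧ p i < (L : ℝ) ^ ε * x i + (L : ℝ) ^ ε}

/-- Assumption (A2). -/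
def AssumptionA2 {d : ℕ} (α : ℝ) (P : Measure (Config d)) : Prop :=
  ∀ ε : ℝ, 0 < ε → ε < 1 → ∃ C : ℝ, 0 < C ∧
    ∀ᵐ ξ ∂P, ∀ᶠ L : ℕ in atTop,
      ∀ x : Fin d → ℤ, (Vcube d L ε x ∩ cube d L).Nonempty →
        Rfun α (Vcube d L ε x) ξ ≤ ENNReal.ofReal (C * (L : ℝ) ^ (ε * d))

noncomputable instance {d : ℕ} : DecidableEq (Pt d) := Classical.decEq _

variable {d : ℕ}

/-- jump rate `e^{-|x-y|^α}`. -/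
def rate (α : ℝ) (x y : Pt d) : ℝ := Real.exp (-(dist x y) ^ α)

/-- weights `w^i_x` for the three models `i = 1,2,3`. -/
def wgt (α : ℝ) (E : Finset (Pt d)) (i : ℕ) (x : Pt d) : ℝ :=
  if i = 1 then 1
  else if i = 2 then ∑ z ∈ E.erase x, rate α x z
  else max 1 (∑ z ∈ E.erase x, rate α x z)

/-- `W^i(U) = Σ_{x∈U} w^i_x`. -/
def Wsum (α : ℝ) (E : Finset (Pt d)) (i : ℕ) (U : Finset (Pt d)) : ℝ :=
  ∑ x ∈ U, wgt α E i x

/-- the reversible probability measure `ν^i(x) = w^i_x / W^i(ξ_L)`. -/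
def nu (α : ℝ) (E : Finset (Pt d)) (i : ℕ) (x : Pt d) : ℝ :=
  wgt α E i x / Wsum α E i E

/-- conductance `I^i_U`. -/
def conduct (α : ℝ) (E : Finset (Pt d)) (i : ℕ) (U : Finset (Pt d)) : ℝ :=
  (∑ x ∈ U, ∑ y ∈ E \ U, rate α x y) / Wsum α E i U

/-- isoperimetric profile `φ^i_L(t)` (valued in `ℝ≥0∞`; `∞` if no admissible `U`). -/
def isoProfile (α : ℝ) (E : Finset (Pt d)) (i : ℕ) (t : ℝ) : ℝ≥0∞ :=
  ⨅ (U : Finset (Pt d)) (_ : U ⊆ E) (_ : U.Nonempty)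
    (_ : Wsum α E i U ≤ t * Wsum α E i E), ENNReal.ofReal (conduct α E i U)

/-- Cheeger's constant `Φ^i_L = φ^i_L(1/2)`. -/
def cheeger (α : ℝ) (E : Finset (Pt d)) (i : ℕ) : ℝ≥0∞ := isoProfile α E i (1 / 2)

/-- Dirichlet form `E_i(f)`. -/
def dirichlet (α : ℝ) (E : Finset (Pt d)) (i : ℕ) (f : Pt d → ℝ) : ℝ :=
  (1 / 2) * ∑ x ∈ E, ∑ y ∈ E.erase x,
    nu α E i x * (rate α x y / wgt α E i x) * (f x - f y) ^ 2

/-- variance `Var_i(f) = ν^i(f²) - ν^i(f)²`. -/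
def varNu (α : ℝ) (E : Finset (Pt d)) (i : ℕ) (f : Pt d → ℝ) : ℝ :=
  (∑ x ∈ E, nu α E i x * f x ^ 2) - (∑ x ∈ E, nu α E i x * f x) ^ 2

/-- nonconstant on `E`. -/
def Nonconst (E : Finset (Pt d)) (f : Pt d → ℝ) : Prop := ∃ x ∈ E, ∃ y ∈ E, f x ≠ f y

/-- Poincaré constant `γ^i(L) = sup { Var_i f / E_i f : f nonconstant }`. -/
def gammaP (α : ℝ) (E : Finset (Pt d)) (i : ℕ) : ℝ≥0∞ :=
  ⨆ (f : Pt d → ℝ) (_ : Nonconst E f),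
    ENNReal.ofReal (varNu α E i f / dirichlet α E i f)

/-- the generator `L^i` as a matrix on `E`. -/
def gen (α : ℝ) (E : Finset (Pt d)) (i : ℕ) : Matrix ↥E ↥E ℝ :=
  Matrix.of fun x y =>
    if x = y then -(∑ z ∈ E.erase (x : Pt d), rate α (x : Pt d) z / wgt α E i (x : Pt d))
    else rate α (x : Pt d) (y : Pt d) / wgt α E i (x : Pt d)

/-- heat kernel `H^i_t = exp(t L^i)`, via the exponential series. -/
def heatKernel (α : ℝ) (E : Finset (Pt d)) (i : ℕ) (t : ℝ) (x y : ↥E) : ℝ :=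
  ∑' n : ℕ, t ^ n / (n.factorial : ℝ) * (gen α E i ^ n) x y

/-- uniform mixing time `τ^i(L)` (valued in `ℝ≥0∞`). -/
def mixTime (α : ℝ) (E : Finset (Pt d)) (i : ℕ) : ℝ≥0∞ :=
  ⨅ (t : ℝ) (_ : 0 < t)
    (_ : ∀ x y : ↥E,
      |heatKernel α E i t x y - nu α E i (y : Pt d)| / nu α E i (y : Pt d) ≤ Real.exp (-1)),
    ENNReal.ofReal t

/-- `c₀⁺(U)`: nonnegative, nonconstant, vanishing outside `U`. -/
def c0plus (E U : Finset (Pt d)) (f : Pt d → ℝ) : Prop :=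
  (∀ x ∈ E, 0 ≤ f x) ∧ Nonconst E f ∧ ∀ x ∈ E, x ∉ U → f x = 0

/-- `λ^i(U) = inf { E_i f / Var_i f : f ∈ c₀⁺(U) }`. -/
def lambdaU (α : ℝ) (E : Finset (Pt d)) (i : ℕ) (U : Finset (Pt d)) : ℝ :=
  sInf {r : ℝ | ∃ f : Pt d → ℝ, c0plus E U f ∧ r = dirichlet α E i f / varNu α E i f}

/-- `ν^i_* = min_{x∈E} ν^i(x)`. -/
def nuStar (α : ℝ) (E : Finset (Pt d)) (i : ℕ) : ℝ :=
  sInf (nu α E i '' ↑E)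

/-- `ν^i(U)` for a subset `U`. -/
def nuSet (α : ℝ) (E : Finset (Pt d)) (i : ℕ) (U : Finset (Pt d)) : ℝ :=
  ∑ x ∈ U, nu α E i x

/-- spectral profile `Λ^i(r)`. -/
def specProfile (α : ℝ) (E : Finset (Pt d)) (i : ℕ) (r : ℝ) : ℝ :=
  sInf {l : ℝ | ∃ U : Finset (Pt d), U ⊆ E ∧
    nuStar α E i ≤ nuSet α E i U ∧ nuSet α E i U ≤ r ∧ l = lambdaU α E i U}

/-- hybrid conductance profile `ψ_L(t)`: model-3 conductance, counting constraint. -/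
def hybridProfile (α : ℝ) (E : Finset (Pt d)) (t : ℝ) : ℝ≥0∞ :=
  ⨅ (U : Finset (Pt d)) (_ : U ⊆ E) (_ : U.Nonempty)
    (_ : (U.card : ℝ) ≤ t * (E.card : ℝ)), ENNReal.ofReal (conduct α E 3 U)

/-- homogeneous Poisson point process of intensity `ρ`, characterized by
independence and Poisson distribution of the counting variables. -/
def IsPoissonPP (d : ℕ) (ρ : ℝ) (P : Measure (Config d)) : Prop :=
  IsProbabilityMeasure P ∧ (∀ᵐ ξ ∂P, IsLocallyFinite ξ) ∧
  ∀ (k : ℕ) (A : Fin k → Set (Pt d)),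
    (∀ j, Bornology.IsBounded (A j)) → (∀ j, MeasurableSet (A j)) →
    (Pairwise fun j j' => Disjoint (A j) (A j')) →
    ∀ m : Fin k → ℕ,
      P {ξ | ∀ j, (ξ ∩ A j).ncard = m j} =
        ∏ j, ENNReal.ofReal (Real.exp (-ρ * (volume (A j)).toReal) *
          (ρ * (volume (A j)).toReal) ^ (m j) / ((m j).factorial : ℝ))

section Heat

variable {ι : Type*} [Fintype ι] [DecidableEq ι]

lemma matrix_hasSum_exp_entry (Q : Matrix ι ι ℝ) (t : ℝ) (x y : ι) :
    HasSum (fun n : ℕ => t ^ n / (n.factorial : ℝ) * (Q ^ n) x y)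
      (NormedSpace.exp (t • Q) x y) := by
  let : NormedRing (Matrix ι ι ℝ) := Matrix.linftyOpNormedRing
  let : NormedAlgebra ℝ (Matrix ι ι ℝ) := Matrix.linftyOpNormedAlgebra
  have h : HasSum (fun n : ℕ => ((n.factorial : ℝ)⁻¹) • (t • Q) ^ n) (NormedSpace.exp (t • Q)) :=
    NormedSpace.exp_series_hasSum_exp' (𝕂 := ℝ) (t • Q)
  have h2 : HasSum (fun n : ℕ => (((n.factorial : ℝ)⁻¹) • (t • Q) ^ n) x y)
    (NormedSpace.exp (t • Q) x y) := (Pi.hasSum.1 ((Pi.hasSum.1 h) x)) y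
  have e : (fun n : ℕ => t ^ n / (n.factorial : ℝ) * (Q ^ n) x y)
      = fun n : ℕ => (((n.factorial : ℝ)⁻¹) • (t • Q) ^ n) x y := by
    funext n
    rw [smul_pow, Matrix.smul_apply, Matrix.smul_apply, smul_eq_mul, smul_eq_mul]
    ring
  rw [e]
  exact h2

lemma matrix_hasDerivAt_exp_entry (Q : Matrix ι ι ℝ) (t : ℝ) (x y : ι) :
    HasDerivAt (fun s : ℝ => NormedSpace.exp (s • Q) x y)
      ((NormedSpace.exp (t • Q) * Q) x y) t := by
  let : NormedRing (Matrix ι ι ℝ) := Matrix.linftyOpNormedRing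
  let : NormedAlgebra ℝ (Matrix ι ι ℝ) := Matrix.linftyOpNormedAlgebra
  have h := hasDerivAt_exp_smul_const (𝕂 := ℝ) Q t
  exact (hasDerivAt_pi.1 ((hasDerivAt_pi.1 h) x)) y

lemma matrix_exp_reversible {Q : Matrix ι ι ℝ} {p : ι → ℝ}
    (hrev : ∀ x y, p x * Q x y = p y * Q y x) (t : ℝ) (x y : ι) :
    p x * NormedSpace.exp (t • Q) x y = p y * NormedSpace.exp (t • Q) y x := by
  have hp : ∀ n : ℕ, ∀ x y, p x * (Q ^ n) x y = p y * (Q ^ n) y x := by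
    intro n
    induction n with
    | zero =>
      intro x y
      by_cases h : x = y
      · subst h; rfl
      · simp [h, Ne.symm h]
    | succ n ih =>
      intro x y
      rw [pow_succ, Matrix.mul_apply, ← pow_succ, pow_succ', Matrix.mul_apply, Finset.mul_sum,
        Finset.mul_sum]
      refine Finset.sum_congr rfl fun z _ => ?_
      calc p x * ((Q ^ n) x z * Q z y) = p x * (Q ^ n) x z * Q z y := by ring
        _ = (Q ^ n) z x * (p z * Q z y) := by rw [ih]; ring
        _ = _ := by rw [hrev]; ring
  have h1 := (matrix_hasSum_exp_entry Q t x y).mul_left (p x)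
  have h2 := (matrix_hasSum_exp_entry Q t y x).mul_left (p y)
  refine h1.unique ?_
  convert h2 using 2 with n
  have := hp n x y
  linear_combination (t ^ n / (n.factorial : ℝ)) * this

lemma matrix_exp_row_sum {Q : Matrix ι ι ℝ} (hrow : ∀ x, ∑ y, Q x y = 0) (t : ℝ) (x : ι) :
    ∑ y, NormedSpace.exp (t • Q) x y = 1 := by
  have hd : ∀ s : ℝ, HasDerivAt (fun s : ℝ => ∑ y, NormedSpace.exp (s • Q) x y) 0 s := by
    intro s
    have h := HasDerivAt.fun_sum (u := Finset.univ)
      (fun y _ => matrix_hasDerivAt_exp_entry Q s x y)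
    have e : ∑ y, (NormedSpace.exp (s • Q) * Q) x y = 0 := by
      simp only [Matrix.mul_apply]
      rw [Finset.sum_comm]
      simp [← Finset.mul_sum, hrow]
    rwa [e] at h
  have h0 : ∑ y, NormedSpace.exp (t • Q) x y = ∑ y, NormedSpace.exp ((0 : ℝ) • Q) x y :=
    is_const_of_deriv_eq_zero (fun s => (hd s).differentiableAt)
    (fun s => (hd s).deriv) t 0
  rw [h0, zero_smul, NormedSpace.exp_zero]
  simp [Matrix.one_apply]

lemma matrix_exp_nonneg {Q : Matrix ι ι ℝ} (hoff : ∀ x y, x ≠ y → 0 ≤ Q x y) {t : ℝ}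
    (ht : 0 ≤ t) (x y : ι) : 0 ≤ NormedSpace.exp (t • Q) x y := by
  obtain ⟨a, ha⟩ : ∃ a : ℝ, ∀ x, 0 ≤ Q x x + a := by
    refine ⟨∑ z, |Q z z|, fun x => ?_⟩
    have : |Q x x| ≤ ∑ z, |Q z z| := Finset.single_le_sum (f := fun z => |Q z z|)
      (fun z _ => abs_nonneg _)
      (Finset.mem_univ x)
    have h2 := neg_abs_le (Q x x)
    linarith
  set R : Matrix ι ι ℝ := Q + a • (1 : Matrix ι ι ℝ) with hR
  have hRnn : ∀ x y, 0 ≤ R x y := by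
    intro x y
    by_cases h : x = y
    · subst h; simpa [hR] using ha x
    · simpa [hR, Matrix.one_apply, h] using hoff x y h
  have hRp : ∀ n : ℕ, ∀ x y, 0 ≤ (R ^ n) x y := by
    intro n
    induction n with
    | zero => intro x y; by_cases h : x = y <;> simp [h]
    | succ n ih =>
      intro x y
      rw [pow_succ, Matrix.mul_apply]
      exact Finset.sum_nonneg fun z _ => mul_nonneg (ih x z) (hRnn z y)
  have h1 : 0 ≤ NormedSpace.exp (t • R) x y :=
    (matrix_hasSum_exp_entry R t x y).nonneg fun n => mul_nonneg (by positivity) (hRp n x y)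
  have h2 : NormedSpace.exp (t • R) = Real.exp (t * a) • NormedSpace.exp (t • Q) := by
    have hc : Commute (t • Q) (algebraMap ℝ (Matrix ι ι ℝ) (t * a)) :=
      (Algebra.commutes _ _).symm
    have : t • R = t • Q + algebraMap ℝ (Matrix ι ι ℝ) (t * a) := by
      rw [hR, Algebra.algebraMap_eq_smul_one, smul_add, smul_smul]
    have h3 : NormedSpace.exp (algebraMap ℝ (Matrix ι ι ℝ) (t * a))
        = algebraMap ℝ (Matrix ι ι ℝ) (Real.exp (t * a)) := by
      let : NormedRing (Matrix ι ι ℝ) := Matrix.linftyOpNormedRing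
      let : NormedAlgebra ℝ (Matrix ι ι ℝ) := Matrix.linftyOpNormedAlgebra
      rw [Real.exp_eq_exp_ℝ]
      exact (NormedSpace.algebraMap_exp_comm (𝕂 := ℝ) (𝔸 := Matrix ι ι ℝ) (t * a)).symm
    rw [this, Matrix.exp_add_of_commute _ _ hc, h3,
      Algebra.algebraMap_eq_smul_one, mul_smul_comm, mul_one]
  rw [h2, Matrix.smul_apply, smul_eq_mul] at h1
  exact nonneg_of_mul_nonneg_right h1 (Real.exp_pos _)

/-- squared `L²` norm of the heat kernel density started from `x`. -/
def heatEnergy (Q : Matrix ι ι ℝ) (p : ι → ℝ) (x : ι) (t : ℝ) : ℝ :=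
  ∑ y, (NormedSpace.exp (t • Q) x y) ^ 2 / p y

lemma heatEnergy_zero (Q : Matrix ι ι ℝ) (p : ι → ℝ) (x : ι) :
    heatEnergy Q p x 0 = 1 / p x := by
  simp only [heatEnergy, zero_smul, NormedSpace.exp_zero, Matrix.one_apply]
  rw [Finset.sum_eq_single x] <;> simp +contextual [eq_comm]

lemma heatEnergy_hasDerivAt {Q : Matrix ι ι ℝ} {p : ι → ℝ} (hp : ∀ x, 0 < p x)
    (hrev : ∀ x y, p x * Q x y = p y * Q y x) (hrow : ∀ x, ∑ y, Q x y = 0) (x : ι) (t : ℝ) :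
    HasDerivAt (heatEnergy Q p x)
      (-∑ y, ∑ z, p y * Q y z * (NormedSpace.exp (t • Q) x y / p y
        - NormedSpace.exp (t • Q) x z / p z) ^ 2) t := by
  have h := HasDerivAt.fun_sum (u := Finset.univ)
    (fun y _ => ((matrix_hasDerivAt_exp_entry Q t x y).pow 2).div_const (p y))
  change HasDerivAt (heatEnergy Q p x) _ t at h
  refine h.congr_deriv ?_
  set f : ι → ℝ := fun y => NormedSpace.exp (t • Q) x y / p y with hf
  have hfe : ∀ y, NormedSpace.exp (t • Q) x y = p y * f y := fun y => by
    have := (hp y).ne'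
    simp only [hf]; field_simp
  have h1 : ∀ y, (((2 : ℕ) : ℝ) * (NormedSpace.exp (t • Q) x y) ^ (2 - 1) *
      (NormedSpace.exp (t • Q) * Q) x y) / p y = ∑ z, 2 * (p y * Q y z) * (f y * f z) := by
    intro y
    rw [Matrix.mul_apply, Finset.mul_sum, Finset.sum_div]
    refine Finset.sum_congr rfl fun z _ => ?_
    rw [hfe, hfe, show p z * f z * Q z y = f z * (p z * Q z y) by ring, hrev z y]
    have := (hp y).ne'
    field_simp
    norm_num
    ring
  rw [Finset.sum_congr rfl fun y _ => h1 y]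
  have e1 : ∑ y, ∑ z, p y * Q y z * f y ^ 2 = 0 := by
    simp_rw [← Finset.sum_mul, ← Finset.mul_sum, hrow]; simp
  have e2 : ∑ y, ∑ z, p y * Q y z * f z ^ 2 = 0 := by
    rw [Finset.sum_comm]
    simp_rw [fun a b => hrev a b, ← Finset.sum_mul, ← Finset.mul_sum, hrow]; simp
  have e3 : ∑ y, ∑ z, p y * Q y z * (f y - f z) ^ 2
      = ∑ y, ∑ z, p y * Q y z * f y ^ 2 + ∑ y, ∑ z, p y * Q y z * f z ^ 2
        - ∑ y, ∑ z, 2 * (p y * Q y z) * (f y * f z) := by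
    simp_rw [← Finset.sum_add_distrib, ← Finset.sum_sub_distrib]
    refine Finset.sum_congr rfl fun y _ => Finset.sum_congr rfl fun z _ => by ring
  simp only [hf] at e1 e2 e3 ⊢
  rw [e3, e1, e2]; ring

/-- A Nash type inequality at a fixed scale, for probability densities. -/
def NashAt (Q : Matrix ι ι ℝ) (p : ι → ℝ) (A B : ℝ) : Prop :=
  ∀ f : ι → ℝ, (∀ x, 0 ≤ f x) → ∑ x, p x * f x = 1 →
    ∑ x, p x * f x ^ 2 ≤ A * (∑ x, ∑ y, p x * Q x y * (f x - f y) ^ 2) + B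

lemma heatEnergy_decay {Q : Matrix ι ι ℝ} {p : ι → ℝ} (hp : ∀ x, 0 < p x)
    (hrev : ∀ x y, p x * Q x y = p y * Q y x) (hrow : ∀ x, ∑ y, Q x y = 0)
    (hoff : ∀ x y, x ≠ y → 0 ≤ Q x y) {A B : ℝ} (hA : 0 < A) (hN : NashAt Q p A B)
    (x : ι) {t s : ℝ} (ht : 0 ≤ t) (hs : 0 ≤ s) :
    heatEnergy Q p x (t + s) - B ≤ Real.exp (-(s / A)) * (heatEnergy Q p x t - B) := by
  set g : ℝ → ℝ := fun r => Real.exp (r / A) * (heatEnergy Q p x r - B) with hg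
  have hd : ∀ r : ℝ, HasDerivAt g (Real.exp (r / A) * (1 / A) * (heatEnergy Q p x r - B)
      + Real.exp (r / A) * (-∑ y, ∑ z, p y * Q y z * (NormedSpace.exp (r • Q) x y / p y
        - NormedSpace.exp (r • Q) x z / p z) ^ 2)) r := fun r =>
    (((hasDerivAt_id r).div_const A).exp).mul ((heatEnergy_hasDerivAt hp hrev hrow x r).sub_const B)
  have hanti : AntitoneOn g (Set.Ici 0) := by
    refine antitoneOn_of_hasDerivWithinAt_nonpos (convex_Ici 0)
      (fun r _ => (hd r).continuousAt.continuousWithinAt)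
      (fun r _ => (hd r).hasDerivWithinAt) ?_
    intro r hr
    rw [interior_Ici] at hr
    have hr0 : (0 : ℝ) ≤ r := le_of_lt hr
    have h1 := hN (fun y => NormedSpace.exp (r • Q) x y / p y)
      (fun y => div_nonneg (matrix_exp_nonneg hoff hr0 x y) (hp y).le) (by
        rw [← matrix_exp_row_sum hrow r x]
        refine Finset.sum_congr rfl fun y _ => ?_
        have := (hp y).ne'
        field_simp)
    have h2 : ∑ y, p y * (NormedSpace.exp (r • Q) x y / p y) ^ 2 = heatEnergy Q p x r := by
      unfold heatEnergy
      refine Finset.sum_congr rfl fun y _ => ?_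
      have := (hp y).ne'
      field_simp
    rw [h2] at h1
    set D := ∑ y, ∑ z, p y * Q y z * (NormedSpace.exp (r • Q) x y / p y
        - NormedSpace.exp (r • Q) x z / p z) ^ 2 with hD
    have h3 : (1 / A) * (heatEnergy Q p x r - B) ≤ D := by
      rw [one_div, inv_mul_le_iff₀ hA]; linarith
    have := mul_le_mul_of_nonneg_left h3 (Real.exp_pos (r / A)).le
    linarith
  have h := hanti (Set.mem_Ici.2 ht) (Set.mem_Ici.2 (add_nonneg ht hs)) (by linarith)
  simp only [hg] at h
  have e : Real.exp ((t + s) / A) = Real.exp (t / A) * Real.exp (s / A) := by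
    rw [← Real.exp_add]; ring_nf
  rw [e, mul_assoc] at h
  have h4 := le_of_mul_le_mul_left h (Real.exp_pos _)
  rw [Real.exp_neg, ← div_eq_inv_mul, le_div_iff₀ (Real.exp_pos _)]
  linarith

lemma heatKernel_abs_sub_le {Q : Matrix ι ι ℝ} {p : ι → ℝ} (hp : ∀ x, 0 < p x)
    (hp1 : ∑ x, p x = 1)
    (hrev : ∀ x y, p x * Q x y = p y * Q y x) (hrow : ∀ x, ∑ y, Q x y = 0)
    {t K : ℝ} (hK : ∀ x, heatEnergy Q p x t - 1 ≤ K) (x y : ι) :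
    |NormedSpace.exp ((2 * t) • Q) x y - p y| / p y ≤ K := by
  set h : ι → ι → ℝ := fun a b => NormedSpace.exp (t • Q) a b with hh
  have hsum : ∀ a, ∑ b, h a b = 1 := fun a => matrix_exp_row_sum hrow t a
  have hsg : NormedSpace.exp ((2 * t) • Q) x y = ∑ z, h x z * h z y := by
    rw [two_mul, add_smul, Matrix.exp_add_of_commute _ _ (Commute.refl _), Matrix.mul_apply]
  have key : ∀ a, ∑ z, p z * (h a z / p z - 1) ^ 2 ≤ K := by
    intro a
    refine le_trans (le_of_eq ?_) (hK a)
    have : ∀ z, p z * (h a z / p z - 1) ^ 2 = (h a z) ^ 2 / p z - 2 * h a z + p z := by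
      intro z
      have := (hp z).ne'
      field_simp
      ring
    simp only [this]
    rw [Finset.sum_add_distrib, Finset.sum_sub_distrib, ← Finset.mul_sum, hsum, hp1]
    simp only [heatEnergy, hh]; ring
  have e : (NormedSpace.exp ((2 * t) • Q) x y - p y) / p y
      = ∑ z, p z * ((h x z / p z - 1) * (h y z / p z - 1)) := by
    have : ∀ z, p z * ((h x z / p z - 1) * (h y z / p z - 1))
        = h x z * h z y / p y - h x z - h y z + p z := by
      intro z
      have h1 := (hp z).ne'
      have h2 := (hp y).ne'
      have h3 : h z y = p y * h y z / p z := by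
        have : p z * h z y = p y * h y z := matrix_exp_reversible hrev t z y
        field_simp; linarith
      rw [h3]; field_simp; ring
    simp only [this]
    rw [Finset.sum_add_distrib, Finset.sum_sub_distrib, Finset.sum_sub_distrib, hsum, hsum, hp1,
      ← Finset.sum_div, hsg, sub_div, div_self (hp y).ne']
    ring
  have habs : |NormedSpace.exp ((2 * t) • Q) x y - p y| / p y
      = |(NormedSpace.exp ((2 * t) • Q) x y - p y) / p y| := by
    rw [abs_div, abs_of_pos (hp y)]
  rw [habs, e]
  refine (Finset.abs_sum_le_sum_abs _ _).trans ?_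
  have : ∀ z ∈ Finset.univ, |p z * ((h x z / p z - 1) * (h y z / p z - 1))| ≤
      (1 / 2) * (p z * (h x z / p z - 1) ^ 2) + (1 / 2) * (p z * (h y z / p z - 1) ^ 2) := by
    intro z _
    rw [abs_mul, abs_of_pos (hp z), abs_mul]
    have := sq_nonneg (|h x z / p z - 1| - |h y z / p z - 1|)
    rw [sub_sq, sq_abs, sq_abs] at this
    have h5 := mul_nonneg (hp z).le this
    nlinarith
  refine (Finset.sum_le_sum this).trans ?_
  rw [Finset.sum_add_distrib, ← Finset.mul_sum, ← Finset.mul_sum]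
  linarith [key x, key y]

end Heat

lemma exists_time_heatEnergy_le {ι : Type*} [Fintype ι] [DecidableEq ι]
    {Q : Matrix ι ι ℝ} {p : ι → ℝ} (hp : ∀ x, 0 < p x)
    (hrev : ∀ x y, p x * Q x y = p y * Q y x) (hrow : ∀ x, ∑ y, Q x y = 0)
    (hoff : ∀ x y, x ≠ y → 0 ≤ Q x y) {A B N : ℝ} (hA : 0 < A) (hB : 1 ≤ B) (hN1 : 1 ≤ N)
    (hN : ∀ x, 1 / p x ≤ N) (d j₀ m : ℕ) (hjm : j₀ ≤ m)
    (hNash : ∀ j, j₀ ≤ j → j ≤ m → NashAt Q p (A * 4 ^ j) (B * 2 ^ (d * (m - j))))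
    (hPoinc : NashAt Q p (A * 4 ^ m) 1) :
    ∃ t : ℝ, 0 < t ∧
      t ≤ A * (4 ^ j₀ * Real.log N + (2 * (d + 1) + Real.log (2 * B) + 1) * 4 ^ m) ∧
      ∀ x, heatEnergy Q p x t - 1 ≤ Real.exp (-1) := by
  have hlogN : 0 ≤ Real.log N := Real.log_nonneg hN1
  have hind : ∀ j, j₀ ≤ j → j ≤ m → ∃ T : ℝ, 0 ≤ T ∧
      T ≤ A * (4 ^ j₀ * Real.log N + 2 * (d + 1) * 4 ^ j) ∧
      ∀ x, heatEnergy Q p x T ≤ 2 * (B * 2 ^ (d * (m - j))) := by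
    intro j hj
    induction j, hj using Nat.le_induction with
    | base =>
      intro _
      refine ⟨A * 4 ^ j₀ * Real.log N, by positivity, ?_, fun x => ?_⟩
      · have : 0 ≤ A * (2 * ((d : ℝ) + 1) * 4 ^ j₀) := by positivity
        nlinarith
      · have h := heatEnergy_decay hp hrev hrow hoff (by positivity) (hNash j₀ le_rfl hjm) x
          le_rfl (s := A * 4 ^ j₀ * Real.log N) (by positivity)
        rw [zero_add, mul_div_cancel_left₀ _ (by positivity : A * (4 : ℝ) ^ j₀ ≠ 0), Real.exp_neg,
          Real.exp_log (by linarith), heatEnergy_zero] at h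
        have hB1 : 1 ≤ B * 2 ^ (d * (m - j₀)) := one_le_mul_of_one_le_of_one_le hB
          (one_le_pow₀ (by norm_num))
        have h2 : N⁻¹ * (1 / p x - B * 2 ^ (d * (m - j₀))) ≤ N⁻¹ * N :=
          mul_le_mul_of_nonneg_left (by linarith [hN x]) (by positivity)
        rw [inv_mul_cancel₀ (by positivity)] at h2
        linarith
    | succ j hj ih =>
      intro hjm'
      obtain ⟨T, hT0, hT, hu⟩ := ih (by omega)
      refine ⟨T + (d + 1) * (A * 4 ^ (j + 1)), by positivity, ?_, fun x => ?_⟩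
      · rw [pow_succ]
        have : 0 ≤ A * ((d : ℝ) + 1) * 4 ^ j := by positivity
        nlinarith
      · have h := heatEnergy_decay hp hrev hrow hoff (by positivity)
          (hNash (j + 1) (by omega) hjm') x hT0 (s := (d + 1) * (A * 4 ^ (j + 1))) (by positivity)
        rw [mul_div_cancel_right₀ _ (by positivity : A * (4 : ℝ) ^ (j + 1) ≠ 0)] at h
        have hB1 : 0 ≤ B * 2 ^ (d * (m - (j + 1))) := by positivity
        have e : (2 : ℝ) ^ (d * (m - j)) = 2 ^ d * 2 ^ (d * (m - (j + 1))) := by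
          rw [← pow_add]; congr 1
          rw [show m - j = (m - (j + 1)) + 1 by omega]; ring
        have hux := hu x
        rw [e] at hux
        have hexp : (2 : ℝ) ^ (d + 1) ≤ Real.exp (d + 1) := by
          have : (2 : ℝ) ≤ Real.exp 1 := by linarith [Real.add_one_le_exp (1 : ℝ)]
          calc (2 : ℝ) ^ (d + 1) ≤ (Real.exp 1) ^ (d + 1) := by gcongr
            _ = Real.exp (d + 1) := by rw [← Real.exp_nat_mul]; push_cast; ring_nf
        have h3 : Real.exp (-((d : ℝ) + 1)) * 2 ^ (d + 1) ≤ 1 := by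
          rw [Real.exp_neg, inv_mul_le_iff₀ (Real.exp_pos _)]; linarith
        have h4 : Real.exp (-((d : ℝ) + 1)) *
            (heatEnergy Q p x T - B * 2 ^ (d * (m - (j + 1)))) ≤
            Real.exp (-((d : ℝ) + 1)) * (2 ^ (d + 1) * (B * 2 ^ (d * (m - (j + 1))))) := by
          refine mul_le_mul_of_nonneg_left ?_ (Real.exp_pos _).le
          rw [pow_succ]; nlinarith
        nlinarith
  obtain ⟨T, hT0, hT, hu⟩ := hind m hjm le_rfl
  have hlB : 0 < Real.log (2 * B) := Real.log_pos (by linarith)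
  refine ⟨T + A * 4 ^ m * (Real.log (2 * B) + 1), by positivity, by nlinarith, fun x => ?_⟩
  have h := heatEnergy_decay hp hrev hrow hoff (by positivity) hPoinc x hT0
    (s := A * 4 ^ m * (Real.log (2 * B) + 1)) (by positivity)
  rw [mul_div_cancel_left₀ _ (by positivity : A * (4 : ℝ) ^ m ≠ 0)] at h
  have hux := hu x
  simp only [Nat.sub_self, mul_zero, pow_zero, mul_one] at hux
  refine h.trans ?_
  rw [neg_add, Real.exp_add, Real.exp_neg, Real.exp_log (by linarith)]
  have h5 : (2 * B)⁻¹ * (heatEnergy Q p x T - 1) ≤ 1 := by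
    rw [inv_mul_le_iff₀ (by linarith)]; linarith
  calc _ = ((2 * B)⁻¹ * (heatEnergy Q p x T - 1)) * Real.exp (-1) := by ring
    _ ≤ 1 * Real.exp (-1) := mul_le_mul_of_nonneg_right h5 (Real.exp_pos _).le
    _ = _ := one_mul _

lemma rate_comm (α : ℝ) (x y : Pt d) : rate α x y = rate α y x := by
  simp [rate, dist_comm]

lemma rate_pos (α : ℝ) (x y : Pt d) : 0 < rate α x y := Real.exp_pos _

/-- unnormalized Dirichlet energy. -/
def pairEnergy (α : ℝ) (E : Finset (Pt d)) (F : Pt d → ℝ) : ℝ :=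
  ∑ x ∈ E, ∑ y ∈ E, rate α x y * (F x - F y) ^ 2

/-- A Nash type inequality at a fixed scale for the weighted point set `E`. -/
def NashPoints (α : ℝ) (E : Finset (Pt d)) (i : ℕ) (A B : ℝ) : Prop :=
  ∀ F : Pt d → ℝ, (∀ x ∈ E, 0 ≤ F x) → ∑ x ∈ E, wgt α E i x * F x = Wsum α E i E →
    ∑ x ∈ E, wgt α E i x * F x ^ 2 ≤ A * pairEnergy α E F + B * Wsum α E i E

section Points

variable {α : ℝ} {E : Finset (Pt d)} {i : ℕ}

lemma gen_row_sum (x : ↥E) : ∑ y, gen α E i x y = 0 := by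
  have h1 : ∑ y : ↥E, gen α E i x y = gen α E i x x + ∑ y ∈ Finset.univ.erase x, gen α E i x y :=
    (Finset.add_sum_erase _ _ (Finset.mem_univ x)).symm
  have h2 : ∑ y ∈ Finset.univ.erase x, gen α E i x y
      = ∑ y ∈ Finset.univ.erase x, rate α (x : Pt d) (y : Pt d) / wgt α E i (x : Pt d) := by
    refine Finset.sum_congr rfl fun y hy => ?_
    have : x ≠ y := fun h => (Finset.ne_of_mem_erase hy) h.symm
    simp [gen, this]
  have h3 : ∑ y ∈ Finset.univ.erase x, rate α (x : Pt d) (y : Pt d) / wgt α E i (x : Pt d)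
      = ∑ z ∈ E.erase (x : Pt d), rate α (x : Pt d) z / wgt α E i (x : Pt d) := by
    refine Finset.sum_bij (fun y _ => (y : Pt d)) ?_ ?_ ?_ ?_
    · intro y hy
      exact Finset.mem_erase.2
        ⟨fun h => (Finset.ne_of_mem_erase hy) (Subtype.ext h), y.2⟩
    · intro a _ b _ h; exact Subtype.ext h
    · intro z hz
      obtain ⟨h1, h2⟩ := Finset.mem_erase.1 hz
      exact ⟨⟨z, h2⟩, Finset.mem_erase.2 ⟨fun h => h1 (congrArg Subtype.val h),
        Finset.mem_univ _⟩, rfl⟩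
    · intro y _; rfl
  rw [h1, h2, h3]
  simp [gen]

lemma nu_mul_gen (hw : ∀ x ∈ E, 0 < wgt α E i x) {x y : ↥E} (h : x ≠ y) :
    nu α E i x * gen α E i x y = rate α (x : Pt d) (y : Pt d) / Wsum α E i E := by
  have := (hw x x.2).ne'
  simp only [nu, gen, Matrix.of_apply, h, if_false]
  field_simp

lemma nu_mul_gen_comm (hw : ∀ x ∈ E, 0 < wgt α E i x) (x y : ↥E) :
    nu α E i x * gen α E i x y = nu α E i y * gen α E i y x := by
  by_cases h : x = y
  · rw [h]
  · rw [nu_mul_gen hw h, nu_mul_gen hw (Ne.symm h), rate_comm]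

lemma nashAt_of_nashPoints (hw : ∀ x ∈ E, 0 < wgt α E i x) (hW : 0 < Wsum α E i E) {A B : ℝ}
    (h : NashPoints α E i A B) :
    NashAt (gen α E i) (fun x : ↥E => nu α E i (x : Pt d)) A B := by
  intro f hf hf1
  set F : Pt d → ℝ := fun x => if hx : x ∈ E then f ⟨x, hx⟩ else 0 with hF
  have hFf : ∀ x : ↥E, F x = f x := fun x => by simp [hF]
  have hsum : ∀ g : Pt d → ℝ, ∑ x ∈ E, g x = ∑ x : ↥E, g x :=
    fun g => (Finset.sum_coe_sort E g).symm
  have h1 := h F (fun x hx => by simp only [hF, hx, dif_pos]; exact hf _) (by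
    rw [hsum]
    have : ∑ x : ↥E, nu α E i (x : Pt d) * f x
        = (∑ x : ↥E, wgt α E i (x : Pt d) * F x) / Wsum α E i E := by
      rw [Finset.sum_div]
      refine Finset.sum_congr rfl fun x _ => ?_
      rw [hFf, nu]; ring
    rw [hf1, eq_div_iff hW.ne', one_mul] at this
    exact this.symm)
  have e1 : ∑ x : ↥E, nu α E i (x : Pt d) * f x ^ 2
      = (∑ x ∈ E, wgt α E i x * F x ^ 2) / Wsum α E i E := by
    rw [hsum, Finset.sum_div]
    refine Finset.sum_congr rfl fun x _ => ?_
    rw [hFf, nu]; ring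
  have e2 : ∑ x : ↥E, ∑ y : ↥E, nu α E i (x : Pt d) * gen α E i x y * (f x - f y) ^ 2
      = pairEnergy α E F / Wsum α E i E := by
    unfold pairEnergy
    rw [hsum, Finset.sum_div]
    refine Finset.sum_congr rfl fun x _ => ?_
    rw [hsum, Finset.sum_div]
    refine Finset.sum_congr rfl fun y _ => ?_
    by_cases hxy : x = y
    · subst hxy; simp
    · rw [nu_mul_gen hw hxy, hFf, hFf]; ring
  rw [e1, e2, div_le_iff₀ hW, add_mul, mul_assoc, div_mul_cancel₀ _ hW.ne']
  exact h1

/-- Multi-scale Nash inequalities bound the uniform mixing time. -/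
lemma mixTime_le_of_nashPoints (hw : ∀ x ∈ E, 0 < wgt α E i x) (hE : E.Nonempty)
    {A B N : ℝ} (hA : 0 < A) (hB : 1 ≤ B) (hN1 : 1 ≤ N)
    (hN : ∀ x ∈ E, Wsum α E i E ≤ N * wgt α E i x) (k j₀ m : ℕ) (hjm : j₀ ≤ m)
    (hNash : ∀ j, j₀ ≤ j → j ≤ m → NashPoints α E i (A * 4 ^ j) (B * 2 ^ (k * (m - j))))
    (hPoinc : NashPoints α E i (A * 4 ^ m) 1) :
    mixTime α E i ≤ ENNReal.ofReal
      (2 * (A * (4 ^ j₀ * Real.log N + (2 * (k + 1) + Real.log (2 * B) + 1) * 4 ^ m))) := by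
  have hW : 0 < Wsum α E i E := Finset.sum_pos hw hE
  have hp : ∀ x : ↥E, 0 < nu α E i (x : Pt d) := fun x => div_pos (hw x x.2) hW
  have hp1 : ∑ x : ↥E, nu α E i (x : Pt d) = 1 := by
    rw [Finset.sum_coe_sort E (fun x => nu α E i x)]
    simp only [nu]
    rw [← Finset.sum_div]
    exact div_self hW.ne'
  have hoff : ∀ x y : ↥E, x ≠ y → 0 ≤ gen α E i x y := by
    intro x y h
    simp only [gen, Matrix.of_apply, h, if_false]
    exact div_nonneg (rate_pos _ _ _).le (hw x x.2).le
  obtain ⟨t, ht0, ht, hu⟩ := exists_time_heatEnergy_le (Q := gen α E i)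
    (p := fun x : ↥E => nu α E i (x : Pt d)) hp (nu_mul_gen_comm hw) gen_row_sum hoff hA hB hN1
    (fun x => by
      rw [nu, one_div_div, div_le_iff₀ (hw x x.2)]; exact hN x x.2) k j₀ m hjm
    (fun j h1 h2 => nashAt_of_nashPoints hw hW (hNash j h1 h2))
    (nashAt_of_nashPoints hw hW hPoinc)
  have hmix : mixTime α E i ≤ ENNReal.ofReal (2 * t) := by
    refine iInf_le_of_le (2 * t) (iInf_le_of_le (by positivity) (iInf_le_of_le ?_ le_rfl))
    intro x y
    have := heatKernel_abs_sub_le (Q := gen α E i) (p := fun x : ↥E => nu α E i (x : Pt d)) hp hp1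
      (nu_mul_gen_comm hw) gen_row_sum hu x y
    rwa [← (matrix_hasSum_exp_entry (gen α E i) (2 * t) x y).tsum_eq] at this
  refine hmix.trans (ENNReal.ofReal_le_ofReal ?_)
  linarith

end Points

/-- dyadic grid of side `2 ^ m`. -/
abbrev Grid (d m : ℕ) := Fin d → Fin (2 ^ m)

/-- the dyadic segment of length `2 ^ j` containing `t`. -/
def seg {m : ℕ} (j : ℕ) (t : Fin (2 ^ m)) : Finset (Fin (2 ^ m)) :=
  Finset.univ.filter fun s => s.1 / 2 ^ j = t.1 / 2 ^ j

lemma mem_seg {m j : ℕ} {s t : Fin (2 ^ m)} : s ∈ seg j t ↔ s.1 / 2 ^ j = t.1 / 2 ^ j := by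
  simp [seg]

lemma self_mem_seg {m j : ℕ} (t : Fin (2 ^ m)) : t ∈ seg j t := mem_seg.2 rfl

lemma seg_eq {m j : ℕ} {s t : Fin (2 ^ m)} (h : s ∈ seg j t) : seg j s = seg j t := by
  ext u; rw [mem_seg, mem_seg, mem_seg.1 h]

lemma card_seg {m j : ℕ} (hj : j ≤ m) (t : Fin (2 ^ m)) : (seg j t).card = 2 ^ j := by
  have hpos : 0 < 2 ^ j := by positivity
  have hdvd : 2 ^ m = 2 ^ (m - j) * 2 ^ j := by rw [← pow_add]; congr 1; omega
  have hq : t.1 / 2 ^ j < 2 ^ (m - j) := by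
    rw [Nat.div_lt_iff_lt_mul hpos, ← hdvd]; exact t.2
  have hlt : ∀ i, i < 2 ^ j → t.1 / 2 ^ j * 2 ^ j + i < 2 ^ m := by
    intro i hi
    calc t.1 / 2 ^ j * 2 ^ j + i < (t.1 / 2 ^ j + 1) * 2 ^ j := by rw [add_mul]; omega
      _ ≤ 2 ^ (m - j) * 2 ^ j := Nat.mul_le_mul_right _ hq
      _ = 2 ^ m := hdvd.symm
  rw [← Finset.card_range (2 ^ j)]
  symm
  refine Finset.card_bij (fun i hi => ⟨t.1 / 2 ^ j * 2 ^ j + i, hlt i (Finset.mem_range.1 hi)⟩)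
    ?_ ?_ ?_
  · intro i hi
    rw [mem_seg]
    have := Finset.mem_range.1 hi
    simp only
    rw [add_comm, Nat.add_mul_div_right _ _ hpos, Nat.div_eq_of_lt this, zero_add]
  · intro a _ b _ h
    have := congrArg Fin.val h
    simp only at this
    omega
  · intro s hs
    rw [mem_seg] at hs
    refine ⟨s.1 % 2 ^ j, Finset.mem_range.2 (Nat.mod_lt _ hpos), ?_⟩
    apply Fin.ext
    simp only
    rw [← hs, Nat.div_add_mod']

section LineOps

variable {m : ℕ}

/-- sum over the dyadic segment in direction `k` through `b`. -/
def lineSum (j : ℕ) (k : Fin d) (h : Grid d m → ℝ) (b : Grid d m) : ℝ :=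
  ∑ s ∈ seg j (b k), h (Function.update b k s)

/-- average over the dyadic segment in direction `k` through `b`. -/
def lineAvg (j : ℕ) (k : Fin d) (h : Grid d m → ℝ) (b : Grid d m) : ℝ :=
  lineSum j k h b / 2 ^ j

variable {j : ℕ} {k : Fin d}

lemma lineSum_update (h : Grid d m → ℝ) (b : Grid d m) {s : Fin (2 ^ m)} (hs : s ∈ seg j (b k)) :
    lineSum j k h (Function.update b k s) = lineSum j k h b := by
  simp only [lineSum, Function.update_self, Function.update_idem]
  rw [seg_eq hs]

lemma lineSum_mono {h h' : Grid d m → ℝ} (hh : ∀ b, h b ≤ h' b) (b : Grid d m) :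
    lineSum j k h b ≤ lineSum j k h' b :=
  Finset.sum_le_sum fun _ _ => hh _

lemma lineSum_nonneg {h : Grid d m → ℝ} (hh : ∀ b, 0 ≤ h b) (b : Grid d m) :
    0 ≤ lineSum j k h b := Finset.sum_nonneg fun _ _ => hh _

lemma sum_mul_lineSum (u h : Grid d m → ℝ) :
    ∑ b, u b * lineSum j k h b = ∑ b, h b * lineSum j k u b := by
  simp only [lineSum, Finset.mul_sum]
  rw [Finset.sum_sigma', Finset.sum_sigma']
  refine Finset.sum_bij' (fun p _ => ⟨Function.update p.1 k p.2, p.1 k⟩)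
    (fun p _ => ⟨Function.update p.1 k p.2, p.1 k⟩) ?_ ?_ ?_ ?_ ?_
  · rintro ⟨b, s⟩ hp
    have := (Finset.mem_sigma.1 hp).2
    simp only [Finset.mem_sigma, Finset.mem_univ, true_and, Function.update_self, mem_seg] at this ⊢
    exact this.symm
  · rintro ⟨b, s⟩ hp
    have := (Finset.mem_sigma.1 hp).2
    simp only [Finset.mem_sigma, Finset.mem_univ, true_and, Function.update_self, mem_seg] at this ⊢
    exact this.symm
  · rintro ⟨b, s⟩ _; simp
  · rintro ⟨b, s⟩ _; simp
  · rintro ⟨b, s⟩ _; simp; ring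

lemma sum_mul_lineAvg (u h : Grid d m → ℝ) :
    ∑ b, u b * lineAvg j k h b = ∑ b, h b * lineAvg j k u b := by
  simp only [lineAvg, mul_div_assoc', ← Finset.sum_div]
  rw [sum_mul_lineSum]

lemma lineSum_const (hj : j ≤ m) (c : ℝ) (b : Grid d m) :
    lineSum j k (fun _ => c) b = 2 ^ j * c := by
  simp [lineSum, card_seg hj]

lemma lineAvg_const (hj : j ≤ m) (c : ℝ) (b : Grid d m) :
    lineAvg j k (fun _ => c) b = c := by
  rw [lineAvg, lineSum_const hj, mul_div_cancel_left₀ _ (by positivity)]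

lemma lineAvg_mono {h h' : Grid d m → ℝ} (hh : ∀ b, h b ≤ h' b) (b : Grid d m) :
    lineAvg j k h b ≤ lineAvg j k h' b :=
  div_le_div_of_nonneg_right (lineSum_mono hh b) (by positivity)

lemma lineAvg_nonneg {h : Grid d m → ℝ} (hh : ∀ b, 0 ≤ h b) (b : Grid d m) :
    0 ≤ lineAvg j k h b := div_nonneg (lineSum_nonneg hh b) (by positivity)

lemma lineAvg_sub (h h' : Grid d m → ℝ) (b : Grid d m) :
    lineAvg j k (fun x => h x - h' x) b = lineAvg j k h b - lineAvg j k h' b := by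
  simp [lineAvg, lineSum, Finset.sum_sub_distrib, sub_div]

lemma lineAvg_sq_le (hj : j ≤ m) (h : Grid d m → ℝ) (b : Grid d m) :
    (lineAvg j k h b) ^ 2 ≤ lineAvg j k (fun x => h x ^ 2) b := by
  have h1 := sq_sum_le_card_mul_sum_sq (s := seg j (b k))
    (f := fun s => h (Function.update b k s))
  rw [card_seg hj] at h1
  push_cast at h1
  simp only [lineAvg, lineSum]
  rw [div_pow, div_le_div_iff₀ (by positivity) (by positivity)]
  have : (0 : ℝ) < 2 ^ j := by positivity
  nlinarith

/-- if `h` is constant along the segments in direction `k`, averaging does nothing. -/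
lemma lineAvg_of_invariant (hj : j ≤ m) {h : Grid d m → ℝ}
    (hh : ∀ b, ∀ s ∈ seg j (b k), h (Function.update b k s) = h b) (b : Grid d m) :
    lineAvg j k h b = h b := by
  rw [lineAvg, lineSum, Finset.sum_congr rfl (hh b), Finset.sum_const, card_seg hj, nsmul_eq_mul]
  push_cast
  rw [mul_div_cancel_left₀ _ (by positivity)]

/-- iterated averages. -/
def avgList (j : ℕ) : List (Fin d) → (Grid d m → ℝ) → Grid d m → ℝ
  | [], g => g
  | k :: l, g => lineAvg j k (avgList j l g)

lemma avgList_invariant (l : List (Fin d)) (g : Grid d m → ℝ) {k : Fin d} (hk : k ∈ l)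
    (b : Grid d m) {s : Fin (2 ^ m)} (hs : s ∈ seg j (b k)) :
    avgList j l g (Function.update b k s) = avgList j l g b := by
  induction l generalizing b s with
  | nil => simp at hk
  | cons k' l ih =>
    by_cases hkk : k = k'
    · subst hkk
      simp only [avgList, lineAvg]
      rw [lineSum_update _ _ hs]
    · have hkl : k ∈ l := by simpa [hkk] using hk
      simp only [avgList, lineAvg, lineSum]
      rw [Function.update_of_ne (Ne.symm hkk)]
      congr 1
      refine Finset.sum_congr rfl fun u _ => ?_
      rw [Function.update_comm hkk]
      exact ih hkl _ (by rwa [Function.update_of_ne hkk])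

lemma sum_mul_sub_avgList_sq_le (hj : j ≤ m) {a X : ℝ} (g : Grid d m → ℝ)
    (hX : ∀ ω : Grid d m → ℝ, (∀ b, 0 ≤ ω b) → (∀ k b, lineAvg j k ω b ≤ a) →
      ∀ k, ∑ b, ω b * (g b - lineAvg j k g b) ^ 2 ≤ X)
    (l : List (Fin d)) (ω : Grid d m → ℝ) (h0 : ∀ b, 0 ≤ ω b) (ha : ∀ k b, lineAvg j k ω b ≤ a) :
    ∑ b, ω b * (g b - avgList j l g b) ^ 2 ≤ (2 ^ (l.length + 1) - 2) * X := by
  induction l generalizing ω with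
  | nil => simp [avgList]
  | cons k l ih =>
    have h1 := hX ω h0 ha k
    have h2 := ih (lineAvg j k ω) (lineAvg_nonneg h0) (fun k' b =>
      (lineAvg_mono (ha k) b).trans (lineAvg_const hj a b).le)
    have h3 : ∑ b, ω b * (g b - avgList j (k :: l) g b) ^ 2 ≤
        2 * ∑ b, ω b * (g b - lineAvg j k g b) ^ 2 +
        2 * ∑ b, ω b * (lineAvg j k (fun x => (g x - avgList j l g x) ^ 2) b) := by
      rw [Finset.mul_sum, Finset.mul_sum, ← Finset.sum_add_distrib]
      refine Finset.sum_le_sum fun b _ => ?_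
      have e1 := lineAvg_sub (j := j) (k := k) g (avgList j l g) b
      have e2 := lineAvg_sq_le (k := k) hj (fun x => g x - avgList j l g x) b
      rw [e1] at e2
      simp only [avgList]
      have e3 : (g b - lineAvg j k (avgList j l g) b) ^ 2 ≤
          2 * (g b - lineAvg j k g b) ^ 2 +
            2 * (lineAvg j k g b - lineAvg j k (avgList j l g) b) ^ 2 := by
        nlinarith [sq_nonneg ((g b - lineAvg j k g b) -
          (lineAvg j k g b - lineAvg j k (avgList j l g) b))]
      nlinarith [mul_le_mul_of_nonneg_left e3 (h0 b), mul_le_mul_of_nonneg_left e2 (h0 b)]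
    rw [sum_mul_lineAvg] at h3
    simp only [mul_comm _ (lineAvg j k ω _)] at h3
    rw [List.length_cons, pow_succ]
    linarith

/-- consecutive pairs in the segment of `t`. -/
def segPairs {m : ℕ} (j : ℕ) (t : Fin (2 ^ m)) : Finset (Fin (2 ^ m) × Fin (2 ^ m)) :=
  (seg j t ×ˢ seg j t).filter fun p => p.2.1 = p.1.1 + 1

lemma abs_sub_le_sum_segPairs (φ : Fin (2 ^ m) → ℝ) {t u v : Fin (2 ^ m)} (hu : u ∈ seg j t)
    (hv : v ∈ seg j t) : |φ v - φ u| ≤ ∑ p ∈ segPairs j t, |φ p.2 - φ p.1| := by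
  have key : ∀ n : ℕ, ∀ u v : Fin (2 ^ m), u ∈ seg j t → v ∈ seg j t → v.1 = u.1 + n →
      |φ v - φ u| ≤ ∑ p ∈ (segPairs j t).filter (fun p => p.1.1 < v.1), |φ p.2 - φ p.1| := by
    intro n
    induction n with
    | zero =>
      intro u v _ _ h
      have : v = u := Fin.ext h
      subst this
      rw [sub_self, abs_zero]
      exact Finset.sum_nonneg fun _ _ => abs_nonneg _
    | succ n ih =>
      intro u v hu hv h
      set w : Fin (2 ^ m) := ⟨u.1 + n, by have := v.2; omega⟩ with hw
      have hwv : v.1 = w.1 + 1 := by simp [hw]; omega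
      have hwm : w ∈ seg j t := by
        rw [mem_seg] at hu hv ⊢
        apply le_antisymm
        · rw [← hv]; exact Nat.div_le_div_right (by omega)
        · rw [← hu]; exact Nat.div_le_div_right (by simp [hw])
      have h1 := ih u w hu hwm rfl
      have hsub : insert (w, v) ((segPairs j t).filter (fun p => p.1.1 < w.1)) ⊆
          (segPairs j t).filter (fun p => p.1.1 < v.1) := by
        intro p hp
        rcases Finset.mem_insert.1 hp with rfl | hp
        · simp only [segPairs, Finset.mem_filter, Finset.mem_product]
          exact ⟨⟨⟨hwm, hv⟩, hwv⟩, by omega⟩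
        · rw [Finset.mem_filter] at hp ⊢
          exact ⟨hp.1, by omega⟩
      refine le_trans ?_ (Finset.sum_le_sum_of_subset_of_nonneg hsub fun _ _ _ => abs_nonneg _)
      rw [Finset.sum_insert (by simp)]
      have := abs_add_le (φ v - φ w) (φ w - φ u)
      rw [sub_add_sub_cancel] at this
      linarith
  have hle : ∀ v : Fin (2 ^ m), ∑ p ∈ (segPairs j t).filter (fun p => p.1.1 < v.1), |φ p.2 - φ p.1|
      ≤ ∑ p ∈ segPairs j t, |φ p.2 - φ p.1| := fun v =>
    Finset.sum_le_sum_of_subset_of_nonneg (Finset.filter_subset _ _) fun _ _ _ => abs_nonneg _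
  rcases le_total u.1 v.1 with h | h
  · exact (key (v.1 - u.1) u v hu hv (by omega)).trans (hle v)
  · rw [abs_sub_comm]
    exact (key (u.1 - v.1) v u hv hu (by omega)).trans (hle u)

/-- weighted squared gradient of `g` at `b` in direction `k`. -/
def gradSq (θ g : Grid d m → ℝ) (k : Fin d) (b : Grid d m) : ℝ :=
  ∑ v : Fin (2 ^ m), if v.1 = (b k).1 + 1 then
    (g (Function.update b k v) - g b) ^ 2 / (θ b + θ (Function.update b k v)) else 0

lemma gradSq_nonneg {θ : Grid d m → ℝ} (hθ : ∀ b, 0 < θ b) (g : Grid d m → ℝ) (k : Fin d)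
    (b : Grid d m) : 0 ≤ gradSq θ g k b := by
  refine Finset.sum_nonneg fun v _ => ?_
  split_ifs
  · exact div_nonneg (sq_nonneg _) (add_pos (hθ _) (hθ _)).le
  · exact le_rfl

lemma sub_lineAvg_sq_le (hj : j ≤ m) {θ : Grid d m → ℝ} (hθ : ∀ b, 0 < θ b) (g : Grid d m → ℝ)
    (b : Grid d m) :
    (g b - lineAvg j k g b) ^ 2 ≤ (2 * lineSum j k θ b) * lineSum j k (gradSq θ g k) b := by
  set S := (2 * lineSum j k θ b) * lineSum j k (gradSq θ g k) b with hS
  have hosc : ∀ s ∈ seg j (b k), (g b - g (Function.update b k s)) ^ 2 ≤ S := by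
    intro s hs
    set φ : Fin (2 ^ m) → ℝ := fun s => g (Function.update b k s) with hφ
    set τ : Fin (2 ^ m) → ℝ := fun s => θ (Function.update b k s) with hτ
    have hτ0 : ∀ s, 0 < τ s := fun s => hθ _
    have h1 := abs_sub_le_sum_segPairs φ hs (self_mem_seg (j := j) (b k))
    have h2 : (g b - g (Function.update b k s)) ^ 2 ≤
        (∑ p ∈ segPairs j (b k), |φ p.2 - φ p.1|) ^ 2 := by
      rw [← sq_abs]
      refine pow_le_pow_left₀ (abs_nonneg _) ?_ 2
      simpa [hφ] using h1
    have h3 := Finset.sum_sq_le_sum_mul_sum_of_sq_le_mul (segPairs j (b k))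
      (r := fun p => |φ p.2 - φ p.1|)
      (f := fun p => τ p.1 + τ p.2) (g := fun p => (φ p.2 - φ p.1) ^ 2 / (τ p.1 + τ p.2))
      (fun p _ => (add_pos (hτ0 _) (hτ0 _)).le)
      (fun p _ => div_nonneg (sq_nonneg _) (add_pos (hτ0 _) (hτ0 _)).le)
      (fun p _ => by rw [sq_abs, mul_div_cancel₀ _ (add_pos (hτ0 _) (hτ0 _)).ne'])
    refine h2.trans (h3.trans ?_)
    rw [hS]
    refine mul_le_mul ?_ ?_ (Finset.sum_nonneg fun p _ =>
      div_nonneg (sq_nonneg _) (add_pos (hτ0 _) (hτ0 _)).le)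
      (mul_nonneg (by norm_num) (lineSum_nonneg (fun b => (hθ b).le) b))
    · rw [Finset.sum_add_distrib, two_mul]
      refine add_le_add ?_ ?_
      · calc ∑ p ∈ segPairs j (b k), τ p.1 = ∑ u ∈ (segPairs j (b k)).image Prod.fst, τ u := by
              rw [Finset.sum_image]
              intro p hp q hq h
              simp only [segPairs, Finset.coe_filter, Set.mem_ofPred_eq] at hp hq
              exact Prod.ext h (Fin.ext (by rw [hp.2, hq.2, h]))
          _ ≤ _ := Finset.sum_le_sum_of_subset_of_nonneg (by
              intro u hu
              obtain ⟨p, hp, rfl⟩ := Finset.mem_image.1 hu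
              exact (Finset.mem_product.1 (Finset.mem_filter.1 hp).1).1) fun _ _ _ => (hτ0 _).le
      · calc ∑ p ∈ segPairs j (b k), τ p.2 = ∑ u ∈ (segPairs j (b k)).image Prod.snd, τ u := by
              rw [Finset.sum_image]
              intro p hp q hq h
              simp only [segPairs, Finset.coe_filter, Set.mem_ofPred_eq] at hp hq
              refine Prod.ext (Fin.ext ?_) h
              have := congrArg Fin.val h
              omega
          _ ≤ _ := Finset.sum_le_sum_of_subset_of_nonneg (by
              intro u hu
              obtain ⟨p, hp, rfl⟩ := Finset.mem_image.1 hu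
              exact (Finset.mem_product.1 (Finset.mem_filter.1 hp).1).2) fun _ _ _ => (hτ0 _).le
    · simp only [lineSum, gradSq, segPairs, Finset.sum_filter, Finset.sum_product,
        Function.update_self, Function.update_idem]
      refine Finset.sum_le_sum fun u _ => ?_
      refine Finset.sum_le_sum_of_subset_of_nonneg (Finset.subset_univ _) fun v _ _ => ?_
      split_ifs
      · exact div_nonneg (sq_nonneg _) (add_pos (hτ0 _) (hτ0 _)).le
      · exact le_rfl
  have h4 : (g b - lineAvg j k g b) ^ 2 = (lineAvg j k (fun x => g b - g x) b) ^ 2 := by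
    rw [lineAvg_sub (fun _ => g b) g, lineAvg_const hj]
  rw [h4]
  refine (lineAvg_sq_le hj _ b).trans ?_
  rw [lineAvg, div_le_iff₀ (by positivity), lineSum]
  refine (Finset.sum_le_sum hosc).trans ?_
  rw [Finset.sum_const, card_seg hj, nsmul_eq_mul]
  push_cast
  linarith

/-- Weighted Poincaré inequality on the dyadic cells of side `2 ^ j`. -/
lemma grid_poincare (hj : j ≤ m) {θ : Grid d m → ℝ} (hθ : ∀ b, 0 < θ b) {aθ a : ℝ}
    (haθ : ∀ k b, lineSum j k θ b ≤ aθ * 2 ^ j) (ha0 : 0 ≤ a) (haθ0 : 0 ≤ aθ)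
    (g ω : Grid d m → ℝ) (h0 : ∀ b, 0 ≤ ω b) (ha : ∀ k b, lineAvg j k ω b ≤ a) :
    ∑ b, ω b * (g b - avgList j (List.finRange d) g b) ^ 2 ≤
      2 ^ (d + 2) * aθ * a * 4 ^ j * ∑ k, ∑ b, gradSq θ g k b := by
  set V := ∑ k, ∑ b, gradSq θ g k b with hV
  have hV0 : 0 ≤ V := Finset.sum_nonneg fun k _ => Finset.sum_nonneg fun b _ =>
    gradSq_nonneg hθ g k b
  have hX : ∀ ω : Grid d m → ℝ, (∀ b, 0 ≤ ω b) → (∀ k b, lineAvg j k ω b ≤ a) →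
      ∀ k, ∑ b, ω b * (g b - lineAvg j k g b) ^ 2 ≤ 2 * aθ * a * 4 ^ j * V := by
    intro ω h0 ha k
    calc ∑ b, ω b * (g b - lineAvg j k g b) ^ 2
        ≤ ∑ b, (2 * (aθ * 2 ^ j)) * (ω b * lineSum j k (gradSq θ g k) b) := by
          refine Finset.sum_le_sum fun b _ => ?_
          have h1 := sub_lineAvg_sq_le (k := k) hj hθ g b
          have h2 := lineSum_nonneg (j := j) (k := k) (gradSq_nonneg hθ g k) b
          have h3 : (g b - lineAvg j k g b) ^ 2 ≤
              (2 * (aθ * 2 ^ j)) * lineSum j k (gradSq θ g k) b :=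
            h1.trans (mul_le_mul_of_nonneg_right (by linarith [haθ k b]) h2)
          calc _ ≤ ω b * ((2 * (aθ * 2 ^ j)) * lineSum j k (gradSq θ g k) b) :=
                mul_le_mul_of_nonneg_left h3 (h0 b)
            _ = _ := by ring
      _ = (2 * (aθ * 2 ^ j)) * ∑ b, gradSq θ g k b * lineSum j k ω b := by
          rw [← Finset.mul_sum, sum_mul_lineSum]
      _ ≤ (2 * (aθ * 2 ^ j)) * ∑ b, gradSq θ g k b * (a * 2 ^ j) := by
          refine mul_le_mul_of_nonneg_left (Finset.sum_le_sum fun b _ => ?_) (by positivity)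
          refine mul_le_mul_of_nonneg_left ?_ (gradSq_nonneg hθ g k b)
          have := ha k b
          rwa [lineAvg, div_le_iff₀ (by positivity)] at this
      _ = 2 * aθ * a * 4 ^ j * ∑ b, gradSq θ g k b := by
          rw [← Finset.sum_mul, show (4 : ℝ) ^ j = 2 ^ j * 2 ^ j by rw [← mul_pow]; norm_num]
          ring
      _ ≤ _ := by
          refine mul_le_mul_of_nonneg_left ?_ (by positivity)
          exact Finset.single_le_sum (f := fun k => ∑ b, gradSq θ g k b)
            (fun k _ => Finset.sum_nonneg fun b _ => gradSq_nonneg hθ g k b) (Finset.mem_univ k)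
  have h := sum_mul_sub_avgList_sq_le hj g hX (List.finRange d) ω h0 ha
  rw [List.length_finRange] at h
  refine h.trans ?_
  have : 0 ≤ 2 * aθ * a * 4 ^ j * V := by positivity
  rw [pow_succ 2 (d + 1)]
  nlinarith

end LineOps

section Kernel

lemma sum_range_exp_half_le (c M : ℕ) :
    ∑ q ∈ Finset.range M, Real.exp (-|(c : ℝ) - q| / 2) ≤ 6 := by
  set r : ℝ := Real.exp (-1 / 2) with hr
  have hr0 : 0 < r := Real.exp_pos _
  have hr1 : r ≤ 2 / 3 := by
    rw [hr, neg_div, Real.exp_neg, inv_le_comm₀ (Real.exp_pos _) (by norm_num)]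
    linarith [Real.add_one_le_exp (1 / 2 : ℝ)]
  have hgeo : ∀ n : ℕ, ∑ q ∈ Finset.range n, r ^ q ≤ 3 := by
    intro n
    have h := (summable_geometric_of_lt_one hr0.le (by linarith : r < 1)).sum_le_tsum
      (Finset.range n) (fun i _ => by positivity)
    rw [tsum_geometric_of_lt_one hr0.le (by linarith)] at h
    refine h.trans ?_
    rw [inv_le_comm₀ (by linarith) (by norm_num)]
    linarith
  have hterm : ∀ q : ℕ, Real.exp (-|(c : ℝ) - q| / 2) ≤
      (if q < c + 1 then r ^ (c - q) else 0) + (if c ≤ q then r ^ (q - c) else 0) := by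
    intro q
    rcases le_total q c with h | h
    · have e : Real.exp (-|(c : ℝ) - q| / 2) = r ^ (c - q) := by
        rw [hr, ← Real.exp_nat_mul, Nat.cast_sub h, abs_of_nonneg (by
          rw [sub_nonneg]; exact_mod_cast h)]
        congr 1; ring
      rw [e, if_pos (by omega)]
      have : 0 ≤ (if c ≤ q then r ^ (q - c) else 0) := by split_ifs <;> positivity
      linarith
    · have e : Real.exp (-|(c : ℝ) - q| / 2) = r ^ (q - c) := by
        rw [hr, ← Real.exp_nat_mul, Nat.cast_sub h, abs_of_nonpos (by
          rw [sub_nonpos]; exact_mod_cast h)]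
        congr 1; ring
      rw [e, if_pos h]
      have : 0 ≤ (if q < c + 1 then r ^ (c - q) else 0) := by split_ifs <;> positivity
      linarith
  have h1 : ∑ q ∈ Finset.range M, (if q < c + 1 then r ^ (c - q) else 0) ≤ 3 := by
    calc ∑ q ∈ Finset.range M, (if q < c + 1 then r ^ (c - q) else 0)
        = ∑ q ∈ (Finset.range M).filter (· < c + 1), r ^ (c - q) :=
          (Finset.sum_filter _ _).symm
      _ ≤ ∑ q ∈ Finset.range (c + 1), r ^ (c - q) :=
          Finset.sum_le_sum_of_subset_of_nonneg
            (fun q hq => Finset.mem_range.2 (Finset.mem_filter.1 hq).2)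
            (fun _ _ _ => by positivity)
      _ = ∑ q ∈ Finset.range (c + 1), r ^ q := Finset.sum_flip (fun q => r ^ q)
      _ ≤ 3 := hgeo _
  have h2 : ∑ q ∈ Finset.range M, (if c ≤ q then r ^ (q - c) else 0) ≤ 3 := by
    calc ∑ q ∈ Finset.range M, (if c ≤ q then r ^ (q - c) else 0)
        = ∑ q ∈ (Finset.range M).filter (c ≤ ·), r ^ (q - c) := (Finset.sum_filter _ _).symm
      _ ≤ ∑ q ∈ Finset.Ico c M, r ^ (q - c) :=
          Finset.sum_le_sum_of_subset_of_nonneg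
            (fun q hq => by
              have := Finset.mem_filter.1 hq
              exact Finset.mem_Ico.2 ⟨this.2, Finset.mem_range.1 this.1⟩)
            (fun _ _ _ => by positivity)
      _ = ∑ q ∈ Finset.range (M - c), r ^ q := by
          rw [Finset.sum_Ico_eq_sum_range]
          simp
      _ ≤ 3 := hgeo _
  calc _ ≤ ∑ q ∈ Finset.range M, ((if q < c + 1 then r ^ (c - q) else 0) +
        (if c ≤ q then r ^ (q - c) else 0)) := Finset.sum_le_sum fun q _ => hterm q
    _ ≤ 6 := by rw [Finset.sum_add_distrib]; linarith

lemma sum_exp_half_div_le {m : ℕ} (c j : ℕ) :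
    ∑ t : Fin (2 ^ m), Real.exp (-|(c : ℝ) - ((t.1 / 2 ^ j : ℕ) : ℝ)| / 2) ≤ 6 * 2 ^ j := by
  have hmaps : ∀ t ∈ (Finset.univ : Finset (Fin (2 ^ m))), t.1 / 2 ^ j ∈ Finset.range (2 ^ m) :=
    fun t _ => Finset.mem_range.2 ((Nat.div_le_self _ _).trans_lt t.2)
  rw [← Finset.sum_fiberwise_of_maps_to hmaps]
  calc _ ≤ ∑ q ∈ Finset.range (2 ^ m), 2 ^ j * Real.exp (-|(c : ℝ) - (q : ℝ)| / 2) := by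
        refine Finset.sum_le_sum fun q _ => ?_
        rw [Finset.sum_congr rfl (g := fun _ => Real.exp (-|(c : ℝ) - (q : ℝ)| / 2))
          (fun t ht => by rw [(Finset.mem_filter.1 ht).2]), Finset.sum_const, nsmul_eq_mul]
        refine mul_le_mul_of_nonneg_right ?_ (Real.exp_pos _).le
        have hc : (Finset.univ.filter fun t : Fin (2 ^ m) => t.1 / 2 ^ j = q).card ≤ 2 ^ j := by
          calc _ ≤ (Finset.Ico (q * 2 ^ j) (q * 2 ^ j + 2 ^ j)).card := by
                refine Finset.card_le_card_of_injOn Fin.val (fun t ht => ?_)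
                  (fun _ _ _ _ h => Fin.ext h)
                have ht : t.1 / 2 ^ j = q := by simpa using ht
                have h1 := Nat.div_add_mod' t.1 (2 ^ j)
                have h2 := Nat.mod_lt t.1 (by positivity : 0 < 2 ^ j)
                rw [ht] at h1
                simp only [Finset.coe_Ico, Set.mem_Ico]
                omega
            _ = 2 ^ j := by simp
        exact_mod_cast hc
    _ ≤ 2 ^ j * 6 := by
        rw [← Finset.mul_sum]
        exact mul_le_mul_of_nonneg_left (sum_range_exp_half_le c _) (by positivity)
    _ = 6 * 2 ^ j := by ring

variable {m : ℕ}

/-- exponential kernel on the grid. -/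
def gridKer (b b' : Grid d m) : ℝ := ∏ i, Real.exp (-|(b i : ℝ) - (b' i : ℝ)|)

lemma gridKer_pos (b b' : Grid d m) : 0 < gridKer b b' :=
  Finset.prod_pos fun _ _ => Real.exp_pos _

lemma gridKer_comm (b b' : Grid d m) : gridKer b b' = gridKer b' b := by
  simp only [gridKer, abs_sub_comm]

/-- exponential kernel which only sees the dyadic segment in direction `k`. -/
def segKer (j : ℕ) (k : Fin d) (b b' : Grid d m) : ℝ :=
  ∏ i, Real.exp (-|(((b i).1 / 2 ^ (if i = k then j else 0) : ℕ) : ℝ) -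
    (((b' i).1 / 2 ^ (if i = k then j else 0) : ℕ) : ℝ)| / 2)

lemma sum_segKer_le (j : ℕ) (k : Fin d) (b : Grid d m) :
    ∑ b', segKer j k b b' ≤ 6 ^ d * 2 ^ j := by
  simp only [segKer]
  rw [← Fintype.prod_sum (fun i (t : Fin (2 ^ m)) =>
    Real.exp (-|(((b i).1 / 2 ^ (if i = k then j else 0) : ℕ) : ℝ) -
    ((t.1 / 2 ^ (if i = k then j else 0) : ℕ) : ℝ)| / 2))]
  calc _ ≤ ∏ i : Fin d, ((6 : ℝ) * 2 ^ (if i = k then j else 0)) :=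
        Finset.prod_le_prod (fun i _ => Finset.sum_nonneg fun _ _ => (Real.exp_pos _).le)
          (fun i _ => sum_exp_half_div_le _ _)
    _ = 6 ^ d * 2 ^ j := by
        rw [Finset.prod_mul_distrib, Finset.prod_const, Finset.card_univ, Fintype.card_fin,
          Finset.prod_pow_eq_pow_sum]
        simp

lemma abs_div_sub_div_le (s t n : ℕ) :
    |((s / n : ℕ) : ℝ) - ((t / n : ℕ) : ℝ)| ≤ |(s : ℝ) - t| := by
  wlog h : t ≤ s generalizing s t
  · rw [abs_sub_comm, abs_sub_comm (s : ℝ)]; exact this t s (by omega)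
  rcases Nat.eq_zero_or_pos n with rfl | hn
  · simp
  have h1 : t / n ≤ s / n := Nat.div_le_div_right h
  have h2 : s / n ≤ t / n + (s - t) := by
    rw [← Nat.add_mul_div_left _ _ hn]
    refine Nat.div_le_div_right ?_
    nlinarith [Nat.sub_add_cancel h]
  rw [abs_of_nonneg (by rw [sub_nonneg]; exact_mod_cast h1),
    abs_of_nonneg (by rw [sub_nonneg]; exact_mod_cast h)]
  have h3 : ((s / n : ℕ) : ℝ) ≤ ((t / n : ℕ) : ℝ) + ((s - t : ℕ) : ℝ) := by exact_mod_cast h2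
  rw [Nat.cast_sub h] at h3
  linarith

lemma gridKer_le_segKer (j : ℕ) (k : Fin d) (b b' : Grid d m) :
    gridKer b b' ≤ Real.exp (-|(b k : ℝ) - (b' k : ℝ)| / 2) * segKer j k b b' := by
  have hk : Real.exp (-|(b k : ℝ) - (b' k : ℝ)| / 2) =
      ∏ i, (if i = k then Real.exp (-|(b i : ℝ) - (b' i : ℝ)| / 2) else 1) := by
    rw [Finset.prod_ite_eq' Finset.univ k]
    simp
  rw [hk, segKer, ← Finset.prod_mul_distrib]
  refine Finset.prod_le_prod (fun _ _ => (Real.exp_pos _).le) fun i _ => ?_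
  have h1 := abs_div_sub_div_le (b i).1 (b' i).1 (2 ^ (if i = k then j else 0))
  have h0 := abs_nonneg ((b i : ℝ) - (b' i : ℝ))
  split_ifs with h
  · rw [← Real.exp_add, Real.exp_le_exp]
    rw [if_pos h] at h1
    linarith
  · rw [one_mul, Real.exp_le_exp]
    rw [if_neg h] at h1
    linarith

lemma sum_gridKer_le (b : Grid d m) : ∑ b', gridKer b b' ≤ 6 ^ d := by
  simp only [gridKer]
  rw [← Fintype.prod_sum (fun i (t : Fin (2 ^ m)) => Real.exp (-|(b i : ℝ) - (t : ℝ)|))]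
  calc _ ≤ ∏ _i : Fin d, (6 : ℝ) := by
        refine Finset.prod_le_prod (fun i _ => Finset.sum_nonneg fun _ _ => (Real.exp_pos _).le)
          (fun i _ => ?_)
        refine le_trans ?_ ((sum_exp_half_div_le (m := m) (b i).1 0).trans_eq (by norm_num))
        refine Finset.sum_le_sum fun t _ => ?_
        rw [Real.exp_le_exp, pow_zero, Nat.div_one]
        linarith [abs_nonneg ((b i : ℝ) - (t : ℝ))]
    _ = 6 ^ d := by simp

lemma segKer_update_left (j : ℕ) (k : Fin d) (b b' : Grid d m) {s : Fin (2 ^ m)}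
    (hs : s ∈ seg j (b k)) : segKer j k (Function.update b k s) b' = segKer j k b b' := by
  refine Finset.prod_congr rfl fun i _ => ?_
  by_cases h : i = k
  · subst h
    rw [Function.update_self, if_pos rfl, mem_seg.1 hs]
  · rw [Function.update_of_ne h]

lemma segKer_update_right (j : ℕ) (k : Fin d) (b b' : Grid d m) {s : Fin (2 ^ m)}
    (hs : s ∈ seg j (b' k)) : segKer j k b (Function.update b' k s) = segKer j k b b' := by
  refine Finset.prod_congr rfl fun i _ => ?_
  by_cases h : i = k
  · subst h
    rw [Function.update_self, if_pos rfl, mem_seg.1 hs]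
  · rw [Function.update_of_ne h]

lemma lineAvg_conv_gridKer_le {j : ℕ} (hj : j ≤ m) (k : Fin d) {F : Grid d m → ℝ} {a : ℝ}
    (hF : ∀ b, 0 ≤ F b) (ha : ∀ b, lineAvg j k F b ≤ a) (b : Grid d m) :
    lineAvg j k (fun b => ∑ b', F b' * gridKer b b') b ≤ 6 ^ (d + 1) * a := by
  have hsum : lineSum j k (fun b => ∑ b', F b' * gridKer b b') b ≤
      6 * ∑ b', F b' * segKer j k b b' := by
    simp only [lineSum]
    rw [Finset.sum_comm, Finset.mul_sum]
    refine Finset.sum_le_sum fun b' _ => ?_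
    calc ∑ s ∈ seg j (b k), F b' * gridKer (Function.update b k s) b'
        ≤ ∑ s ∈ seg j (b k), F b' * segKer j k b b' *
            Real.exp (-|((b' k : ℕ) : ℝ) - ((s.1 / 2 ^ 0 : ℕ) : ℝ)| / 2) := by
          refine Finset.sum_le_sum fun s hs => ?_
          have h := gridKer_le_segKer j k (Function.update b k s) b'
          rw [segKer_update_left j k b b' hs, Function.update_self, abs_sub_comm] at h
          rw [pow_zero, Nat.div_one]
          calc _ ≤ F b' * _ := mul_le_mul_of_nonneg_left h (hF b')
            _ = _ := by ring
      _ ≤ F b' * segKer j k b b' * 6 := by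
          rw [← Finset.mul_sum]
          refine mul_le_mul_of_nonneg_left ?_ (mul_nonneg (hF b')
            (Finset.prod_nonneg fun _ _ => (Real.exp_pos _).le))
          refine le_trans (Finset.sum_le_univ_sum_of_nonneg fun _ => (Real.exp_pos _).le) ?_
          exact (sum_exp_half_div_le (m := m) (b' k).1 0).trans_eq (by norm_num)
      _ = _ := by ring
  have hinv : ∀ b', lineAvg j k (segKer j k b) b' = segKer j k b b' := fun b' =>
    lineAvg_of_invariant hj (fun b' s hs => segKer_update_right j k b b' hs) b'
  have h2 : ∑ b', F b' * segKer j k b b' ≤ a * (6 ^ d * 2 ^ j) := by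
    calc ∑ b', F b' * segKer j k b b' = ∑ b', F b' * lineAvg j k (segKer j k b) b' := by
          simp only [hinv]
      _ = ∑ b', segKer j k b b' * lineAvg j k F b' := sum_mul_lineAvg _ _
      _ ≤ ∑ b', segKer j k b b' * a := Finset.sum_le_sum fun b' _ =>
          mul_le_mul_of_nonneg_left (ha b') (Finset.prod_nonneg fun _ _ => (Real.exp_pos _).le)
      _ = a * ∑ b', segKer j k b b' := by rw [← Finset.sum_mul]; ring
      _ ≤ a * (6 ^ d * 2 ^ j) :=
          mul_le_mul_of_nonneg_left (sum_segKer_le j k b) ((lineAvg_nonneg hF b).trans (ha b))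
  rw [lineAvg, div_le_iff₀ (by positivity)]
  rw [pow_succ]
  linarith

end Kernel

section Boxes

variable {m : ℕ}

/-- `β` sends the points of `E` to the cells of a grid of mesh comparable to one. -/
structure IsGridMap (E : Finset (Pt d)) (β : Pt d → Grid d m) : Prop where
  dist_le : ∀ x ∈ E, ∀ y ∈ E, ∀ t : ℝ, (∀ i, |((β x i : ℕ) : ℝ) - (β y i : ℕ)| ≤ t) →
    dist x y ≤ 2 * √d * (t + 1)
  le_dist : ∀ x ∈ E, ∀ y ∈ E, ∀ i, |((β x i : ℕ) : ℝ) - (β y i : ℕ)| ≤ dist x y + 1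

/-- the points of `E` in the cell `b`. -/
def boxPts (E : Finset (Pt d)) (β : Pt d → Grid d m) (b : Grid d m) : Finset (Pt d) :=
  E.filter fun x => β x = b

/-- the number of points of `E` in the cell `b`. -/
def boxCount (E : Finset (Pt d)) (β : Pt d → Grid d m) (b : Grid d m) : ℕ :=
  (boxPts E β b).card

variable {E : Finset (Pt d)} {β : Pt d → Grid d m}

lemma mem_boxPts {b : Grid d m} {x : Pt d} : x ∈ boxPts E β b ↔ x ∈ E ∧ β x = b := by
  simp [boxPts]

lemma sum_boxPts (h : Pt d → ℝ) : ∑ b, ∑ x ∈ boxPts E β b, h x = ∑ x ∈ E, h x :=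
  Finset.sum_fiberwise E β h

lemma sum_comp_boxMap (h : Grid d m → ℝ) :
    ∑ x ∈ E, h (β x) = ∑ b, (boxCount E β b : ℝ) * h b := by
  rw [← sum_boxPts (β := β)]
  refine Finset.sum_congr rfl fun b _ => ?_
  rw [Finset.sum_congr rfl (g := fun _ => h b) fun x hx => by rw [(mem_boxPts.1 hx).2],
    Finset.sum_const, nsmul_eq_mul, boxCount]

lemma rate_nat (x y : Pt d) : rate (d : ℝ) x y = Real.exp (-dist x y ^ d) := by
  rw [rate, Real.rpow_natCast]

lemma rate_le_gridKer (hd : 2 ≤ d) (hβ : IsGridMap E β) {x y : Pt d} (hx : x ∈ E) (hy : y ∈ E) :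
    rate (d : ℝ) x y ≤ Real.exp ((d : ℝ) ^ 2 + d) * gridKer (β x) (β y) := by
  rw [rate_nat, gridKer, ← Real.exp_sum, ← Real.exp_add, Real.exp_le_exp, Finset.sum_neg_distrib]
  have h1 : ∑ i, |((β x i : ℕ) : ℝ) - (β y i : ℕ)| ≤ ∑ _i : Fin d, (dist x y + 1) :=
    Finset.sum_le_sum fun i _ => hβ.le_dist x hx y hy i
  rw [Finset.sum_const, Finset.card_univ, Fintype.card_fin, nsmul_eq_mul] at h1
  set r := dist x y
  have hr : 0 ≤ r := dist_nonneg
  have hd' : (2 : ℝ) ≤ d := by exact_mod_cast hd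
  have h2 : d * r ≤ r ^ d + d ^ 2 := by
    rcases le_total r d with h | h
    · have : 0 ≤ r ^ d := by positivity
      nlinarith
    · have h3 : r ^ 2 ≤ r ^ d := pow_le_pow_right₀ (by linarith) hd
      nlinarith
  nlinarith

lemma wgt_le_one_add (i : ℕ) (α : ℝ) (x : Pt d) :
    wgt α E i x ≤ 1 + ∑ z ∈ E.erase x, rate α x z := by
  have h : 0 ≤ ∑ z ∈ E.erase x, rate α x z := Finset.sum_nonneg fun _ _ => (rate_pos _ _ _).le
  unfold wgt
  split_ifs
  · linarith
  · linarith
  · exact max_le (by linarith) (by linarith)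

lemma wgt_nonneg (i : ℕ) (α : ℝ) (x : Pt d) : 0 ≤ wgt α E i x := by
  have h : 0 ≤ ∑ z ∈ E.erase x, rate α x z := Finset.sum_nonneg fun _ _ => (rate_pos _ _ _).le
  unfold wgt
  split_ifs
  · exact zero_le_one
  · exact h
  · exact le_max_of_le_left zero_le_one

lemma wgt_le_conv (hd : 2 ≤ d) (hβ : IsGridMap E β) (i : ℕ) {x : Pt d} (hx : x ∈ E) :
    wgt (d : ℝ) E i x ≤ 1 + Real.exp ((d : ℝ) ^ 2 + d) *
      ∑ b, (boxCount E β b : ℝ) * gridKer (β x) b := by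
  refine (wgt_le_one_add i _ x).trans ?_
  rw [← sum_comp_boxMap (E := E) (β := β) (fun b => gridKer (β x) b), Finset.mul_sum]
  have : ∑ z ∈ E.erase x, rate (d : ℝ) x z ≤
      ∑ z ∈ E, Real.exp ((d : ℝ) ^ 2 + d) * gridKer (β x) (β z) :=
    (Finset.sum_le_sum fun z hz => rate_le_gridKer hd hβ hx (Finset.mem_of_mem_erase hz)).trans
      (Finset.sum_le_sum_of_subset_of_nonneg (Finset.erase_subset _ _)
        fun z _ _ => mul_nonneg (Real.exp_pos _).le (gridKer_pos _ _).le)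
  linarith

lemma wgt_le_of_boxCount_le (hd : 2 ≤ d) (hβ : IsGridMap E β) (i : ℕ) {M : ℝ}
    (hM : ∀ b, (boxCount E β b : ℝ) ≤ M) {x : Pt d} (hx : x ∈ E) :
    wgt (d : ℝ) E i x ≤ 1 + Real.exp ((d : ℝ) ^ 2 + d) * (6 ^ d * M) := by
  refine (wgt_le_conv hd hβ i hx).trans ?_
  have h : ∑ b, (boxCount E β b : ℝ) * gridKer (β x) b ≤ 6 ^ d * M := by
    calc _ ≤ ∑ b, M * gridKer (β x) b :=
          Finset.sum_le_sum fun b _ => mul_le_mul_of_nonneg_right (hM b) (gridKer_pos _ _).le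
      _ = M * ∑ b, gridKer (β x) b := by rw [Finset.mul_sum]
      _ ≤ M * 6 ^ d := mul_le_mul_of_nonneg_left (sum_gridKer_le _)
          ((Nat.cast_nonneg _).trans (hM (β x)))
      _ = _ := mul_comm _ _
  have := mul_le_mul_of_nonneg_left h (Real.exp_pos ((d : ℝ) ^ 2 + d)).le
  linarith

/-- total weight of the cell `b`. -/
def boxWgt (i : ℕ) (E : Finset (Pt d)) (β : Pt d → Grid d m) (b : Grid d m) : ℝ :=
  ∑ x ∈ boxPts E β b, wgt (d : ℝ) E i x

lemma boxWgt_nonneg (i : ℕ) (b : Grid d m) : 0 ≤ boxWgt i E β b :=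
  Finset.sum_nonneg fun _ _ => wgt_nonneg _ _ _

lemma boxWgt_le (hd : 2 ≤ d) (hβ : IsGridMap E β) (i : ℕ) (b : Grid d m) :
    boxWgt i E β b ≤ (1 + Real.exp ((d : ℝ) ^ 2 + d) * 6 ^ d) * (boxCount E β b : ℝ) ^ 2 +
      Real.exp ((d : ℝ) ^ 2 + d) * ∑ b', (boxCount E β b' : ℝ) ^ 2 * gridKer b' b := by
  set Ck := Real.exp ((d : ℝ) ^ 2 + d)
  have hCk : 0 < Ck := Real.exp_pos _
  set N : Grid d m → ℝ := fun b => (boxCount E β b : ℝ) with hN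
  have hN0 : ∀ b, 0 ≤ N b := fun b => Nat.cast_nonneg _
  have h1 : boxWgt i E β b ≤ N b * (1 + Ck * ∑ b', N b' * gridKer b b') := by
    calc boxWgt i E β b ≤ ∑ x ∈ boxPts E β b, (1 + Ck * ∑ b', N b' * gridKer b b') := by
          refine Finset.sum_le_sum fun x hx => ?_
          obtain ⟨hxE, hxb⟩ := mem_boxPts.1 hx
          have := wgt_le_conv hd hβ i hxE
          rwa [hxb] at this
      _ = _ := by rw [Finset.sum_const, nsmul_eq_mul]; rfl
  have h2 : N b ≤ N b ^ 2 := by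
    have : boxCount E β b ≤ boxCount E β b ^ 2 := Nat.le_self_pow two_ne_zero _
    simp only [hN]
    exact_mod_cast this
  have h3 : N b * ∑ b', N b' * gridKer b b' ≤
      6 ^ d * N b ^ 2 + ∑ b', N b' ^ 2 * gridKer b' b := by
    calc N b * ∑ b', N b' * gridKer b b'
        ≤ ∑ b', (N b ^ 2 * gridKer b b' + N b' ^ 2 * gridKer b' b) := by
          rw [Finset.mul_sum]
          refine Finset.sum_le_sum fun b' _ => ?_
          rw [gridKer_comm b' b]
          have := gridKer_pos b b'
          nlinarith [mul_nonneg this.le (sq_nonneg (N b - N b')),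
            mul_nonneg this.le (mul_nonneg (hN0 b) (hN0 b'))]
      _ = N b ^ 2 * ∑ b', gridKer b b' + ∑ b', N b' ^ 2 * gridKer b' b := by
          rw [Finset.sum_add_distrib, Finset.mul_sum]
      _ ≤ _ := by
          have := mul_le_mul_of_nonneg_left (sum_gridKer_le b) (sq_nonneg (N b))
          linarith
  have h4 := mul_le_mul_of_nonneg_left h3 hCk.le
  calc _ ≤ N b * (1 + Ck * ∑ b', N b' * gridKer b b') := h1
    _ = N b + Ck * (N b * ∑ b', N b' * gridKer b b') := by ring
    _ ≤ N b ^ 2 + Ck * (6 ^ d * N b ^ 2 + ∑ b', N b' ^ 2 * gridKer b' b) := by linarith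
    _ = _ := by ring

/-- factor relating averages of squared occupation numbers to averages of weights. -/
def wgtFactor (d : ℕ) : ℝ := 1 + 7 * Real.exp ((d : ℝ) ^ 2 + d) * 6 ^ d

lemma one_le_wgtFactor (d : ℕ) : 1 ≤ wgtFactor d := by
  have : 0 ≤ 7 * Real.exp ((d : ℝ) ^ 2 + d) * 6 ^ d := by positivity
  unfold wgtFactor
  linarith

lemma lineAvg_boxWgt_le (hd : 2 ≤ d) (hβ : IsGridMap E β) (i : ℕ) {j : ℕ} (hj : j ≤ m)
    (k : Fin d) {a : ℝ} (ha : ∀ b, lineAvg j k (fun b => (boxCount E β b : ℝ) ^ 2) b ≤ a)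
    (b : Grid d m) : lineAvg j k (boxWgt i E β) b ≤ wgtFactor d * a := by
  set Ck := Real.exp ((d : ℝ) ^ 2 + d) with hCk
  have h0 : 0 < Ck := Real.exp_pos _
  set F : Grid d m → ℝ := fun b => (boxCount E β b : ℝ) ^ 2 with hF
  have hlin : lineAvg j k (fun b => (1 + Ck * 6 ^ d) * F b +
      Ck * ∑ b', F b' * gridKer b' b) b =
      (1 + Ck * 6 ^ d) * lineAvg j k F b +
        Ck * lineAvg j k (fun b => ∑ b', F b' * gridKer b b') b := by
    simp only [lineAvg, lineSum, Finset.sum_add_distrib, ← Finset.mul_sum]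
    simp only [gridKer_comm]
    ring
  calc lineAvg j k (boxWgt i E β) b ≤ lineAvg j k (fun b => (1 + Ck * 6 ^ d) * F b +
      Ck * ∑ b', F b' * gridKer b' b) b := lineAvg_mono (boxWgt_le hd hβ i) b
    _ ≤ (1 + Ck * 6 ^ d) * a + Ck * (6 ^ (d + 1) * a) := by
        rw [hlin]
        have h1 := mul_le_mul_of_nonneg_left (ha b) (by positivity : 0 ≤ 1 + Ck * 6 ^ d)
        have h2 := mul_le_mul_of_nonneg_left
          (lineAvg_conv_gridKer_le hj k (fun b => by positivity) ha b) h0.le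
        linarith
    _ = wgtFactor d * a := by rw [wgtFactor, ← hCk, pow_succ]; ring

end Boxes

section Means

variable {ι : Type*}

lemma sq_sub_mean_le (c : ℝ) {t : Finset ι} (ht : t.Nonempty) (f : ι → ℝ) :
    (c - (∑ y ∈ t, f y) / t.card) ^ 2 ≤ (∑ y ∈ t, (c - f y) ^ 2) / t.card := by
  have hc : (0 : ℝ) < t.card := by exact_mod_cast ht.card_pos
  have h := sq_sum_le_card_mul_sum_sq (s := t) (f := fun y => c - f y)
  rw [Finset.sum_sub_distrib, Finset.sum_const, nsmul_eq_mul] at h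
  rw [show c - (∑ y ∈ t, f y) / t.card = (t.card * c - ∑ y ∈ t, f y) / t.card by field_simp,
    div_pow, div_le_div_iff₀ (by positivity) hc]
  nlinarith

lemma sq_mean_sub_mean_le {s t : Finset ι} (hs : s.Nonempty) (ht : t.Nonempty) (f : ι → ℝ) :
    ((∑ x ∈ s, f x) / s.card - (∑ y ∈ t, f y) / t.card) ^ 2 ≤
      (∑ x ∈ s, ∑ y ∈ t, (f x - f y) ^ 2) / (s.card * t.card) := by
  have hc : (0 : ℝ) < t.card := by exact_mod_cast ht.card_pos
  have hc' : (0 : ℝ) < s.card := by exact_mod_cast hs.card_pos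
  rw [sub_sq_comm]
  refine (sq_sub_mean_le _ hs f).trans ?_
  rw [← div_div, div_right_comm]
  refine div_le_div_of_nonneg_right ?_ hc'.le
  refine le_trans (Finset.sum_le_sum fun x _ => ?_) (Finset.sum_div _ _ _).ge
  rw [sub_sq_comm]
  exact sq_sub_mean_le _ ht f

end Means

section Levels

variable {m : ℕ}

/-- every cell of the dyadic block of side `2 ^ k` around `b` has few points. -/
def BlockBad (ρ : ℝ) (N : Grid d m → ℕ) (k : ℕ) (b : Grid d m) : Prop :=
  ∀ b' : Grid d m, (∀ i, (b' i).1 / 2 ^ k = (b i).1 / 2 ^ k) → (N b' : ℝ) < ρ / 2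

open Classical in
/-- upper bound for the resistance caused by sparse blocks around `b`. -/
def badSum (D : ℝ) (K : ℕ) (ρ : ℝ) (N : Grid d m → ℕ) (b : Grid d m) : ℝ :=
  1 + ∑ k ∈ Finset.range K,
    if BlockBad ρ N k b then Real.exp (2 * D * ((2 ^ (k + 1)) ^ d - 1)) else 0

lemma one_le_badSum (D : ℝ) (K : ℕ) (ρ : ℝ) (N : Grid d m → ℕ) (b : Grid d m) :
    1 ≤ badSum D K ρ N b := by
  classical
  rw [badSum, le_add_iff_nonneg_right]
  refine Finset.sum_nonneg fun k _ => ?_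
  split_ifs <;> positivity

lemma exp_le_badSum {D : ℝ} {K : ℕ} {ρ : ℝ} {N : Grid d m → ℕ} {k : ℕ} (hk : k < K)
    {b : Grid d m} (hb : BlockBad ρ N k b) :
    Real.exp (2 * D * ((2 ^ (k + 1)) ^ d - 1)) ≤ badSum D K ρ N b := by
  classical
  have h : Real.exp (2 * D * ((2 ^ (k + 1)) ^ d - 1)) ≤ ∑ k ∈ Finset.range K,
      if BlockBad ρ N k b then Real.exp (2 * D * ((2 ^ (k + 1)) ^ d - 1)) else 0 := by
    refine le_trans (le_of_eq ?_) (Finset.single_le_sum (f := fun k =>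
      if BlockBad ρ N k b then Real.exp (2 * D * ((2 ^ (k + 1)) ^ d - 1)) else 0)
      (fun k _ => by split_ifs <;> positivity) (Finset.mem_range.2 hk))
    rw [if_pos hb]
  have := (badSum.eq_1 D K ρ N b)
  rw [this]
  refine h.trans (le_trans (le_of_eq ?_) (le_add_of_nonneg_left zero_le_one))
  refine Finset.sum_congr rfl fun k _ => ?_
  congr

lemma abs_sub_le_of_div_eq {s t k : ℕ} (h : s / 2 ^ k = t / 2 ^ k) :
    |(s : ℝ) - t| ≤ 2 ^ k - 1 := by
  have h1 := Nat.div_add_mod s (2 ^ k)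
  have h2 := Nat.div_add_mod t (2 ^ k)
  have h3 := Nat.mod_lt s (by positivity : 0 < 2 ^ k)
  have h4 := Nat.mod_lt t (by positivity : 0 < 2 ^ k)
  rw [h] at h1
  have h5 : s + 1 ≤ t + 2 ^ k := by omega
  have h6 : t + 1 ≤ s + 2 ^ k := by omega
  rw [abs_le]
  constructor
  · have : (t : ℝ) + 1 ≤ s + 2 ^ k := by exact_mod_cast h6
    linarith
  · have : (s : ℝ) + 1 ≤ t + 2 ^ k := by exact_mod_cast h5
    linarith

/-- the cell `b'` is a dense cell at dyadic distance `2 ^ l` of `b`. -/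
structure IsNear (D : ℝ) (ρ : ℝ) (N : Grid d m → ℕ) (θ : ℝ) (b b' : Grid d m) (l : ℕ) : Prop where
  dense : ρ / 2 ≤ N b'
  close : ∀ i, |((b i : ℕ) : ℝ) - (b' i : ℕ)| ≤ 2 ^ l - 1
  exp_le : Real.exp (2 * D * ((2 ^ l) ^ d - 1)) ≤ θ

lemma exists_isNear (D : ℝ) {K : ℕ} {ρ : ℝ} {N : Grid d m → ℕ} {b : Grid d m}
    (hb : ¬ BlockBad ρ N K b) :
    ∃ b' l, l ≤ K ∧ IsNear D ρ N (badSum D K ρ N b) b b' l := by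
  classical
  have hex : ∃ k, ¬ BlockBad ρ N k b := ⟨K, hb⟩
  have hspec := Nat.find_spec hex
  set l := Nat.find hex with hl
  have hlK : l ≤ K := Nat.find_min' hex hb
  rw [BlockBad] at hspec
  push Not at hspec
  obtain ⟨b', h1, h2⟩ := hspec
  refine ⟨b', l, hlK, h2, fun i => abs_sub_le_of_div_eq (h1 i).symm, ?_⟩
  rcases Nat.eq_zero_or_pos l with h0 | h0
  · rw [h0]
    simpa using one_le_badSum D K ρ N b
  · have hbad : BlockBad ρ N (l - 1) b := by
      by_contra hcon
      exact Nat.find_min hex (by omega : l - 1 < l) hcon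
    have := exp_le_badSum (D := D) (by omega : l - 1 < K) hbad
    rwa [show l - 1 + 1 = l by omega] at this

/-- cost of crossing one unit of volume. -/
def crossCost (d : ℕ) : ℝ := (4 * √d) ^ d

lemma crossCost_nonneg (d : ℕ) : 0 ≤ crossCost d := by unfold crossCost; positivity

variable {E : Finset (Pt d)} {β : Pt d → Grid d m}

lemma exp_neg_le_rate (hβ : IsGridMap E β) {x y : Pt d} (hx : x ∈ E) (hy : y ∈ E) {u v : ℝ}
    (hu : 0 ≤ u) (hv : 0 ≤ v) (h : ∀ i, |((β x i : ℕ) : ℝ) - (β y i : ℕ)| ≤ u + v - 1) :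
    Real.exp (-(crossCost d * (u ^ d + v ^ d))) ≤ rate (d : ℝ) x y := by
  rw [rate_nat, Real.exp_le_exp, neg_le_neg_iff]
  have h1 := hβ.dist_le x hx y hy _ h
  calc dist x y ^ d ≤ (2 * √d * (u + v)) ^ d := by
        refine pow_le_pow_left₀ dist_nonneg (h1.trans_eq (by ring)) d
    _ = (2 * √d) ^ d * (u + v) ^ d := mul_pow _ _ _
    _ ≤ (2 * √d) ^ d * (2 ^ d * (u ^ d + v ^ d)) := by
        refine mul_le_mul_of_nonneg_left ((add_pow_le hu hv d).trans ?_) (by positivity)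
        refine mul_le_mul_of_nonneg_right ?_ (by positivity)
        exact pow_le_pow_right₀ (by norm_num) (Nat.sub_le _ _)
    _ = crossCost d * (u ^ d + v ^ d) := by
        rw [← mul_assoc, ← mul_pow, crossCost]; ring_nf

/-- average of `f` over the points of the cell `b`. -/
def boxMean (E : Finset (Pt d)) (β : Pt d → Grid d m) (f : Pt d → ℝ) (b : Grid d m) : ℝ :=
  (∑ x ∈ boxPts E β b, f x) / (boxPts E β b).card

/-- energy between two cells. -/
def boxEnergy (E : Finset (Pt d)) (β : Pt d → Grid d m) (f : Pt d → ℝ) (b b' : Grid d m) : ℝ :=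
  ∑ x ∈ boxPts E β b, ∑ y ∈ boxPts E β b', rate (d : ℝ) x y * (f x - f y) ^ 2

lemma boxEnergy_nonneg (f : Pt d → ℝ) (b b' : Grid d m) : 0 ≤ boxEnergy E β f b b' :=
  Finset.sum_nonneg fun _ _ => Finset.sum_nonneg fun _ _ =>
    mul_nonneg (rate_pos _ _ _).le (sq_nonneg _)

lemma sum_boxEnergy (f : Pt d → ℝ) :
    ∑ b, ∑ b', boxEnergy E β f b b' = pairEnergy (d : ℝ) E f := by
  simp only [boxEnergy, pairEnergy]
  rw [← sum_boxPts (β := β)]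
  refine Finset.sum_congr rfl fun b _ => ?_
  rw [Finset.sum_comm]
  refine Finset.sum_congr rfl fun x _ => ?_
  rw [sum_boxPts]

lemma boxPts_nonempty {ρ : ℝ} (hρ : 0 < ρ) {b : Grid d m} (h : ρ / 2 ≤ boxCount E β b) :
    (boxPts E β b).Nonempty := by
  rw [← Finset.card_pos]
  have : (0 : ℝ) < boxCount E β b := by linarith
  exact_mod_cast this

lemma sq_boxMean_sub_le (hβ : IsGridMap E β) {ρ : ℝ} (hρ : 0 < ρ) {b b' : Grid d m}
    (hb : ρ / 2 ≤ boxCount E β b) (hb' : ρ / 2 ≤ boxCount E β b') {u v : ℝ}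
    (hu : 0 ≤ u) (hv : 0 ≤ v)
    (h : ∀ i, |((b i : ℕ) : ℝ) - (b' i : ℕ)| ≤ u + v - 1) (f : Pt d → ℝ) :
    (boxMean E β f b - boxMean E β f b') ^ 2 ≤
      4 / ρ ^ 2 * Real.exp (crossCost d * (u ^ d + v ^ d)) * boxEnergy E β f b b' := by
  have h1 := sq_mean_sub_mean_le (boxPts_nonempty hρ hb) (boxPts_nonempty hρ hb') f
  refine h1.trans ?_
  have h2 : ∑ x ∈ boxPts E β b, ∑ y ∈ boxPts E β b', (f x - f y) ^ 2 ≤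
      Real.exp (crossCost d * (u ^ d + v ^ d)) * boxEnergy E β f b b' := by
    simp only [boxEnergy, Finset.mul_sum]
    refine Finset.sum_le_sum fun x hx => Finset.sum_le_sum fun y hy => ?_
    obtain ⟨hxE, hxb⟩ := mem_boxPts.1 hx
    obtain ⟨hyE, hyb⟩ := mem_boxPts.1 hy
    have h3 := exp_neg_le_rate hβ hxE hyE hu hv (by rw [hxb, hyb]; exact h)
    rw [Real.exp_neg, inv_le_iff_one_le_mul₀' (Real.exp_pos _)] at h3
    nlinarith [sq_nonneg (f x - f y)]
  rw [div_le_iff₀ (mul_pos (by exact_mod_cast (boxPts_nonempty hρ hb).card_pos)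
    (by exact_mod_cast (boxPts_nonempty hρ hb').card_pos))]
  have h4 : ρ / 2 * (ρ / 2) ≤ (boxCount E β b : ℝ) * boxCount E β b' :=
    mul_le_mul hb hb' (by positivity) (Nat.cast_nonneg _)
  have h5 : 1 ≤ 4 / ρ ^ 2 * ((boxCount E β b : ℝ) * boxCount E β b') := by
    rw [div_mul_eq_mul_div, le_div_iff₀ (by positivity)]
    nlinarith
  set X := Real.exp (crossCost d * (u ^ d + v ^ d)) * boxEnergy E β f b b' with hX
  have hX0 : 0 ≤ X := mul_nonneg (Real.exp_pos _).le (boxEnergy_nonneg _ _ _)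
  calc _ ≤ X := h2
    _ ≤ X * (4 / ρ ^ 2 * ((boxCount E β b : ℝ) * boxCount E β b')) :=
        le_mul_of_one_le_right hX0 h5
    _ = _ := by rw [hX, boxCount, boxCount]; ring

lemma cross_exp_le {D A B θ θ' : ℝ} (hD : crossCost d + d ≤ D) (hA : 1 ≤ A) (hB : 1 ≤ B)
    (hθ : Real.exp (2 * D * (A - 1)) ≤ θ) (hθ' : Real.exp (2 * D * (B - 1)) ≤ θ') :
    Real.exp (crossCost d * (A + B)) ≤
      Real.exp (2 * crossCost d) * Real.exp (-(d * (A - 1))) * (θ + θ') := by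
  set u := Real.exp (D * (A - 1)) with hu
  set v := Real.exp (D * (B - 1)) with hv
  have h1 : Real.exp (2 * D * (A - 1)) = u ^ 2 := by
    rw [hu, ← Real.exp_nat_mul]; congr 1; push_cast; ring
  have h2 : Real.exp (2 * D * (B - 1)) = v ^ 2 := by
    rw [hv, ← Real.exp_nat_mul]; congr 1; push_cast; ring
  have h3 : u * v ≤ θ + θ' := by
    have h0 : 0 ≤ u * v := mul_nonneg (Real.exp_pos _).le (Real.exp_pos _).le
    nlinarith [sq_nonneg (u - v)]
  calc Real.exp (crossCost d * (A + B))
      ≤ Real.exp (2 * crossCost d) * Real.exp (-(d * (A - 1))) * (u * v) := by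
        rw [hu, hv, ← Real.exp_add, ← Real.exp_add, ← Real.exp_add, Real.exp_le_exp]
        have hd : (0 : ℝ) ≤ d := Nat.cast_nonneg d
        nlinarith [mul_nonneg (by linarith : 0 ≤ D - crossCost d - d) (by linarith : 0 ≤ A - 1),
          mul_nonneg (by linarith : 0 ≤ D - crossCost d) (by linarith : 0 ≤ B - 1)]
    _ ≤ _ := mul_le_mul_of_nonneg_left h3 (by positivity)

lemma sum_gradSq_le (hβ : IsGridMap E β) {D ρ : ℝ} (hρ : 0 < ρ) (hD : crossCost d + d ≤ D)
    {θ : Grid d m → ℝ} (hθ : ∀ b, 0 < θ b) {nb : Grid d m → Grid d m} {lev : Grid d m → ℕ}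
    (hnb : ∀ b, IsNear D ρ (boxCount E β) (θ b) b (nb b) (lev b)) (f : Pt d → ℝ) :
    ∑ k, ∑ b, gradSq θ (fun b => boxMean E β f (nb b)) k b ≤
      d * (4 * Real.exp (2 * crossCost d) * 6 ^ d / ρ ^ 2) * pairEnergy (d : ℝ) E f := by
  set c := 4 / ρ ^ 2 * Real.exp (2 * crossCost d) with hc
  have hc0 : 0 ≤ c := by positivity
  set T : Grid d m → ℝ := fun b => ∑ b', boxEnergy E β f b b' with hT
  have hT0 : ∀ b, 0 ≤ T b := fun b => Finset.sum_nonneg fun _ _ => boxEnergy_nonneg _ _ _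
  have hpow : ∀ l : ℕ, (1 : ℝ) ≤ (2 ^ l) ^ d := fun l =>
    one_le_pow₀ (one_le_pow₀ (by norm_num))
  have hedge : ∀ k b, gradSq θ (fun b => boxMean E β f (nb b)) k b ≤
      c * (gridKer (nb b) b * T (nb b)) := by
    intro k b
    have hker : Real.exp (-(d * ((2 ^ lev b) ^ d - 1))) ≤ gridKer (nb b) b := by
      rw [gridKer, ← Real.exp_sum, Real.exp_le_exp, Finset.sum_neg_distrib, neg_le_neg_iff]
      calc ∑ i, |((nb b i : ℕ) : ℝ) - (b i : ℕ)| ≤ ∑ _i : Fin d, ((2 : ℝ) ^ lev b - 1) := by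
            refine Finset.sum_le_sum fun i _ => ?_
            rw [abs_sub_comm]
            exact (hnb b).close i
        _ = d * (2 ^ lev b - 1) := by simp [mul_sub]
        _ ≤ d * ((2 ^ lev b) ^ d - 1) := by
            rcases Nat.eq_zero_or_pos d with rfl | hd
            · simp
            refine mul_le_mul_of_nonneg_left ?_ (Nat.cast_nonneg _)
            have : (2 : ℝ) ^ lev b ≤ (2 ^ lev b) ^ d :=
              le_self_pow₀ (one_le_pow₀ (by norm_num)) (by omega)
            linarith
    have hone : ∀ v : Fin (2 ^ m), v.1 = (b k).1 + 1 →
        (boxMean E β f (nb (Function.update b k v)) - boxMean E β f (nb b)) ^ 2 /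
          (θ b + θ (Function.update b k v)) ≤ c * (gridKer (nb b) b * T (nb b)) := by
      intro v hv
      set b' := Function.update b k v with hb'
      have hclose : ∀ i, |((nb b i : ℕ) : ℝ) - (nb b' i : ℕ)| ≤ 2 ^ lev b + 2 ^ lev b' - 1 := by
        intro i
        have h1 := (hnb b).close i
        have h2 := (hnb b').close i
        have h3 : |((b i : ℕ) : ℝ) - (b' i : ℕ)| ≤ 1 := by
          by_cases hi : i = k
          · subst hi
            rw [hb', Function.update_self, hv]
            simp
          · rw [hb', Function.update_of_ne hi]
            simp
        rw [abs_le] at *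
        constructor <;> linarith
      have h1 := sq_boxMean_sub_le hβ hρ (hnb b).dense (hnb b').dense
        (by positivity) (by positivity) hclose f
      have h2 := cross_exp_le hD (hpow (lev b)) (hpow (lev b')) (hnb b).exp_le (hnb b').exp_le
      have hE : boxEnergy E β f (nb b) (nb b') ≤ T (nb b) :=
        Finset.single_le_sum (f := fun b' => boxEnergy E β f (nb b) b')
          (fun _ _ => boxEnergy_nonneg _ _ _) (Finset.mem_univ _)
      have hθθ := add_pos (hθ b) (hθ b')
      rw [div_le_iff₀ hθθ, sub_sq_comm]
      calc _ ≤ 4 / ρ ^ 2 * Real.exp (crossCost d * ((2 ^ lev b) ^ d + (2 ^ lev b') ^ d)) *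
            boxEnergy E β f (nb b) (nb b') := h1
        _ ≤ 4 / ρ ^ 2 * (Real.exp (2 * crossCost d) * gridKer (nb b) b * (θ b + θ b')) *
            T (nb b) := by
          refine mul_le_mul (mul_le_mul_of_nonneg_left (h2.trans ?_) (by positivity)) hE
            (boxEnergy_nonneg _ _ _) ?_
          · exact mul_le_mul_of_nonneg_right (mul_le_mul_of_nonneg_left hker
              (Real.exp_pos _).le) hθθ.le
          · have := gridKer_pos (nb b) b
            positivity
        _ = _ := by rw [hc]; ring
    have hr0 : 0 ≤ c * (gridKer (nb b) b * T (nb b)) :=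
      mul_nonneg hc0 (mul_nonneg (gridKer_pos _ _).le (hT0 _))
    rw [gradSq]
    by_cases hex : ∃ v : Fin (2 ^ m), v.1 = (b k).1 + 1
    · obtain ⟨v, hv⟩ := hex
      rw [Finset.sum_eq_single v]
      · rw [if_pos hv]; exact hone v hv
      · intro u _ huv
        rw [if_neg fun h => huv (Fin.ext (h.trans hv.symm))]
      · intro h; exact absurd (Finset.mem_univ _) h
    · push Not at hex
      rw [Finset.sum_eq_zero fun v _ => if_neg (hex v)]
      exact hr0
  have hsum : ∑ b, gridKer (nb b) b * T (nb b) ≤ 6 ^ d * pairEnergy (d : ℝ) E f := by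
    calc ∑ b, gridKer (nb b) b * T (nb b) ≤ ∑ b, ∑ b', gridKer b' b * T b' := by
          refine Finset.sum_le_sum fun b _ => ?_
          exact Finset.single_le_sum (f := fun b' => gridKer b' b * T b')
            (fun _ _ => mul_nonneg (gridKer_pos _ _).le (hT0 _)) (Finset.mem_univ _)
      _ = ∑ b', (∑ b, gridKer b' b) * T b' := by
          rw [Finset.sum_comm]; simp only [Finset.sum_mul]
      _ ≤ ∑ b', 6 ^ d * T b' := Finset.sum_le_sum fun b' _ =>
          mul_le_mul_of_nonneg_right (sum_gridKer_le b') (hT0 b')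
      _ = _ := by rw [← Finset.mul_sum, sum_boxEnergy]
  calc _ ≤ ∑ _k : Fin d, c * (6 ^ d * pairEnergy (d : ℝ) E f) := by
        refine Finset.sum_le_sum fun k _ => ?_
        refine (Finset.sum_le_sum fun b _ => hedge k b).trans ?_
        rw [← Finset.mul_sum]
        exact mul_le_mul_of_nonneg_left hsum hc0
    _ = _ := by
        rw [Finset.sum_const, Finset.card_univ, Fintype.card_fin, nsmul_eq_mul, hc]
        ring

end Levels

lemma sum_mul_sq_le_of_cells {ι κ : Type*} [DecidableEq κ] (E : Finset ι) (q : ι → κ)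
    {w F c : ι → ℝ} {v : ℝ} (hv0 : 0 < v) (hw : ∀ x ∈ E, 0 ≤ w x) (hF : ∀ x ∈ E, 0 ≤ F x)
    (hc : ∀ x ∈ E, ∀ y ∈ E, q x = q y → c x = c y)
    (hv : ∀ x ∈ E, v ≤ ∑ y ∈ E with q y = q x, w y) :
    ∑ x ∈ E, w x * F x ^ 2 ≤ ∑ x ∈ E, w x * (F x - c x) ^ 2 + (∑ x ∈ E, w x * F x) ^ 2 / v := by
  have hmain : ∑ x ∈ E, w x * (2 * F x * c x - c x ^ 2) ≤ (∑ x ∈ E, w x * F x) ^ 2 / v := by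
    set T := ∑ x ∈ E, w x * F x with hT
    have hfib := fun h : ι → ℝ => Finset.sum_fiberwise_of_maps_to (s := E) (t := E.image q)
      (fun x hx => Finset.mem_image_of_mem q hx) h
    rw [← hfib]
    calc _ ≤ ∑ p ∈ E.image q, (∑ x ∈ E with q x = p, w x * F x) * (T / v) := by
          refine Finset.sum_le_sum fun p hp => ?_
          obtain ⟨x₀, hx₀, rfl⟩ := Finset.mem_image.1 hp
          set G := ∑ x ∈ E with q x = q x₀, w x * F x with hG
          have h1 : ∑ x ∈ E with q x = q x₀, w x * (2 * F x * c x - c x ^ 2) =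
              2 * c x₀ * G - c x₀ ^ 2 * ∑ x ∈ E with q x = q x₀, w x := by
            rw [hG, Finset.mul_sum, Finset.mul_sum, ← Finset.sum_sub_distrib]
            refine Finset.sum_congr rfl fun x hx => ?_
            rw [hc x (Finset.mem_filter.1 hx).1 x₀ hx₀ (Finset.mem_filter.1 hx).2]
            ring
          have hG0 : 0 ≤ G := Finset.sum_nonneg fun x hx =>
            mul_nonneg (hw x (Finset.mem_filter.1 hx).1) (hF x (Finset.mem_filter.1 hx).1)
          have hGT : G ≤ T := Finset.sum_le_sum_of_subset_of_nonneg (Finset.filter_subset _ _)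
            fun x hx _ => mul_nonneg (hw x hx) (hF x hx)
          rw [h1, mul_div_assoc', le_div_iff₀ hv0]
          have h2 := hv x₀ hx₀
          nlinarith [sq_nonneg (c x₀ * v - G), mul_le_mul_of_nonneg_left hGT hG0,
            mul_le_mul_of_nonneg_left h2 (mul_nonneg (sq_nonneg (c x₀)) hv0.le)]
      _ = T ^ 2 / v := by
          rw [← Finset.sum_mul, hfib, ← hT]; ring
  have e : ∑ x ∈ E, w x * F x ^ 2 = ∑ x ∈ E, w x * (F x - c x) ^ 2 +
      ∑ x ∈ E, w x * (2 * F x * c x - c x ^ 2) := by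
    rw [← Finset.sum_add_distrib]
    exact Finset.sum_congr rfl fun x _ => by ring
  linarith

section Cells

variable {m : ℕ}

/-- indicator of the dyadic cell of side `2 ^ j` around `b`. -/
def cellInd (j : ℕ) (b b' : Grid d m) : ℝ := ∏ i, if b' i ∈ seg j (b i) then 1 else 0

lemma cellInd_nonneg (j : ℕ) (b b' : Grid d m) : 0 ≤ cellInd j b b' :=
  Finset.prod_nonneg fun _ _ => by split_ifs <;> norm_num

lemma cellInd_eq (j : ℕ) (b b' : Grid d m) :
    cellInd j b b' = if (fun i => (b' i).1 / 2 ^ j) = (fun i => (b i).1 / 2 ^ j) then 1 else 0 := by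
  rw [cellInd, Finset.prod_ite_zero]
  simp [mem_seg, funext_iff]

lemma sum_cellInd {j : ℕ} (hj : j ≤ m) (b : Grid d m) :
    ∑ b', cellInd j b b' = ((2 : ℝ) ^ j) ^ d := by
  simp only [cellInd]
  rw [← Fintype.prod_sum (fun i (t : Fin (2 ^ m)) => if t ∈ seg j (b i) then (1 : ℝ) else 0)]
  simp [card_seg hj]

lemma cellInd_update {j : ℕ} (k : Fin d) (b b' : Grid d m) {s : Fin (2 ^ m)}
    (hs : s ∈ seg j (b' k)) : cellInd j b (Function.update b' k s) = cellInd j b b' := by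
  refine Finset.prod_congr rfl fun i _ => ?_
  by_cases h : i = k
  · subst h
    simp only [Function.update_self, mem_seg, mem_seg.1 hs]
  · rw [Function.update_of_ne h]

/-- A field with line averages at most `a` has cell averages at most `a`. -/
lemma sum_cellInd_mul_le {j : ℕ} (hj : j ≤ m) (k : Fin d) {F : Grid d m → ℝ} {a : ℝ}
    (ha : ∀ b, lineAvg j k F b ≤ a) (b : Grid d m) :
    ∑ b', cellInd j b b' * F b' ≤ ((2 : ℝ) ^ j) ^ d * a := by
  have hinv : ∀ b', lineAvg j k (cellInd j b) b' = cellInd j b b' := fun b' =>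
    lineAvg_of_invariant hj (fun b' s hs => cellInd_update k b b' hs) b'
  calc ∑ b', cellInd j b b' * F b' = ∑ b', F b' * lineAvg j k (cellInd j b) b' := by
        simp only [hinv, mul_comm]
    _ = ∑ b', cellInd j b b' * lineAvg j k F b' := sum_mul_lineAvg _ _
    _ ≤ ∑ b', cellInd j b b' * a := Finset.sum_le_sum fun b' _ =>
        mul_le_mul_of_nonneg_left (ha b') (cellInd_nonneg _ _ _)
    _ = _ := by rw [← Finset.sum_mul, sum_cellInd hj]

lemma sum_le_of_lineAvg_le {j : ℕ} (hj : j ≤ m) (k : Fin d) {F : Grid d m → ℝ} {a : ℝ}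
    (ha : ∀ b, lineAvg j k F b ≤ a) : ∑ b, F b ≤ ((2 : ℝ) ^ m) ^ d * a := by
  have hinv : ∀ b : Grid d m, lineAvg j k (fun _ => (1 : ℝ)) b = 1 := lineAvg_const hj 1
  calc ∑ b, F b = ∑ b, F b * lineAvg j k (fun _ => (1 : ℝ)) b := by simp only [hinv, mul_one]
    _ = ∑ b, 1 * lineAvg j k F b := sum_mul_lineAvg _ _
    _ ≤ ∑ _b : Grid d m, a := Finset.sum_le_sum fun b _ => by rw [one_mul]; exact ha b
    _ = _ := by simp

/-- Regularity of the occupation numbers of a grid. -/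
structure RegularCounts (D a ρ : ℝ) (K j₀ : ℕ) (M : ℝ) (N : Grid d m → ℕ) : Prop where
  not_blockBad : ∀ b, ¬ BlockBad ρ N K b
  le_max : ∀ b, (N b : ℝ) ≤ M
  lineSum_le : ∀ j, j₀ ≤ j → j ≤ m → ∀ k b,
    lineSum j k (fun b => badSum D K ρ N b + (N b : ℝ) ^ 2 / ρ ^ 2) b ≤ a * 2 ^ j

namespace RegularCounts

variable {D a ρ M : ℝ} {K j₀ : ℕ} {N : Grid d m → ℕ}

lemma lineSum_badSum_le (h : RegularCounts D a ρ K j₀ M N) {j : ℕ} (hj₀ : j₀ ≤ j)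
    (hj : j ≤ m) (k : Fin d) (b : Grid d m) :
    lineSum j k (badSum D K ρ N) b ≤ a * 2 ^ j :=
  (lineSum_mono (fun b => le_add_of_nonneg_right (by positivity)) b).trans
    (h.lineSum_le j hj₀ hj k b)

lemma lineAvg_sq_le (h : RegularCounts D a ρ K j₀ M N) (hρ : 0 < ρ) {j : ℕ} (hj₀ : j₀ ≤ j)
    (hj : j ≤ m) (k : Fin d) (b : Grid d m) :
    lineAvg j k (fun b => (N b : ℝ) ^ 2) b ≤ a * ρ ^ 2 := by
  have h1 : lineSum j k (fun b => (N b : ℝ) ^ 2 / ρ ^ 2) b ≤ a * 2 ^ j :=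
    (lineSum_mono (fun b => le_add_of_nonneg_left
      (zero_le_one.trans (one_le_badSum D K ρ N b))) b).trans (h.lineSum_le j hj₀ hj k b)
  simp only [lineSum, ← Finset.sum_div] at h1
  rw [div_le_iff₀ (by positivity)] at h1
  rw [lineAvg, lineSum, div_le_iff₀ (by positivity)]
  linarith

lemma half_le_sum_dense (h : RegularCounts D a ρ K j₀ M N) (hd : 2 ≤ d) (hK : 0 < K)
    (ha : 0 < a) (hD0 : 0 ≤ D) (hD : 2 * a ≤ Real.exp (6 * D)) {j : ℕ} (hj₀ : j₀ ≤ j)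
    (hj : j ≤ m) (b : Grid d m) :
    ((2 : ℝ) ^ j) ^ d / 2 ≤ ∑ b', cellInd j b b' * if ρ / 2 ≤ N b' then 1 else 0 := by
  have hbad : ∀ b', (if ρ / 2 ≤ (N b' : ℝ) then (0 : ℝ) else 1) ≤
      badSum D K ρ N b' * (2 * a)⁻¹ := by
    intro b'
    rw [← div_eq_mul_inv, le_div_iff₀ (by positivity)]
    have h1 := one_le_badSum D K ρ N b'
    split_ifs with hN
    · linarith
    · have hB : BlockBad ρ N 0 b' := by
        intro b'' hb''
        have : b'' = b' := by
          funext i; have := hb'' i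
          simpa [Fin.ext_iff] using this
        rw [this]; exact not_le.1 hN
      have h2 := exp_le_badSum (D := D) hK hB
      refine (by linarith : (1 : ℝ) * (2 * a) ≤ Real.exp (6 * D)).trans (le_trans ?_ h2)
      rw [Real.exp_le_exp]
      have : (4 : ℝ) ≤ 2 ^ d := by
        calc (4 : ℝ) = 2 ^ 2 := by norm_num
          _ ≤ 2 ^ d := pow_le_pow_right₀ (by norm_num) hd
      rw [zero_add, pow_one]
      nlinarith
  have hk : Fin d := ⟨0, by omega⟩
  have hle := sum_cellInd_mul_le (j := j) hj hk (a := 1 / 2)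
    (F := fun b' => if ρ / 2 ≤ (N b' : ℝ) then (0 : ℝ) else 1) (fun b' => by
      refine (lineAvg_mono hbad b').trans ?_
      have h1 := h.lineSum_badSum_le hj₀ hj hk b'
      rw [lineAvg, div_le_iff₀ (by positivity)]
      simp only [lineSum, ← Finset.sum_mul] at h1 ⊢
      rw [← div_eq_mul_inv, div_le_iff₀ (by positivity)]
      linarith) b
  have hsum := sum_cellInd (d := d) hj b
  have hsplit : ∑ b', cellInd j b b' = ∑ b', cellInd j b b' * (if ρ / 2 ≤ (N b' : ℝ) then 1 else 0)
      + ∑ b', cellInd j b b' * (if ρ / 2 ≤ (N b' : ℝ) then 0 else 1) := by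
    rw [← Finset.sum_add_distrib]
    refine Finset.sum_congr rfl fun b' _ => ?_
    split_ifs <;> simp
  linarith

end RegularCounts

end Cells

section Deterministic

variable {m : ℕ} {E : Finset (Pt d)} {β : Pt d → Grid d m}

/-- order of magnitude of the weight of a cell in the three models. -/
def wgtUnit (i : ℕ) (ρ : ℝ) : ℝ := if i = 1 then ρ else ρ ^ 2

lemma wgtUnit_pos (i : ℕ) {ρ : ℝ} (hρ : 0 < ρ) : 0 < wgtUnit i ρ := by
  unfold wgtUnit; split_ifs <;> positivity

lemma wgtUnit_le (i : ℕ) {ρ : ℝ} (hρ : 1 ≤ ρ) : wgtUnit i ρ ≤ ρ ^ 2 := by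
  unfold wgtUnit; split_ifs <;> nlinarith

lemma sum_wgt_mul_comp (i : ℕ) (h : Grid d m → ℝ) :
    ∑ x ∈ E, wgt (d : ℝ) E i x * h (β x) = ∑ b, boxWgt i E β b * h b := by
  rw [← sum_boxPts (β := β)]
  refine Finset.sum_congr rfl fun b _ => ?_
  rw [boxWgt, Finset.sum_mul]
  exact Finset.sum_congr rfl fun x hx => by rw [(mem_boxPts.1 hx).2]

lemma Wsum_eq_sum_boxWgt (i : ℕ) : Wsum (d : ℝ) E i E = ∑ b, boxWgt i E β b := by
  have := sum_wgt_mul_comp (E := E) (β := β) i (fun _ => 1)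
  simpa [Wsum] using this

lemma wgtUnit_mul_le_boxWgt (hd : 1 ≤ d) (hβ : IsGridMap E β) (i : ℕ) {ρ : ℝ} (hρ : 4 ≤ ρ)
    {b : Grid d m} (hb : ρ / 2 ≤ boxCount E β b) :
    wgtUnit i ρ * (Real.exp (-crossCost d) / 8) ≤ boxWgt i E β b := by
  have hexp : Real.exp (-crossCost d) ≤ 1 := by
    rw [Real.exp_le_one_iff]; linarith [crossCost_nonneg d]
  have hexp0 := Real.exp_pos (-crossCost d)
  by_cases hi : i = 1
  · subst hi
    have : boxWgt 1 E β b = boxCount E β b := by simp [boxWgt, wgt, boxCount]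
    rw [this, wgtUnit, if_pos rfl]
    nlinarith
  · rw [wgtUnit, if_neg hi]
    have hw : ∀ x, ∑ z ∈ E.erase x, rate (d : ℝ) x z ≤ wgt (d : ℝ) E i x := by
      intro x
      unfold wgt
      rw [if_neg hi]
      split_ifs
      · exact le_rfl
      · exact le_max_right _ _
    have h1 : (boxCount E β b : ℝ) * ((boxCount E β b - 1) * Real.exp (-crossCost d)) ≤
        boxWgt i E β b := by
      rw [boxWgt, boxCount, ← nsmul_eq_mul]
      refine Finset.card_nsmul_le_sum _ _ _ fun x hx => ?_
      refine le_trans ?_ (hw x)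
      have hsub : (boxPts E β b).erase x ⊆ E.erase x :=
        Finset.erase_subset_erase _ (Finset.filter_subset _ _)
      refine le_trans ?_ (Finset.sum_le_sum_of_subset_of_nonneg hsub
        fun _ _ _ => (rate_pos _ _ _).le)
      have hcard : (((boxPts E β b).erase x).card : ℝ) = (boxPts E β b).card - 1 := by
        rw [Finset.card_erase_of_mem hx, Nat.cast_sub (Finset.card_pos.2 ⟨x, hx⟩), Nat.cast_one]
      rw [← hcard, ← nsmul_eq_mul]
      refine Finset.card_nsmul_le_sum _ _ _ fun z hz => ?_
      obtain ⟨hxE, hxb⟩ := mem_boxPts.1 hx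
      obtain ⟨hzE, hzb⟩ := mem_boxPts.1 (Finset.mem_of_mem_erase hz)
      have := exp_neg_le_rate hβ hxE hzE (u := 1) (v := 0) zero_le_one le_rfl
        (by rw [hxb, hzb]; simp)
      simpa [zero_pow (by omega : d ≠ 0)] using this
    have h2 : ρ ^ 2 / 8 ≤ (boxCount E β b : ℝ) * (boxCount E β b - 1) := by nlinarith
    nlinarith

variable {D a ρ M : ℝ} {K j₀ : ℕ}

lemma sum_boxWgt_le (hd : 2 ≤ d) (hβ : IsGridMap E β) (i : ℕ) (hρ : 4 ≤ ρ) (ha : 1 ≤ a)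
    (hjm : j₀ ≤ m) (hN : RegularCounts D a ρ K j₀ M (boxCount E β)) :
    Wsum (d : ℝ) E i E ≤ wgtUnit i ρ * (wgtFactor d * a) * ((2 : ℝ) ^ m) ^ d := by
  have hρ0 : 0 < ρ := by linarith
  let k : Fin d := ⟨0, by omega⟩
  have hsq := hN.lineAvg_sq_le hρ0 hjm le_rfl k
  have hwf := one_le_wgtFactor d
  by_cases hi : i = 1
  · subst hi
    have h1 := sum_le_of_lineAvg_le le_rfl k hsq
    have h2 : Wsum (d : ℝ) E 1 E ≤ ∑ b, ((boxCount E β b : ℝ) ^ 2 / ρ + ρ) / 2 := by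
      rw [Wsum_eq_sum_boxWgt (β := β)]
      refine Finset.sum_le_sum fun b _ => ?_
      have : boxWgt 1 E β b = boxCount E β b := by simp [boxWgt, wgt, boxCount]
      rw [this, le_div_iff₀ two_pos, div_add' _ _ _ hρ0.ne', le_div_iff₀ hρ0]
      nlinarith [sq_nonneg ((boxCount E β b : ℝ) - ρ)]
    rw [← Finset.sum_div, Finset.sum_add_distrib, ← Finset.sum_div, Finset.sum_const,
      nsmul_eq_mul] at h2
    have hcard : ((Finset.univ : Finset (Grid d m)).card : ℝ) = ((2 : ℝ) ^ m) ^ d := by simp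
    rw [hcard] at h2
    have h3 : (∑ b, (boxCount E β b : ℝ) ^ 2) / ρ ≤ ((2 : ℝ) ^ m) ^ d * (a * ρ) := by
      rw [div_le_iff₀ hρ0]
      linarith
    have hn : 0 ≤ ((2 : ℝ) ^ m) ^ d * ρ := by positivity
    have h4 : 1 * a ≤ wgtFactor d * a := mul_le_mul_of_nonneg_right hwf (by linarith)
    rw [wgtUnit, if_pos rfl]
    nlinarith
  · rw [wgtUnit, if_neg hi, Wsum_eq_sum_boxWgt (β := β)]
    have := sum_le_of_lineAvg_le le_rfl k (lineAvg_boxWgt_le hd hβ i le_rfl k hsq)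
    linarith

lemma le_sum_cell_wgt (hd : 2 ≤ d) (hβ : IsGridMap E β) (i : ℕ) (hρ : 4 ≤ ρ) (ha : 1 ≤ a)
    (hK : 0 < K) (hD0 : 0 ≤ D) (hD : 2 * a ≤ Real.exp (6 * D)) {j : ℕ} (hj₀ : j₀ ≤ j)
    (hj : j ≤ m) (hN : RegularCounts D a ρ K j₀ M (boxCount E β)) (b : Grid d m) :
    wgtUnit i ρ * (Real.exp (-crossCost d) / 16) * ((2 : ℝ) ^ j) ^ d ≤
      ∑ y ∈ E with (fun l => (β y l).1 / 2 ^ j) = (fun l => (b l).1 / 2 ^ j),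
        wgt (d : ℝ) E i y := by
  have h1 : ∑ y ∈ E with (fun l => (β y l).1 / 2 ^ j) = (fun l => (b l).1 / 2 ^ j),
      wgt (d : ℝ) E i y = ∑ b', cellInd j b b' * boxWgt i E β b' := by
    have := sum_wgt_mul_comp (E := E) (β := β) i (fun b' => cellInd j b b')
    simp only [mul_comm (cellInd _ _ _)]
    rw [← this, Finset.sum_filter]
    refine Finset.sum_congr rfl fun x _ => ?_
    rw [cellInd_eq]
    split_ifs <;> simp
  rw [h1]
  have h2 := hN.half_le_sum_dense hd hK (by linarith) hD0 hD hj₀ hj b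
  set c := wgtUnit i ρ * (Real.exp (-crossCost d) / 8) with hc
  have hc0 : 0 ≤ c := mul_nonneg (wgtUnit_pos i (by linarith)).le (by positivity)
  calc _ = c * (((2 : ℝ) ^ j) ^ d / 2) := by rw [hc]; ring
    _ ≤ c * ∑ b', cellInd j b b' * if ρ / 2 ≤ (boxCount E β b' : ℝ) then 1 else 0 :=
        mul_le_mul_of_nonneg_left h2 hc0
    _ = ∑ b', cellInd j b b' * (c * if ρ / 2 ≤ (boxCount E β b' : ℝ) then 1 else 0) := by
        rw [Finset.mul_sum]; exact Finset.sum_congr rfl fun _ _ => by ring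
    _ ≤ _ := by
        refine Finset.sum_le_sum fun b' _ =>
          mul_le_mul_of_nonneg_left ?_ (cellInd_nonneg _ _ _)
        split_ifs with hb
        · rw [mul_one]; exact wgtUnit_mul_le_boxWgt (by omega) hβ i hρ hb
        · rw [mul_zero]; exact boxWgt_nonneg i _

/-- constant in the local Poincaré inequality. -/
def poincareConst (d : ℕ) (a : ℝ) : ℝ :=
  2 + 2 * (2 ^ (d + 2) * a * (wgtFactor d * a) * (d * (4 * Real.exp (2 * crossCost d) * 6 ^ d)))

/-- the largest weight compatible with at most `M` points per cell. -/
def maxWgt (d : ℕ) (M : ℝ) : ℝ := 1 + Real.exp ((d : ℝ) ^ 2 + d) * (6 ^ d * M)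

lemma sq_sub_boxMean_le (hd : 1 ≤ d) (hβ : IsGridMap E β) (hρ : 0 < ρ) {x : Pt d} (hx : x ∈ E)
    {θ : ℝ} {b' : Grid d m} {l : ℕ} (hl : l ≤ K) (hnb : IsNear D ρ (boxCount E β) θ (β x) b' l)
    (f : Pt d → ℝ) :
    (f x - boxMean E β f b') ^ 2 ≤ 2 / ρ * Real.exp (crossCost d * (2 ^ K) ^ d) *
      ∑ y ∈ E, rate (d : ℝ) x y * (f x - f y) ^ 2 := by
  have hne := boxPts_nonempty hρ hnb.dense
  refine (sq_sub_mean_le (f x) hne f).trans ?_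
  have hterm : ∀ y ∈ boxPts E β b', (f x - f y) ^ 2 ≤
      Real.exp (crossCost d * (2 ^ K) ^ d) * (rate (d : ℝ) x y * (f x - f y) ^ 2) := by
    intro y hy
    obtain ⟨hyE, hyb⟩ := mem_boxPts.1 hy
    have h1 := exp_neg_le_rate hβ hx hyE (u := 2 ^ l) (v := 0) (by positivity) le_rfl
      (by intro i; rw [hyb, add_zero]; exact hnb.close i)
    rw [zero_pow (by omega : d ≠ 0), add_zero, Real.exp_neg,
      inv_le_iff_one_le_mul₀' (Real.exp_pos _)] at h1
    have h2 : Real.exp (crossCost d * (2 ^ l) ^ d) ≤ Real.exp (crossCost d * (2 ^ K) ^ d) := by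
      rw [Real.exp_le_exp]
      refine mul_le_mul_of_nonneg_left ?_ (crossCost_nonneg d)
      exact pow_le_pow_left₀ (by positivity) (pow_le_pow_right₀ (by norm_num) hl) d
    have h3 := mul_le_mul_of_nonneg_right h2 (rate_pos (d : ℝ) x y).le
    nlinarith [sq_nonneg (f x - f y)]
  have hsum : ∑ y ∈ boxPts E β b', (f x - f y) ^ 2 ≤ Real.exp (crossCost d * (2 ^ K) ^ d) *
      ∑ y ∈ E, rate (d : ℝ) x y * (f x - f y) ^ 2 := by
    refine (Finset.sum_le_sum hterm).trans ?_
    rw [← Finset.mul_sum]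
    refine mul_le_mul_of_nonneg_left ?_ (Real.exp_pos _).le
    exact Finset.sum_le_sum_of_subset_of_nonneg (Finset.filter_subset _ _)
      fun y _ _ => mul_nonneg (rate_pos _ _ _).le (sq_nonneg _)
  have hcard : ρ / 2 ≤ ((boxPts E β b').card : ℝ) := hnb.dense
  have hS0 := (Finset.sum_nonneg fun y _ => sq_nonneg (f x - f y) :
    0 ≤ ∑ y ∈ boxPts E β b', (f x - f y) ^ 2)
  calc _ ≤ (∑ y ∈ boxPts E β b', (f x - f y) ^ 2) / (ρ / 2) :=
        div_le_div_of_nonneg_left hS0 (by positivity) hcard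
    _ = 2 / ρ * ∑ y ∈ boxPts E β b', (f x - f y) ^ 2 := by field_simp
    _ ≤ _ := by
        rw [mul_assoc]
        exact mul_le_mul_of_nonneg_left hsum (by positivity)

/-- Poincaré inequality on the dyadic cells of side `2 ^ j`. -/
lemma exists_cell_poincare (hd : 2 ≤ d) (hβ : IsGridMap E β) (i : ℕ) (hρ : 4 ≤ ρ) (ha : 1 ≤ a)
    (hDc : crossCost d + d ≤ D) {j : ℕ} (hj₀ : j₀ ≤ j)
    (hj : j ≤ m) (hN : RegularCounts D a ρ K j₀ M (boxCount E β))
    (hmax : maxWgt d M * (2 / ρ * Real.exp (crossCost d * (2 ^ K) ^ d)) ≤ 4 ^ j₀)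
    (f : Pt d → ℝ) :
    ∃ c : Grid d m → ℝ, (∀ b b', (fun l => (b l).1 / 2 ^ j) = (fun l => (b' l).1 / 2 ^ j) →
        c b = c b') ∧
      ∑ x ∈ E, wgt (d : ℝ) E i x * (f x - c (β x)) ^ 2 ≤
        poincareConst d a * 4 ^ j * pairEnergy (d : ℝ) E f := by
  have hρ0 : 0 < ρ := by linarith
  choose nb lev hlev hnb using fun b => exists_isNear D (hN.not_blockBad b)
  set θ := badSum D K ρ (boxCount E β) with hθ
  have hθ0 : ∀ b, 0 < θ b := fun b => zero_lt_one.trans_le (one_le_badSum _ _ _ _ b)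
  set g : Grid d m → ℝ := fun b => boxMean E β f (nb b) with hg
  set S := pairEnergy (d : ℝ) E f with hS
  have hS0 : 0 ≤ S := Finset.sum_nonneg fun _ _ => Finset.sum_nonneg fun _ _ =>
    mul_nonneg (rate_pos _ _ _).le (sq_nonneg _)
  refine ⟨avgList j (List.finRange d) g, ?_, ?_⟩
  · intro b b' hbb
    have key : ∀ l : List (Fin d), l.Nodup → ∀ b b' : Grid d m,
        (∀ k, k ∉ l → b k = b' k) →
        (fun l => (b l).1 / 2 ^ j) = (fun l => (b' l).1 / 2 ^ j) →
        avgList j (List.finRange d) g b = avgList j (List.finRange d) g b' := by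
      intro l
      induction l with
      | nil =>
        intro _ b b' h _
        rw [show b = b' from funext fun k => h k (by simp)]
      | cons k l ih =>
        intro hl b b' h hq
        have hs : b' k ∈ seg j (b k) := mem_seg.2 (congrFun hq k).symm
        have h1 := avgList_invariant (j := j) (List.finRange d) g (List.mem_finRange k) b hs
        rw [← h1]
        refine ih (List.nodup_cons.1 hl).2 _ _ ?_ ?_
        · intro k' hk'
          by_cases hkk : k' = k
          · subst hkk; simp
          · rw [Function.update_of_ne hkk]
            exact h k' (by simp [hkk, hk'])
        · rw [← hq]
          funext k'
          by_cases hkk : k' = k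
          · subst hkk; simpa using (congrFun hq k').symm
          · simp [Function.update_of_ne hkk]
    exact key (List.finRange d) (List.nodup_finRange d) b b'
      (fun k hk => absurd (List.mem_finRange k) hk) hbb
  · have hfirst : ∑ x ∈ E, wgt (d : ℝ) E i x * (f x - g (β x)) ^ 2 ≤ 4 ^ j₀ * S := by
      calc _ ≤ ∑ x ∈ E, 4 ^ j₀ * ∑ y ∈ E, rate (d : ℝ) x y * (f x - f y) ^ 2 := by
            refine Finset.sum_le_sum fun x hx => ?_
            have h1 := sq_sub_boxMean_le (by omega) hβ hρ0 hx (hlev (β x)) (hnb (β x)) f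
            have h2 : wgt (d : ℝ) E i x ≤ maxWgt d M := wgt_le_of_boxCount_le hd hβ i hN.le_max hx
            have h3 : 0 ≤ ∑ y ∈ E, rate (d : ℝ) x y * (f x - f y) ^ 2 :=
              Finset.sum_nonneg fun _ _ => mul_nonneg (rate_pos _ _ _).le (sq_nonneg _)
            calc _ ≤ maxWgt d M * (2 / ρ * Real.exp (crossCost d * (2 ^ K) ^ d) *
                  ∑ y ∈ E, rate (d : ℝ) x y * (f x - f y) ^ 2) :=
                  mul_le_mul h2 h1 (sq_nonneg _) ((wgt_nonneg _ _ _).trans h2)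
              _ = maxWgt d M * (2 / ρ * Real.exp (crossCost d * (2 ^ K) ^ d)) *
                  ∑ y ∈ E, rate (d : ℝ) x y * (f x - f y) ^ 2 := by ring
              _ ≤ _ := mul_le_mul_of_nonneg_right hmax h3
        _ = 4 ^ j₀ * S := by rw [← Finset.mul_sum, hS, pairEnergy]
    have hwf := one_le_wgtFactor d
    have hsecond : ∑ x ∈ E, wgt (d : ℝ) E i x *
        (g (β x) - avgList j (List.finRange d) g (β x)) ^ 2 ≤
        2 ^ (d + 2) * a * (wgtFactor d * a) *
          (d * (4 * Real.exp (2 * crossCost d) * 6 ^ d)) * 4 ^ j * S := by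
      rw [sum_wgt_mul_comp i (fun b => (g b - avgList j (List.finRange d) g b) ^ 2)]
      have h1 := grid_poincare hj hθ0 (fun k b => hN.lineSum_badSum_le hj₀ hj k b)
        (a := wgtFactor d * (a * ρ ^ 2)) (by positivity) (by linarith) g
        (boxWgt i E β) (fun b => boxWgt_nonneg i b)
        (fun k b => lineAvg_boxWgt_le hd hβ i hj k (hN.lineAvg_sq_le hρ0 hj₀ hj k) b)
      have h2 := sum_gradSq_le hβ hρ0 hDc hθ0 hnb f
      refine h1.trans ((mul_le_mul_of_nonneg_left h2 (by positivity)).trans_eq ?_)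
      rw [← hS]
      field_simp
    calc _ ≤ ∑ x ∈ E, (2 * (wgt (d : ℝ) E i x * (f x - g (β x)) ^ 2) +
          2 * (wgt (d : ℝ) E i x * (g (β x) - avgList j (List.finRange d) g (β x)) ^ 2)) := by
          refine Finset.sum_le_sum fun x _ => ?_
          have := wgt_nonneg (E := E) i (d : ℝ) x
          nlinarith [mul_nonneg this (sq_nonneg (f x - 2 * g (β x) +
            avgList j (List.finRange d) g (β x)))]
      _ ≤ 2 * (4 ^ j₀ * S) + 2 * (2 ^ (d + 2) * a * (wgtFactor d * a) *
          (d * (4 * Real.exp (2 * crossCost d) * 6 ^ d)) * 4 ^ j * S) := by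
          rw [Finset.sum_add_distrib, ← Finset.mul_sum, ← Finset.mul_sum]
          linarith
      _ ≤ 2 * (4 ^ j * S) + 2 * (2 ^ (d + 2) * a * (wgtFactor d * a) *
          (d * (4 * Real.exp (2 * crossCost d) * 6 ^ d)) * 4 ^ j * S) := by
          have : (4 : ℝ) ^ j₀ ≤ 4 ^ j := pow_le_pow_right₀ (by norm_num) hj₀
          have := mul_le_mul_of_nonneg_right this hS0
          linarith
      _ = _ := by rw [poincareConst]; ring

/-- constant in the Nash type inequality. -/
def nashConst (d : ℕ) (a : ℝ) : ℝ := 16 * Real.exp (crossCost d) * (wgtFactor d * a)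

lemma exp_neg_le_wgt (hd : 2 ≤ d) (hβ : IsGridMap E β) (i : ℕ) (hρ : 4 ≤ ρ)
    (hN : RegularCounts D a ρ K j₀ M (boxCount E β)) {x : Pt d} (hx : x ∈ E) :
    Real.exp (-(crossCost d * (2 ^ K) ^ d)) ≤ wgt (d : ℝ) E i x := by
  have hle1 : Real.exp (-(crossCost d * (2 ^ K) ^ d)) ≤ 1 := by
    rw [Real.exp_le_one_iff, neg_nonpos]
    exact mul_nonneg (crossCost_nonneg d) (by positivity)
  obtain ⟨b', l, hl, hnb⟩ := exists_isNear D (hN.not_blockBad (β x))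
  have hcard : 1 < (boxPts E β b').card := by
    have : (1 : ℝ) < boxCount E β b' := by linarith [hnb.dense]
    exact_mod_cast this
  obtain ⟨z, hz, hzx⟩ := Finset.exists_mem_ne hcard x
  obtain ⟨hzE, hzb⟩ := mem_boxPts.1 hz
  have h1 := exp_neg_le_rate hβ hx hzE (u := 2 ^ l) (v := 0) (by positivity) le_rfl
    (by intro i; rw [hzb, add_zero]; exact hnb.close i)
  rw [zero_pow (by omega : d ≠ 0), add_zero] at h1
  have h2 : Real.exp (-(crossCost d * (2 ^ K) ^ d)) ≤ ∑ z ∈ E.erase x, rate (d : ℝ) x z := by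
    calc _ ≤ Real.exp (-(crossCost d * (2 ^ l) ^ d)) := by
          rw [Real.exp_le_exp, neg_le_neg_iff]
          refine mul_le_mul_of_nonneg_left ?_ (crossCost_nonneg d)
          exact pow_le_pow_left₀ (by positivity) (pow_le_pow_right₀ (by norm_num) hl) d
      _ ≤ rate (d : ℝ) x z := h1
      _ ≤ _ := Finset.single_le_sum (f := fun z => rate (d : ℝ) x z)
          (fun _ _ => (rate_pos _ _ _).le) (Finset.mem_erase.2 ⟨hzx, hzE⟩)
  unfold wgt
  split_ifs
  · exact hle1
  · exact h2
  · exact h2.trans (le_max_right _ _)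

theorem mixTime_le_of_regularCounts (hd : 2 ≤ d) (hβ : IsGridMap E β) (i : ℕ) (hρ : 4 ≤ ρ)
    (ha : 1 ≤ a) (hK : 0 < K) (hDc : crossCost d + d ≤ D) (hD : 2 * a ≤ Real.exp (6 * D))
    (hjm : j₀ ≤ m) (hN : RegularCounts D a ρ K j₀ M (boxCount E β))
    (hmax : maxWgt d M * (2 / ρ * Real.exp (crossCost d * (2 ^ K) ^ d)) ≤ 4 ^ j₀) :
    mixTime (d : ℝ) E i ≤ ENNReal.ofReal (2 * (poincareConst d a * (4 ^ j₀ *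
      Real.log (ρ ^ 2 * (wgtFactor d * a) * (2 ^ m) ^ d * Real.exp (crossCost d * (2 ^ K) ^ d)) +
      (2 * (d + 1) + Real.log (2 * nashConst d a) + 1) * 4 ^ m))) := by
  have hρ0 : 0 < ρ := by linarith
  have hwf := one_le_wgtFactor d
  have hwfa : 1 ≤ wgtFactor d * a := one_le_mul_of_one_le_of_one_le hwf ha
  have hD0 : 0 ≤ D := by
    have := crossCost_nonneg d
    have : (0 : ℝ) ≤ d := Nat.cast_nonneg d
    linarith
  have hU := wgtUnit_pos i hρ0
  have hw0 : ∀ x ∈ E, 0 < wgt (d : ℝ) E i x := fun x hx =>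
    (Real.exp_pos _).trans_le (exp_neg_le_wgt hd hβ i hρ hN hx)
  have hexp1 : 1 ≤ Real.exp (crossCost d * (2 ^ K) ^ d) :=
    Real.one_le_exp (mul_nonneg (crossCost_nonneg d) (by positivity))
  have hW := sum_boxWgt_le hd hβ i hρ ha hjm hN
  have hE : E.Nonempty := by
    let b₀ : Grid d m := fun _ => ⟨0, by positivity⟩
    obtain ⟨b', l, -, hnb⟩ := exists_isNear D (hN.not_blockBad b₀)
    obtain ⟨x, hx⟩ := boxPts_nonempty hρ0 hnb.dense
    exact ⟨x, (mem_boxPts.1 hx).1⟩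
  have hnash : 1 ≤ nashConst d a := by
    have := Real.one_le_exp (crossCost_nonneg d)
    unfold nashConst
    nlinarith
  have hA : 0 < poincareConst d a := by
    unfold poincareConst
    positivity
  refine mixTime_le_of_nashPoints hw0 hE hA hnash ?_ ?_ d j₀ m hjm ?_ ?_
  · have h1 : (1 : ℝ) ≤ (2 ^ m) ^ d := one_le_pow₀ (one_le_pow₀ (by norm_num))
    have h2 : (1 : ℝ) ≤ ρ ^ 2 := one_le_pow₀ (by linarith)
    exact one_le_mul_of_one_le_of_one_le (one_le_mul_of_one_le_of_one_le
      (one_le_mul_of_one_le_of_one_le h2 hwfa) h1) hexp1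
  · intro x hx
    have h1 := exp_neg_le_wgt hd hβ i hρ hN hx
    rw [Real.exp_neg, inv_le_iff_one_le_mul₀' (Real.exp_pos _)] at h1
    have h2 := wgtUnit_le i (by linarith : 1 ≤ ρ)
    set X := (wgtFactor d * a) * ((2 : ℝ) ^ m) ^ d with hX
    have hX0 : 0 ≤ X := by positivity
    calc Wsum (d : ℝ) E i E ≤ ρ ^ 2 * X := by
          refine hW.trans ?_
          rw [mul_assoc]
          exact mul_le_mul_of_nonneg_right h2 hX0
      _ ≤ ρ ^ 2 * X * (Real.exp (crossCost d * (2 ^ K) ^ d) * wgt (d : ℝ) E i x) :=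
          le_mul_of_one_le_right (by positivity) h1
      _ = _ := by rw [hX]; ring
  · intro j hj₀ hj F hF hFW
    obtain ⟨c, hc, hpoin⟩ := exists_cell_poincare hd hβ i hρ ha hDc hj₀ hj hN hmax F
    set v := wgtUnit i ρ * (Real.exp (-crossCost d) / 16) * ((2 : ℝ) ^ j) ^ d with hv
    have hv0 : 0 < v := by positivity
    have h1 := sum_mul_sq_le_of_cells E (fun x l => (β x l).1 / 2 ^ j) (c := fun x => c (β x))
      hv0 (fun x hx => (hw0 x hx).le) hF (fun x _ y _ hxy => hc _ _ hxy)
      (fun x _ => le_sum_cell_wgt hd hβ i hρ ha hK hD0 hD hj₀ hj hN (β x))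
    refine h1.trans (add_le_add hpoin ?_)
    rw [hFW, div_le_iff₀ hv0]
    have hW0 : 0 ≤ Wsum (d : ℝ) E i E := Finset.sum_nonneg fun x hx => (hw0 x hx).le
    have h2 : wgtUnit i ρ * (wgtFactor d * a) * ((2 : ℝ) ^ m) ^ d =
        nashConst d a * 2 ^ (d * (m - j)) * v := by
      have h3 : ((2 : ℝ) ^ m) ^ d = 2 ^ (d * (m - j)) * (2 ^ j) ^ d := by
        rw [← pow_mul, ← pow_mul, ← pow_add]
        congr 1
        rw [mul_comm d, ← add_mul, Nat.sub_add_cancel hj]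
      have h4 : Real.exp (crossCost d) * Real.exp (-crossCost d) = 1 := by
        rw [← Real.exp_add]; simp
      rw [h3, hv, nashConst]
      linear_combination (-(wgtUnit i ρ * (wgtFactor d * a) * (2 ^ (d * (m - j)) *
        ((2 : ℝ) ^ j) ^ d))) * h4
    rw [h2] at hW
    nlinarith
  · intro F hF hFW
    obtain ⟨c, hc, hpoin⟩ := exists_cell_poincare hd hβ i hρ ha hDc hjm le_rfl hN hmax F
    have hW0 : 0 < Wsum (d : ℝ) E i E := Finset.sum_pos hw0 hE
    have hq : ∀ b b' : Grid d m, (fun l => (b l).1 / 2 ^ m) = (fun l => (b' l).1 / 2 ^ m) := by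
      intro b b'
      funext l
      rw [Nat.div_eq_of_lt (b l).2, Nat.div_eq_of_lt (b' l).2]
    have h1 := sum_mul_sq_le_of_cells E (fun _ => ()) (c := fun x => c (β x))
      hW0 (fun x hx => (hw0 x hx).le) hF (fun x _ y _ _ => hc _ _ (hq _ _))
      (fun x _ => by simp [Wsum])
    refine h1.trans (add_le_add hpoin (le_of_eq ?_))
    rw [hFW]
    field_simp

end Deterministic

section Independence

open ProbabilityTheory

variable {ι κ Ω : Type*} [Fintype ι] {mΩ : MeasurableSpace Ω} {P : Measure Ω} {N : ι → Ω → ℕ}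

lemma indepFun_of_dependsOn (hN : iIndepFun N P) (hm : ∀ i, Measurable (N i))
    {S T : Finset ι} (hST : Disjoint S T) {f g : (ι → ℕ) → ℝ}
    (hf : ∀ u v : ι → ℕ, (∀ i ∈ S, u i = v i) → f u = f v)
    (hg : ∀ u v : ι → ℕ, (∀ i ∈ T, u i = v i) → g u = g v) :
    IndepFun (fun ω => f fun i => N i ω) (fun ω => g fun i => N i ω) P := by
  classical
  have ext : ∀ {S : Finset ι} {f : (ι → ℕ) → ℝ},
      (∀ u v : ι → ℕ, (∀ i ∈ S, u i = v i) → f u = f v) →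
      (fun ω => f fun i => N i ω) =
        (fun w : S → ℕ => f fun i => if h : i ∈ S then w ⟨i, h⟩ else 0) ∘
          fun ω (i : S) => N i ω := by
    intro S f hf
    funext ω
    refine hf _ _ fun i hi => ?_
    simp [hi]
  rw [ext hf, ext hg]
  exact (hN.indepFun_finset S T hST hm).comp .of_discrete .of_discrete

lemma mgf_sum_of_dependsOn [IsProbabilityMeasure P] (hN : iIndepFun N P)
    (hm : ∀ i, Measurable (N i)) {S : κ → Finset ι} {φ : κ → (ι → ℕ) → ℝ} (s : Finset κ)
    (hS : (s : Set κ).PairwiseDisjoint S)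
    (hφ : ∀ c (u v : ι → ℕ), (∀ i ∈ S c, u i = v i) → φ c u = φ c v) (t : ℝ) :
    mgf (fun ω => ∑ c ∈ s, φ c fun i => N i ω) P t =
      ∏ c ∈ s, mgf (fun ω => φ c fun i => N i ω) P t := by
  classical
  have hmeas : ∀ f : (ι → ℕ) → ℝ, Measurable fun ω => f fun i => N i ω := fun f =>
    (Measurable.of_discrete (f := f)).comp (measurable_pi_lambda _ hm)
  induction s using Finset.induction_on with
  | empty => simp [mgf]
  | insert c s hc ih =>
    rw [Finset.prod_insert hc, ← ih (hS.subset (by simp))]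
    have hd : Disjoint (S c) (s.biUnion S) := by
      rw [Finset.disjoint_biUnion_right]
      intro c' hc'
      exact hS (by simp) (by simp [hc']) (by rintro rfl; exact hc hc')
    have := indepFun_of_dependsOn hN hm hd (hφ c) (g := fun u => ∑ c ∈ s, φ c u)
      fun u v huv => Finset.sum_congr rfl fun c' hc' => hφ c' _ _ fun i hi =>
        huv i (Finset.mem_biUnion.2 ⟨c', hc', hi⟩)
    simp_rw [Finset.sum_insert hc]
    exact this.mgf_add ((hmeas fun u => Real.exp (t * φ c u)).aestronglyMeasurable)
      ((hmeas fun u => Real.exp (t * ∑ c ∈ s, φ c u)).aestronglyMeasurable)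

lemma mgf_le_exp_of_mem_Icc [IsProbabilityMeasure P] {X : Ω → ℝ} (hX : Measurable X) {R : ℝ}
    (hR : 0 < R) (h0 : ∀ ω, 0 ≤ X ω) (h1 : ∀ ω, X ω ≤ R) :
    mgf X P R⁻¹ ≤ Real.exp (2 * R⁻¹ * ∫ ω, X ω ∂P) := by
  have hint : Integrable X P := by
    refine Integrable.of_bound hX.aestronglyMeasurable R (ae_of_all _ fun ω => ?_)
    rw [Real.norm_of_nonneg (h0 ω)]; exact h1 ω
  have hle : ∀ ω, Real.exp (R⁻¹ * X ω) ≤ 1 + 2 * R⁻¹ * X ω := by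
    intro ω
    set y := R⁻¹ * X ω with hy
    have hy0 : 0 ≤ y := mul_nonneg (inv_nonneg.2 hR.le) (h0 ω)
    have hy1 : y ≤ 1 := by
      rw [hy, inv_mul_le_iff₀ hR, mul_one]; exact h1 ω
    have := Real.exp_bound' hy0 hy1 (n := 2) (by norm_num)
    simp [Finset.sum_range_succ] at this
    rw [mul_assoc, ← hy]
    nlinarith
  have hexp : Integrable (fun ω => Real.exp (R⁻¹ * X ω)) P := by
    refine Integrable.of_bound (by fun_prop) (Real.exp 1) (ae_of_all _ fun ω => ?_)
    rw [Real.norm_of_nonneg (Real.exp_pos _).le, Real.exp_le_exp, inv_mul_le_iff₀ hR, mul_one]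
    exact h1 ω
  calc mgf X P R⁻¹ ≤ ∫ ω, 1 + 2 * R⁻¹ * X ω ∂P :=
        integral_mono hexp ((integrable_const _).add (hint.const_mul _)) hle
    _ = 2 * R⁻¹ * (∫ ω, X ω ∂P) + 1 := by
        rw [integral_add (integrable_const _) (hint.const_mul _), integral_const_mul]
        simp [add_comm]
    _ ≤ _ := Real.add_one_le_exp _

lemma measureReal_sum_ge_le [IsProbabilityMeasure P] (hN : iIndepFun N P)
    (hm : ∀ i, Measurable (N i)) {S : κ → Finset ι} {φ : κ → (ι → ℕ) → ℝ} (s : Finset κ)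
    (hS : (s : Set κ).PairwiseDisjoint S)
    (hφ : ∀ c (u v : ι → ℕ), (∀ i ∈ S c, u i = v i) → φ c u = φ c v)
    {R : ℝ} (hR : 0 < R) (h0 : ∀ c u, 0 ≤ φ c u) (h1 : ∀ c u, φ c u ≤ R) {A B : ℝ}
    (hB : ∑ c ∈ s, ∫ ω, φ c (fun i => N i ω) ∂P ≤ B) :
    P.real {ω | A ≤ ∑ c ∈ s, φ c fun i => N i ω} ≤ Real.exp (-((A - 2 * B) / R)) := by
  have hmeas : ∀ f : (ι → ℕ) → ℝ, Measurable fun ω => f fun i => N i ω := fun f =>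
    (Measurable.of_discrete (f := f)).comp (measurable_pi_lambda _ hm)
  have hexp : Integrable (fun ω => Real.exp (R⁻¹ * ∑ c ∈ s, φ c fun i => N i ω)) P := by
    refine Integrable.of_bound (hmeas fun u => Real.exp (R⁻¹ * ∑ c ∈ s, φ c u)).aestronglyMeasurable
      (Real.exp (R⁻¹ * ∑ c ∈ s, R)) (ae_of_all _ fun ω => ?_)
    rw [Real.norm_of_nonneg (Real.exp_pos _).le, Real.exp_le_exp]
    exact mul_le_mul_of_nonneg_left (Finset.sum_le_sum fun c _ => h1 c _) (inv_nonneg.2 hR.le)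
  refine (measure_ge_le_exp_mul_mgf A (inv_nonneg.2 hR.le) hexp).trans ?_
  rw [mgf_sum_of_dependsOn hN hm s hS hφ]
  calc _ ≤ Real.exp (-R⁻¹ * A) *
        ∏ c ∈ s, Real.exp (2 * R⁻¹ * ∫ ω, φ c (fun i => N i ω) ∂P) := by
        refine mul_le_mul_of_nonneg_left (Finset.prod_le_prod (fun _ _ => mgf_nonneg)
          fun c _ => ?_) (Real.exp_pos _).le
        exact mgf_le_exp_of_mem_Icc (hmeas (φ c)) hR (fun ω => h0 c _) (fun ω => h1 c _)
    _ = Real.exp (-R⁻¹ * A + 2 * R⁻¹ * ∑ c ∈ s, ∫ ω, φ c (fun i => N i ω) ∂P) := by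
        rw [← Real.exp_sum, ← Real.exp_add, Finset.mul_sum]
    _ ≤ _ := by
        rw [Real.exp_le_exp]
        have := mul_le_mul_of_nonneg_left hB (inv_nonneg.2 hR.le)
        have e : (A - 2 * B) / R = R⁻¹ * A - 2 * (R⁻¹ * B) := by ring
        rw [e]
        linarith

end Independence

section Poisson

open ProbabilityTheory

open scoped NNReal Nat

lemma hasSum_exp_poisson (r : ℝ≥0) (s : ℝ) :
    HasSum (fun n : ℕ => Real.exp (-r) * r ^ n / n ! * Real.exp (s * n))
      (Real.exp (r * (Real.exp s - 1))) := by
  have h := (NormedSpace.expSeries_div_hasSum_exp (r * Real.exp s : ℝ)).mul_left (Real.exp (-r))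
  rw [← Real.exp_eq_exp_ℝ, ← Real.exp_add] at h
  convert! h using 1
  · funext n
    rw [mul_pow, ← Real.exp_nat_mul, mul_comm s]
    ring
  · ring_nf

lemma integrable_exp_poissonMeasure (r : ℝ≥0) (s : ℝ) :
    Integrable (fun n : ℕ => Real.exp (s * n)) (poissonMeasure r) := by
  rw [integrable_poissonMeasure_iff]
  simpa using (hasSum_exp_poisson r s).summable

lemma integral_exp_poissonMeasure (r : ℝ≥0) (s : ℝ) :
    ∫ n : ℕ, Real.exp (s * n) ∂poissonMeasure r = Real.exp (r * (Real.exp s - 1)) :=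
  (hasSum_integral_poissonMeasure (integrable_exp_poissonMeasure r s)).unique
    (by simpa using hasSum_exp_poisson r s)

variable {Ω : Type*} {mΩ : MeasurableSpace Ω} {P : Measure Ω} {X : Ω → ℕ} {r : ℝ≥0}

lemma integrable_exp_of_hasLaw (hX : HasLaw X (poissonMeasure r) P) (s : ℝ) :
    Integrable (fun ω => Real.exp (s * X ω)) P := by
  have := integrable_exp_poissonMeasure r s
  rw [← hX.map_eq] at this
  exact this.comp_aemeasurable hX.aemeasurable

lemma mgf_of_hasLaw (hX : HasLaw X (poissonMeasure r) P) (s : ℝ) :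
    mgf (fun ω => (X ω : ℝ)) P s = Real.exp (r * (Real.exp s - 1)) := by
  rw [← integral_exp_poissonMeasure, mgf]
  exact hX.integral_comp (f := fun n : ℕ => Real.exp (s * n)) (by fun_prop)

lemma integrable_sq_of_hasLaw (hX : HasLaw X (poissonMeasure r) P) :
    Integrable (fun ω => (X ω : ℝ) ^ 2) P := by
  refine ((integrable_exp_of_hasLaw hX 1).const_mul 2).mono'
    ((by fun_prop : Measurable fun n : ℕ => (n : ℝ) ^ 2).comp_aemeasurable
      hX.aemeasurable).aestronglyMeasurable (ae_of_all _ fun ω => ?_)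
  rw [Real.norm_of_nonneg (sq_nonneg _), one_mul]
  have := Real.quadratic_le_exp_of_nonneg (Nat.cast_nonneg (α := ℝ) (X ω))
  have : (0 : ℝ) ≤ X ω := Nat.cast_nonneg _
  nlinarith

/-- second moment bound for a Poisson variable with mean at least one. -/
lemma integral_sq_le_of_hasLaw (hX : HasLaw X (poissonMeasure r) P) (hr : 1 ≤ r) :
    ∫ ω, (X ω : ℝ) ^ 2 ∂P ≤ 16 * (r : ℝ) ^ 2 := by
  have hr1 : (1 : ℝ) ≤ r := hr
  have hr0 : (0 : ℝ) < r := by linarith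
  have hle : ∀ ω, (X ω : ℝ) ^ 2 ≤ 2 * (r : ℝ) ^ 2 * Real.exp ((r : ℝ)⁻¹ * X ω) := by
    intro ω
    have h0 : 0 ≤ (r : ℝ)⁻¹ * X ω := by positivity
    have := Real.quadratic_le_exp_of_nonneg h0
    have h2 : ((r : ℝ)⁻¹ * X ω) ^ 2 ≤ 2 * Real.exp ((r : ℝ)⁻¹ * X ω) := by nlinarith
    calc (X ω : ℝ) ^ 2 = (r : ℝ) ^ 2 * ((r : ℝ)⁻¹ * X ω) ^ 2 := by field_simp
      _ ≤ (r : ℝ) ^ 2 * (2 * Real.exp ((r : ℝ)⁻¹ * X ω)) :=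
          mul_le_mul_of_nonneg_left h2 (sq_nonneg _)
      _ = _ := by ring
  have hmgf := mgf_of_hasLaw hX (r : ℝ)⁻¹
  rw [mgf] at hmgf
  have hexp : (r : ℝ) * (Real.exp (r : ℝ)⁻¹ - 1) ≤ 2 := by
    have h1 : (r : ℝ)⁻¹ ≤ 1 := inv_le_one_of_one_le₀ hr1
    have := Real.exp_bound' (inv_nonneg.2 hr0.le) h1 (n := 2) (by norm_num)
    simp [Finset.sum_range_succ, -inv_pow] at this
    have h3 : (0 : ℝ) < (r : ℝ)⁻¹ := inv_pos.2 hr0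
    have h2 : Real.exp (r : ℝ)⁻¹ - 1 ≤ 2 * (r : ℝ)⁻¹ := by nlinarith
    calc _ ≤ (r : ℝ) * (2 * (r : ℝ)⁻¹) := mul_le_mul_of_nonneg_left h2 hr0.le
      _ = 2 := by field_simp
  calc _ ≤ ∫ ω, 2 * (r : ℝ) ^ 2 * Real.exp ((r : ℝ)⁻¹ * X ω) ∂P :=
        integral_mono (integrable_sq_of_hasLaw hX)
          ((integrable_exp_of_hasLaw hX _).const_mul _) hle
    _ = 2 * (r : ℝ) ^ 2 * Real.exp (r * (Real.exp (r : ℝ)⁻¹ - 1)) := by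
        rw [integral_const_mul, hmgf]
    _ ≤ 2 * (r : ℝ) ^ 2 * 8 := by
        refine mul_le_mul_of_nonneg_left ((Real.exp_le_exp.2 hexp).trans ?_) (by positivity)
        have := Real.exp_one_lt_d9
        have h2 : Real.exp 2 = Real.exp 1 * Real.exp 1 := by rw [← Real.exp_add]; norm_num
        nlinarith [Real.exp_pos 1]
    _ = _ := by ring

lemma measureReal_lt_half_le [IsProbabilityMeasure P] (hX : HasLaw X (poissonMeasure r) P)
    {ρ : ℝ} (hr : ρ ≤ r) :
    P.real {ω | (X ω : ℝ) < ρ / 2} ≤ Real.exp (-(ρ / 10)) := by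
  have h := measure_le_le_exp_mul_mgf (μ := P) (X := fun ω => (X ω : ℝ)) (t := -1) (ρ / 2)
    (by norm_num) (integrable_exp_of_hasLaw hX (-1))
  rw [mgf_of_hasLaw hX, ← Real.exp_add] at h
  refine (measureReal_mono fun ω (hω : (X ω : ℝ) < ρ / 2) => hω.le).trans (h.trans ?_)
  rw [Real.exp_le_exp]
  have h1 : Real.exp (-1) ≤ 2 / 5 := by
    rw [Real.exp_neg]
    have := Real.exp_one_gt_d9
    rw [inv_le_comm₀ (Real.exp_pos 1) (by norm_num)]
    norm_num; linarith
  have : (0 : ℝ) ≤ r := r.2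
  nlinarith

lemma measureReal_gt_le [IsProbabilityMeasure P] (hX : HasLaw X (poissonMeasure r) P) (M : ℝ) :
    P.real {ω | M < (X ω : ℝ)} ≤ Real.exp (2 * r - M) := by
  have h := measure_ge_le_exp_mul_mgf (μ := P) (X := fun ω => (X ω : ℝ)) (t := 1) M
    (by norm_num) (integrable_exp_of_hasLaw hX 1)
  rw [mgf_of_hasLaw hX, ← Real.exp_add] at h
  refine (measureReal_mono fun ω (hω : M < X ω) => hω.le).trans (h.trans ?_)
  rw [Real.exp_le_exp]
  have := Real.exp_one_lt_d9
  have : (0 : ℝ) ≤ r := r.2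
  nlinarith

end Poisson

section PoissonField

open ProbabilityTheory

open scoped NNReal

variable {m : ℕ}

lemma blockBad_congr {ρ : ℝ} {u v : Grid d m → ℕ} {k K : ℕ} (hk : k ≤ K) (b : Grid d m)
    (l : Fin d) (huv : ∀ b' : Grid d m, (b' l).1 / 2 ^ K = (b l).1 / 2 ^ K → u b' = v b') :
    BlockBad ρ u k b ↔ BlockBad ρ v k b := by
  refine forall_congr' fun b' => forall_congr' fun h => ?_
  rw [huv b']
  obtain ⟨n, rfl⟩ := Nat.exists_eq_add_of_le hk
  rw [pow_add, ← Nat.div_div_eq_div_mul, h l, Nat.div_div_eq_div_mul]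

/-- resistance plus normalised squared occupation, the latter truncated at `M`. -/
def truncCost (D ρ : ℝ) (K : ℕ) (M : ℝ) (u : Grid d m → ℕ) (b : Grid d m) : ℝ :=
  badSum D K ρ u b + min (u b : ℝ) M ^ 2 / ρ ^ 2

lemma truncCost_congr {D ρ M : ℝ} {K : ℕ} {u v : Grid d m → ℕ} (b : Grid d m) (l : Fin d)
    (huv : ∀ b' : Grid d m, (b' l).1 / 2 ^ K = (b l).1 / 2 ^ K → u b' = v b') :
    truncCost D ρ K M u b = truncCost D ρ K M v b := by
  classical
  rw [truncCost, truncCost, huv b rfl, badSum, badSum]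
  congr 2
  refine Finset.sum_congr rfl fun k hk => ?_
  have := blockBad_congr (ρ := ρ) (Finset.mem_range.1 hk).le b l huv
  by_cases h : BlockBad ρ u k b
  · rw [if_pos h, if_pos (this.1 h)]
  · rw [if_neg h, if_neg (this.not.1 h)]

lemma truncCost_nonneg {D ρ M : ℝ} {K : ℕ} (u : Grid d m → ℕ) (b : Grid d m) :
    0 ≤ truncCost D ρ K M u b :=
  add_nonneg (zero_le_one.trans (one_le_badSum _ _ _ _ _)) (by positivity)

/-- deterministic bound on `truncCost`. -/
def costBound (d : ℕ) (D : ℝ) (K : ℕ) (M : ℝ) : ℝ :=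
  1 + K * Real.exp (2 * D * (2 ^ K) ^ d) + M ^ 2

lemma costBound_pos (d : ℕ) (D : ℝ) (K : ℕ) (M : ℝ) : 0 < costBound d D K M := by
  unfold costBound
  positivity

lemma truncCost_le {D ρ M : ℝ} {K : ℕ} (hD : 0 ≤ D) (hρ : 1 ≤ ρ) (hM : 0 ≤ M)
    (u : Grid d m → ℕ) (b : Grid d m) : truncCost D ρ K M u b ≤ costBound d D K M := by
  classical
  refine add_le_add (add_le_add le_rfl ?_) ?_
  · refine (Finset.sum_le_card_nsmul _ _ (Real.exp (2 * D * (2 ^ K) ^ d)) fun k hk => ?_).trans_eq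
      (by simp)
    split_ifs
    · rw [Real.exp_le_exp]
      have h : ((2 : ℝ) ^ (k + 1)) ^ d ≤ (2 ^ K) ^ d :=
        pow_le_pow_left₀ (by positivity)
          (pow_le_pow_right₀ (by norm_num) (Finset.mem_range.1 hk)) d
      exact mul_le_mul_of_nonneg_left (by linarith) (by positivity)
    · positivity
  · have h0 : 0 ≤ min (u b : ℝ) M := le_min (Nat.cast_nonneg _) hM
    calc _ ≤ min (u b : ℝ) M ^ 2 := div_le_self (sq_nonneg _) (one_le_pow₀ hρ)
      _ ≤ M ^ 2 := pow_le_pow_left₀ h0 (min_le_right _ _) 2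

variable {Ω : Type*} {mΩ : MeasurableSpace Ω}

/-- independent Poisson variables of mean `r` indexed by the dyadic grid. -/
structure IsPoissonField (N : Grid d m → Ω → ℕ) (r : ℝ≥0) (P : Measure Ω) : Prop where
  indep : iIndepFun N P
  measurable : ∀ b, Measurable (N b)
  hasLaw : ∀ b, HasLaw (N b) (poissonMeasure r) P

namespace IsPoissonField

variable {P : Measure Ω} {N : Grid d m → Ω → ℕ} {r : ℝ≥0}

lemma measurable_comp (h : IsPoissonField N r P) {E : Type*} [MeasurableSpace E]
    (f : (Grid d m → ℕ) → E) : Measurable fun ω => f fun b => N b ω :=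
  (Measurable.of_discrete (f := f)).comp (measurable_pi_lambda _ h.measurable)

variable [IsProbabilityMeasure P]

lemma measureReal_blockBad_le (h : IsPoissonField N r P) {ρ : ℝ} (hr : ρ ≤ r) {k : ℕ}
    (hk : k ≤ m) (b : Grid d m) :
    P.real {ω | BlockBad ρ (fun b => N b ω) k b} ≤ Real.exp (-(ρ / 10 * (2 ^ k) ^ d)) := by
  set S : Finset (Grid d m) := Fintype.piFinset fun i => seg k (b i) with hS
  have hset : {ω | BlockBad ρ (fun b => N b ω) k b} =
      ⋂ b' ∈ S, N b' ⁻¹' {n : ℕ | (n : ℝ) < ρ / 2} := by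
    ext ω
    simp only [Set.mem_ofPred_eq, BlockBad, Set.mem_iInter, Set.mem_preimage, hS,
      Fintype.mem_piFinset, mem_seg]
  have hcard : S.card = (2 ^ k) ^ d := by
    rw [hS, Fintype.card_piFinset]
    simp [card_seg hk]
  rw [hset, measureReal_def, h.indep.measure_inter_preimage_eq_mul S fun _ _ => .of_discrete,
    ENNReal.toReal_prod]
  refine (Finset.prod_le_prod (fun _ _ => ENNReal.toReal_nonneg) fun b' _ =>
    measureReal_lt_half_le (h.hasLaw b') hr).trans_eq ?_
  rw [Finset.prod_const, hcard, ← Real.exp_nat_mul]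
  push_cast
  ring_nf

lemma integral_badSum_le (h : IsPoissonField N r P) {D ρ : ℝ} (hd : d ≠ 0) (hr : ρ ≤ r)
    (hρ : 2 * D * 2 ^ d + 1 ≤ ρ / 10) (hD : 0 ≤ D) {K : ℕ} (hK : K ≤ m) (b : Grid d m) :
    ∫ ω, badSum D K ρ (fun b => N b ω) b ∂P ≤ 2 := by
  classical
  have hind : ∀ k, ∀ c : ℝ, (fun ω => if BlockBad ρ (fun b => N b ω) k b then c else 0) =
      {ω | BlockBad ρ (fun b => N b ω) k b}.indicator fun _ => c := by
    intro k c
    funext ω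
    simp [Set.indicator_apply]
  have hms : ∀ k, MeasurableSet {ω | BlockBad ρ (fun b => N b ω) k b} := fun k =>
    (measurable_pi_lambda _ h.measurable)
      (MeasurableSet.of_discrete (s := {u : Grid d m → ℕ | BlockBad ρ u k b}))
  have hint : ∀ k, ∀ c : ℝ,
      Integrable (fun ω => if BlockBad ρ (fun b => N b ω) k b then c else 0) P := by
    intro k c
    rw [hind]
    exact (integrable_const c).indicator (hms k)
  have hterm : ∀ k ∈ Finset.range K, ∫ ω, (if BlockBad ρ (fun b => N b ω) k b then
      Real.exp (2 * D * ((2 ^ (k + 1)) ^ d - 1)) else 0) ∂P ≤ (1 / 2) * (1 / 2) ^ k := by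
    intro k hk
    have hk' : k ≤ m := (Finset.mem_range.1 hk).le.trans hK
    rw [hind, integral_indicator_const _ (hms k), smul_eq_mul]
    calc _ ≤ Real.exp (-(ρ / 10 * (2 ^ k) ^ d)) *
          Real.exp (2 * D * ((2 ^ (k + 1)) ^ d - 1)) :=
          mul_le_mul_of_nonneg_right (h.measureReal_blockBad_le hr hk' b) (Real.exp_pos _).le
      _ ≤ Real.exp (-((k + 1 : ℕ) : ℝ)) := by
          rw [← Real.exp_add, Real.exp_le_exp]
          have h1 : ((2 : ℝ) ^ (k + 1)) ^ d = 2 ^ d * (2 ^ k) ^ d := by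
            rw [pow_succ', mul_pow]
          have h2 : ((k + 1 : ℕ) : ℝ) ≤ (2 ^ k) ^ d := by
            have : k + 1 ≤ 2 ^ k := Nat.lt_two_pow_self
            calc ((k + 1 : ℕ) : ℝ) ≤ ((2 ^ k : ℕ) : ℝ) := by exact_mod_cast this
              _ = 2 ^ k := by norm_cast
              _ ≤ (2 ^ k) ^ d := le_self_pow₀ (one_le_pow₀ (by norm_num)) hd
          have h3 : (0 : ℝ) ≤ (2 ^ k) ^ d := by positivity
          rw [h1]
          nlinarith [mul_le_mul_of_nonneg_right hρ h3]
      _ ≤ (1 / 2) ^ (k + 1) := by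
          rw [← mul_one ((k + 1 : ℕ) : ℝ), ← mul_neg, Real.exp_nat_mul]
          refine pow_le_pow_left₀ (Real.exp_pos _).le ?_ _
          rw [Real.exp_neg, one_div]
          refine inv_anti₀ (by norm_num) ?_
          have := Real.exp_one_gt_d9
          linarith
      _ = _ := by ring
  unfold badSum
  rw [integral_add (integrable_const _) (integrable_finsetSum _ fun k _ => hint k _),
    integral_finsetSum _ fun k _ => hint k _]
  have h1 := Finset.sum_le_sum hterm
  rw [← Finset.mul_sum, geom_sum_eq (by norm_num)] at h1
  have h2 : (0 : ℝ) ≤ (1 / 2) ^ K := by positivity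
  have h3 : (1 / 2 : ℝ) * (((1 / 2) ^ K - 1) / (1 / 2 - 1)) = 1 - (1 / 2) ^ K := by ring
  simp only [integral_const, probReal_univ, one_smul]
  linarith

lemma integral_truncCost_le (h : IsPoissonField N r P) {D ρ M : ℝ} (hd : d ≠ 0) (hr : ρ ≤ r)
    (hr' : (r : ℝ) ≤ 2 ^ d * ρ) (hρ1 : 1 ≤ ρ) (hM : 0 ≤ M)
    (hρ : 2 * D * 2 ^ d + 1 ≤ ρ / 10) (hD : 0 ≤ D) {K : ℕ} (hK : K ≤ m) (b : Grid d m) :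
    ∫ ω, truncCost D ρ K M (fun b => N b ω) b ∂P ≤ 2 + 16 * 4 ^ d := by
  have hr1 : (1 : ℝ) ≤ r := hρ1.trans hr
  have hρ0 : 0 < ρ := by linarith
  have hint : Integrable (fun ω => badSum D K ρ (fun b => N b ω) b) P := by
    refine Integrable.of_bound
      (h.measurable_comp fun u => badSum D K ρ u b).aestronglyMeasurable
      (costBound d D K M) (ae_of_all _ fun ω => ?_)
    rw [Real.norm_of_nonneg (zero_le_one.trans (one_le_badSum _ _ _ _ _))]
    refine le_trans ?_ (truncCost_le hD hρ1 hM (fun b => N b ω) b)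
    rw [truncCost]
    linarith [show 0 ≤ min (N b ω : ℝ) M ^ 2 / ρ ^ 2 by positivity]
  have hsq := (integrable_sq_of_hasLaw (h.hasLaw b)).div_const (ρ ^ 2)
  calc _ ≤ ∫ ω, badSum D K ρ (fun b => N b ω) b + (N b ω : ℝ) ^ 2 / ρ ^ 2 ∂P := by
        refine integral_mono_of_nonneg (ae_of_all _ fun ω => truncCost_nonneg _ b)
          (hint.add hsq) (ae_of_all _ fun ω => ?_)
        refine add_le_add le_rfl (div_le_div_of_nonneg_right ?_ (sq_nonneg _))
        exact pow_le_pow_left₀ (le_min (Nat.cast_nonneg _) hM) (min_le_left _ _) 2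
    _ ≤ 2 + 16 * 4 ^ d := by
        rw [integral_add hint hsq, integral_div]
        refine add_le_add (h.integral_badSum_le hd hr hρ hD hK b) ?_
        rw [div_le_iff₀ (by positivity)]
        refine (integral_sq_le_of_hasLaw (h.hasLaw b) (by exact_mod_cast hr1)).trans ?_
        have h1 := pow_le_pow_left₀ r.2 hr' 2
        rw [mul_pow, ← pow_mul, mul_comm d 2, pow_mul] at h1
        norm_num at h1
        linarith

lemma measureReal_lineSum_truncCost_le (h : IsPoissonField N r P) {D ρ M : ℝ} (hd : d ≠ 0)
    (hr : ρ ≤ r) (hr' : (r : ℝ) ≤ 2 ^ d * ρ) (hρ1 : 1 ≤ ρ) (hM : 0 ≤ M)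
    (hρ : 2 * D * 2 ^ d + 1 ≤ ρ / 10) (hD : 0 ≤ D) {K : ℕ} (hK : K ≤ m) {j : ℕ} (hj : j ≤ m)
    (k : Fin d) (b : Grid d m) :
    P.real {ω | (2 * (2 + 16 * 4 ^ d) + 1) * 2 ^ j ≤
      lineSum j k (truncCost D ρ K M fun b => N b ω) b} ≤
      Real.exp (-(2 ^ j / (2 ^ K * costBound d D K M))) := by
  have hB := costBound_pos d D K M
  set s := (seg j (b k)).image fun t => t.1 / 2 ^ K with hs
  set φ : ℕ → (Grid d m → ℕ) → ℝ := fun c u =>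
    ∑ t ∈ seg j (b k) with t.1 / 2 ^ K = c, truncCost D ρ K M u (Function.update b k t) with hφ
  have hsum : ∀ u : Grid d m → ℕ,
      ∑ c ∈ s, φ c u = lineSum j k (truncCost D ρ K M u) b := fun u =>
    Finset.sum_fiberwise_of_maps_to (fun t ht => Finset.mem_image_of_mem _ ht) _
  have hint : ∀ b, Integrable (fun ω => truncCost D ρ K M (fun b => N b ω) b) P := fun b =>
    Integrable.of_bound (h.measurable_comp fun u => truncCost D ρ K M u b).aestronglyMeasurable
      (costBound d D K M) (ae_of_all _ fun ω => by
        rw [Real.norm_of_nonneg (truncCost_nonneg _ _)]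
        exact truncCost_le hD hρ1 hM _ b)
  have hmain := measureReal_sum_ge_le h.indep h.measurable
    (S := fun c => Finset.univ.filter fun b' : Grid d m => (b' k).1 / 2 ^ K = c) (φ := φ) s
    (A := (2 * (2 + 16 * 4 ^ d) + 1) * 2 ^ j) (B := (2 + 16 * 4 ^ d) * 2 ^ j)
    (R := 2 ^ K * costBound d D K M) ?_ ?_ (by positivity) ?_ ?_ ?_
  · simp_rw [hsum] at hmain
    refine hmain.trans (le_of_eq ?_)
    congr 3
    ring
  · intro c _ c' _ hcc
    rw [Function.onFun, Finset.disjoint_left]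
    intro b' h1 h2
    rw [Finset.mem_filter] at h1 h2
    exact hcc (h1.2.symm.trans h2.2)
  · intro c u v huv
    refine Finset.sum_congr rfl fun t ht => truncCost_congr _ k fun b' hb' => huv b' ?_
    rw [Function.update_self] at hb'
    simp [hb', (Finset.mem_filter.1 ht).2]
  · exact fun c u => Finset.sum_nonneg fun _ _ => truncCost_nonneg _ _
  · intro c u
    refine (Finset.sum_le_card_nsmul _ _ (costBound d D K M) fun t _ =>
      truncCost_le hD hρ1 hM _ _).trans ?_
    rw [nsmul_eq_mul]
    refine mul_le_mul_of_nonneg_right ?_ hB.le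
    rcases Finset.eq_empty_or_nonempty ((seg j (b k)).filter fun t => t.1 / 2 ^ K = c) with h0 | h0
    · rw [h0]; simp
    · obtain ⟨t, ht⟩ := h0
      have hsub : ((seg j (b k)).filter fun t => t.1 / 2 ^ K = c) ⊆ seg K t := fun t' ht' =>
        mem_seg.2 ((Finset.mem_filter.1 ht').2.trans (Finset.mem_filter.1 ht).2.symm)
      have := Finset.card_le_card hsub
      rw [card_seg hK] at this
      exact_mod_cast this
  · have h1 : ∑ c ∈ s, ∫ ω, φ c (fun b => N b ω) ∂P =
        ∑ t ∈ seg j (b k), ∫ ω, truncCost D ρ K M (fun b => N b ω) (Function.update b k t) ∂P := by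
      rw [← integral_finsetSum _ fun t _ => hint _, ← integral_finsetSum]
      · simp_rw [hsum]
        rfl
      · exact fun c _ => integrable_finsetSum _ fun t _ => hint _
    rw [h1]
    refine (Finset.sum_le_card_nsmul _ _ _ fun t _ =>
      h.integral_truncCost_le hd hr hr' hρ1 hM hρ hD hK _).trans_eq ?_
    rw [card_seg hj, nsmul_eq_mul]
    push_cast
    ring

lemma card_grid (d m : ℕ) : Fintype.card (Grid d m) = 2 ^ (m * d) := by
  simp [Grid, pow_mul]

theorem measureReal_not_regularCounts_le (h : IsPoissonField N r P) {D ρ M : ℝ} (hd : d ≠ 0)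
    (hr : ρ ≤ r) (hr' : (r : ℝ) ≤ 2 ^ d * ρ) (hρ1 : 1 ≤ ρ) (hM : 0 ≤ M)
    (hρ : 2 * D * 2 ^ d + 1 ≤ ρ / 10) (hD : 0 ≤ D) {K : ℕ} (hK : K ≤ m) (j₀ : ℕ) :
    P.real {ω | ¬ RegularCounts D (2 * (2 + 16 * 4 ^ d) + 1) ρ K j₀ M fun b => N b ω} ≤
      2 ^ (m * d) * Real.exp (-(ρ / 10 * (2 ^ K) ^ d)) +
      2 ^ (m * d) * Real.exp (2 * r - M) +
      (m + 1) * (d * (2 ^ (m * d) * Real.exp (-(2 ^ j₀ / (2 ^ K * costBound d D K M))))) := by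
  have hB := costBound_pos d D K M
  set a : ℝ := 2 * (2 + 16 * 4 ^ d) + 1 with ha
  set bad : ℕ → Fin d → Grid d m → Set Ω := fun j k b =>
    {ω | a * 2 ^ j ≤ lineSum j k (truncCost D ρ K M fun b => N b ω) b} with hbad
  set J := (Finset.range (m + 1)).filter fun j => j₀ ≤ j with hJ
  have hsub : {ω | ¬ RegularCounts D a ρ K j₀ M fun b => N b ω} ⊆
      ((⋃ b, {ω | BlockBad ρ (fun b => N b ω) K b}) ∪ (⋃ b, {ω | M < N b ω})) ∪
      ⋃ j ∈ J, ⋃ k, ⋃ b, bad j k b := by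
    intro ω hω
    by_contra hcon
    simp only [Set.mem_union, Set.mem_iUnion, not_or, not_exists, Set.mem_ofPred_eq,
      not_lt] at hcon
    obtain ⟨⟨h1, h2⟩, h3⟩ := hcon
    refine hω ⟨h1, h2, fun j hj₀ hj k b => ?_⟩
    have h4 := h3 j (by simp [hJ, hj₀]; omega) k b
    rw [hbad, Set.mem_ofPred_eq, not_le] at h4
    refine le_trans (le_of_eq ?_) h4.le
    congr 1
    funext b'
    rw [truncCost, min_eq_left (h2 b')]
  refine (measureReal_mono hsub).trans ((measureReal_union_le _ _).trans (add_le_add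
    ((measureReal_union_le _ _).trans (add_le_add ?_ ?_)) ?_))
  · refine (measureReal_iUnion_fintype_le _).trans ((Finset.sum_le_card_nsmul _ _ _ fun b _ =>
      h.measureReal_blockBad_le hr hK b).trans_eq ?_)
    rw [Finset.card_univ, card_grid, nsmul_eq_mul]
    push_cast
    rfl
  · refine (measureReal_iUnion_fintype_le _).trans ((Finset.sum_le_card_nsmul _ _ _ fun b _ =>
      measureReal_gt_le (h.hasLaw b) M).trans_eq ?_)
    rw [Finset.card_univ, card_grid, nsmul_eq_mul]
    push_cast
    rfl
  · set c := Real.exp (-(2 ^ j₀ / (2 ^ K * costBound d D K M))) with hc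
    have h1 : ∀ j ∈ J, P.real (⋃ k, ⋃ b, bad j k b) ≤ d * (2 ^ (m * d) * c) := by
      intro j hj
      rw [hJ, Finset.mem_filter, Finset.mem_range] at hj
      refine (measureReal_iUnion_fintype_le _).trans ((Finset.sum_le_card_nsmul _ _
        (2 ^ (m * d) * c) fun k _ => ?_).trans_eq (by simp))
      refine (measureReal_iUnion_fintype_le _).trans ((Finset.sum_le_card_nsmul _ _ c
        fun b _ => ?_).trans_eq ?_)
      · refine (h.measureReal_lineSum_truncCost_le hd hr hr' hρ1 hM hρ hD hK (by omega)
          k b).trans ?_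
        rw [hc, Real.exp_le_exp, neg_le_neg_iff]
        exact div_le_div_of_nonneg_right (pow_le_pow_right₀ (by norm_num) hj.2) (by positivity)
      · rw [Finset.card_univ, card_grid, nsmul_eq_mul]
        push_cast
        rfl
    refine (measureReal_biUnion_finset_le _ _).trans
      ((Finset.sum_le_card_nsmul _ _ _ h1).trans ?_)
    rw [nsmul_eq_mul]
    refine mul_le_mul_of_nonneg_right ?_ (by positivity)
    have : J.card ≤ m + 1 := (Finset.card_filter_le _ _).trans_eq (Finset.card_range _)
    exact_mod_cast this

end IsPoissonField

end PoissonField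

section GridOfCube

open scoped NNReal

/-- index of the subinterval of `[-L/2, L/2]`, split into `2 ^ m` equal parts, containing `x`. -/
def gridIdx (m : ℕ) (L x : ℝ) : Fin (2 ^ m) :=
  ⟨min ⌊(x + L / 2) / (L / 2 ^ m)⌋₊ (2 ^ m - 1), by
    have : 0 < 2 ^ m := by positivity
    omega⟩

/-- index of the cell of the cube of side `L`, split into `2 ^ (m * d)` equal cells. -/
def gridOf (m : ℕ) (L : ℝ) (p : Pt d) : Grid d m := fun i => gridIdx m L (p i)

/-- the cell of the cube with index `b`. -/
def gridBox (m : ℕ) (L : ℝ) (b : Grid d m) : Set (Pt d) := {p | p ∈ cube d L ∧ gridOf m L p = b}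

lemma measurable_gridIdx (m : ℕ) (L : ℝ) : Measurable (gridIdx m L) := by
  have : Measurable fun x : ℝ => min ⌊(x + L / 2) / (L / 2 ^ m)⌋₊ (2 ^ m - 1) := by fun_prop
  refine measurable_to_countable' fun t => ?_
  have h := this (measurableSet_singleton t.1)
  convert! h using 1
  ext x
  simp [gridIdx, Fin.ext_iff]

variable {m : ℕ} {L : ℝ}

lemma gridIdx_le (hL : 0 < L) {x : ℝ} (hx : |x| ≤ L / 2) :
    ((gridIdx m L x : ℕ) : ℝ) * (L / 2 ^ m) ≤ x + L / 2 := by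
  have hs : 0 < L / 2 ^ m := by positivity
  rw [← le_div_iff₀ hs]
  refine le_trans ?_ (Nat.floor_le (div_nonneg (by linarith [neg_le_of_abs_le hx]) hs.le))
  exact Nat.cast_le.2 (min_le_left _ _)

lemma le_gridIdx (hL : 0 < L) {x : ℝ} (hx : |x| ≤ L / 2) :
    x + L / 2 ≤ (((gridIdx m L x : ℕ) : ℝ) + 1) * (L / 2 ^ m) := by
  have hs : 0 < L / 2 ^ m := by positivity
  rw [← div_le_iff₀ hs]
  rcases min_choice ⌊(x + L / 2) / (L / 2 ^ m)⌋₊ (2 ^ m - 1) with h | h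
  · have : (gridIdx m L x : ℕ) = ⌊(x + L / 2) / (L / 2 ^ m)⌋₊ := h
    rw [this]
    exact (Nat.lt_floor_add_one _).le
  · have h' : (gridIdx m L x : ℕ) = 2 ^ m - 1 := h
    have : ((gridIdx m L x : ℕ) : ℝ) + 1 = 2 ^ m := by
      rw [h']
      have : 1 ≤ 2 ^ m := Nat.one_le_two_pow
      push_cast [Nat.cast_sub this]
      ring
    rw [this, div_le_iff₀ hs]
    have e : (2 : ℝ) ^ m * (L / 2 ^ m) = L := by field_simp
    rw [e]
    linarith [le_of_abs_le hx]

lemma gridIdx_eq (hL : 0 < L) {x : ℝ} {t : Fin (2 ^ m)} (h1 : (t : ℕ) * (L / 2 ^ m) ≤ x + L / 2)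
    (h2 : x + L / 2 < ((t : ℕ) + 1) * (L / 2 ^ m)) : gridIdx m L x = t := by
  have hs : 0 < L / 2 ^ m := by positivity
  have hf : ⌊(x + L / 2) / (L / 2 ^ m)⌋₊ = t.1 := by
    rw [Nat.floor_eq_iff (div_nonneg (le_trans (by positivity) h1) hs.le), le_div_iff₀ hs,
      div_lt_iff₀ hs]
    exact ⟨h1, h2⟩
  ext
  have := t.2
  simp only [gridIdx, hf]
  omega

lemma isGridMap_gridOf (hL : 0 < L) (h1 : 2 ^ m ≤ L) (h2 : L ≤ 2 * 2 ^ m) {E : Finset (Pt d)}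
    (hE : ∀ x ∈ E, x ∈ cube d L) : IsGridMap E (gridOf m L) := by
  have hm : (0 : ℝ) < 2 ^ m := by positivity
  have hs1 : 1 ≤ L / 2 ^ m := by rwa [le_div_iff₀ hm, one_mul]
  have hs2 : L / 2 ^ m ≤ 2 := by rwa [div_le_iff₀ hm]
  set s := L / 2 ^ m with hs
  constructor
  · intro x hx y hy t ht
    rcases Nat.eq_zero_or_pos d with rfl | hd
    · have : x = y := Subsingleton.elim _ _
      simp [this]
    have ht0 : 0 ≤ t := (abs_nonneg _).trans (ht ⟨0, hd⟩)
    rw [EuclideanSpace.dist_eq]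
    have hle : ∀ i, dist (x i) (y i) ^ 2 ≤ (2 * (t + 1)) ^ 2 := by
      intro i
      refine pow_le_pow_left₀ dist_nonneg ?_ 2
      have := abs_le.1 (ht i)
      have a1 := gridIdx_le (m := m) hL (hE x hx i)
      have a2 := le_gridIdx (m := m) hL (hE x hx i)
      have b1 := gridIdx_le (m := m) hL (hE y hy i)
      have b2 := le_gridIdx (m := m) hL (hE y hy i)
      simp only [gridOf] at this
      rw [Real.dist_eq, abs_le]
      constructor <;> nlinarith
    refine Real.sqrt_le_iff.2 ⟨by positivity, ?_⟩
    refine (Finset.sum_le_card_nsmul _ _ _ fun i _ => hle i).trans_eq ?_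
    rw [nsmul_eq_mul, Finset.card_univ, Fintype.card_fin, mul_assoc, mul_pow 2, mul_pow 2,
      mul_pow √(d : ℝ), Real.sq_sqrt (Nat.cast_nonneg d)]
    ring
  · intro x hx y hy i
    have hxy : |x i - y i| ≤ dist x y := by
      rw [← Real.dist_eq]
      exact PiLp.dist_apply_le x y i
    have := abs_le.1 hxy
    have a1 := gridIdx_le (m := m) hL (hE x hx i)
    have a2 := le_gridIdx (m := m) hL (hE x hx i)
    have b1 := gridIdx_le (m := m) hL (hE y hy i)
    have b2 := le_gridIdx (m := m) hL (hE y hy i)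
    simp only [gridOf]
    have hd0 : 0 ≤ dist x y := dist_nonneg
    rw [abs_le]
    constructor
    · by_contra hcon
      nlinarith
    · by_contra hcon
      nlinarith

lemma boxCount_gridOf {E : Finset (Pt d)} {ξ : Config d} (hE : (E : Set (Pt d)) = ξ ∩ cube d L)
    (b : Grid d m) : boxCount E (gridOf m L) b = (ξ ∩ gridBox m L b).ncard := by
  rw [boxCount, boxPts, ← Set.ncard_coe_finset]
  congr 1
  ext x
  have : x ∈ E ↔ x ∈ ξ ∩ cube d L := by rw [← hE]; rfl
  simp [gridBox, this, and_assoc]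

lemma isBounded_cube (d : ℕ) (L : ℝ) : Bornology.IsBounded (cube d L) := by
  rw [isBounded_iff_forall_norm_le]
  refine ⟨√(d * (L / 2) ^ 2), fun x hx => ?_⟩
  rw [EuclideanSpace.norm_eq]
  refine Real.sqrt_le_sqrt ((Finset.sum_le_card_nsmul _ _ ((L / 2) ^ 2) fun i _ => ?_).trans_eq ?_)
  · exact pow_le_pow_left₀ (norm_nonneg _) (hx i) 2
  · simp

lemma isBounded_gridBox (b : Grid d m) : Bornology.IsBounded (gridBox m L b) :=
  (isBounded_cube d L).subset fun _ hp => hp.1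

lemma gridBox_eq (b : Grid d m) : gridBox m L b =
    WithLp.ofLp ⁻¹' (Set.univ.pi fun i => {x : ℝ | |x| ≤ L / 2 ∧ gridIdx m L x = b i}) := by
  ext p
  simp only [gridBox, cube, gridOf, funext_iff, Set.mem_ofPred_eq, Set.mem_preimage,
    Set.mem_univ_pi]
  exact forall_and.symm

lemma measurableSet_abs_le_inter (t : Fin (2 ^ m)) :
    MeasurableSet {x : ℝ | |x| ≤ L / 2 ∧ gridIdx m L x = t} :=
  (measurableSet_le measurable_norm measurable_const).inter
    ((measurable_gridIdx m L) (measurableSet_singleton t))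

lemma measurableSet_gridBox (b : Grid d m) : MeasurableSet (gridBox m L b) := by
  rw [gridBox_eq]
  exact (PiLp.volume_preserving_ofLp (Fin d)).measurable
    (MeasurableSet.univ_pi fun i => measurableSet_abs_le_inter (b i))

lemma volume_gridBox (hL : 0 < L) (b : Grid d m) :
    volume (gridBox m L b) = ENNReal.ofReal (L / 2 ^ m) ^ d := by
  have h1 : ∀ t : Fin (2 ^ m),
      volume {x : ℝ | |x| ≤ L / 2 ∧ gridIdx m L x = t} = ENNReal.ofReal (L / 2 ^ m) := by
    intro t
    have hs : 0 < L / 2 ^ m := by positivity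
    have hlen : ((t : ℕ) + 1 : ℝ) * (L / 2 ^ m) - L / 2 - ((t : ℕ) * (L / 2 ^ m) - L / 2) =
        L / 2 ^ m := by ring
    refine le_antisymm ?_ ?_
    · refine (measure_mono (t := Set.Icc ((t : ℕ) * (L / 2 ^ m) - L / 2)
        (((t : ℕ) + 1 : ℝ) * (L / 2 ^ m) - L / 2)) ?_).trans_eq (by rw [Real.volume_Icc, hlen])
      rintro x ⟨hx, rfl⟩
      have := gridIdx_le (m := m) hL hx
      have := le_gridIdx (m := m) hL hx
      constructor <;> linarith
    · refine le_trans (le_of_eq (by rw [Real.volume_Ico, hlen])) (measure_mono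
        (s := Set.Ico ((t : ℕ) * (L / 2 ^ m) - L / 2)
        (((t : ℕ) + 1 : ℝ) * (L / 2 ^ m) - L / 2)) ?_)
      rintro x ⟨hx1, hx2⟩
      refine ⟨?_, gridIdx_eq hL (by linarith) (by linarith)⟩
      have h0 : 0 ≤ ((t : ℕ) : ℝ) * (L / 2 ^ m) := by positivity
      have h3 : (((t : ℕ) : ℝ) + 1) * (L / 2 ^ m) ≤ L := by
        have : (((t : ℕ) : ℝ) + 1) ≤ 2 ^ m := by exact_mod_cast t.2
        calc _ ≤ 2 ^ m * (L / 2 ^ m) := mul_le_mul_of_nonneg_right this hs.le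
          _ = L := by field_simp
      rw [abs_le]
      constructor <;> linarith
  rw [gridBox_eq, (PiLp.volume_preserving_ofLp (Fin d)).measure_preimage
    (MeasurableSet.univ_pi fun i => measurableSet_abs_le_inter (b i)).nullMeasurableSet,
    volume_pi_pi]
  simp [h1]

open ProbabilityTheory in
lemma IsPoissonPP.isPoissonField {ρ : ℝ} {P : Measure (Config d)} (hP : IsPoissonPP d ρ P)
    (hρ : 0 ≤ ρ) (hL : 0 < L) (m : ℕ) :
    IsPoissonField (fun (b : Grid d m) (ξ : Config d) => (ξ ∩ gridBox m L b).ncard)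
      (Real.toNNReal (ρ * (L / 2 ^ m) ^ d)) P := by
  obtain ⟨hprob, -, hcount⟩ := hP
  have hvol : ∀ b : Grid d m, (volume (gridBox m L b)).toReal = (L / 2 ^ m) ^ d := by
    intro b
    rw [volume_gridBox hL, ENNReal.toReal_pow, ENNReal.toReal_ofReal (by positivity)]
  have hdisj : ∀ b b' : Grid d m, b ≠ b' → Disjoint (gridBox m L b) (gridBox m L b') := by
    intro b b' hbb
    rw [Set.disjoint_left]
    intro p h1 h2
    exact hbb (h1.2.symm.trans h2.2)
  set r := Real.toNNReal (ρ * (L / 2 ^ m) ^ d) with hr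
  have hrr : (r : ℝ) = ρ * (L / 2 ^ m) ^ d := Real.coe_toNNReal _ (by positivity)
  have hmeas : ∀ b : Grid d m, Measurable fun ξ : Config d => (ξ ∩ gridBox m L b).ncard :=
    fun b => measurable_to_countable' fun n => MeasurableSpace.measurableSet_generateFrom
      ⟨gridBox m L b, n, isBounded_gridBox b, measurableSet_gridBox b, rfl⟩
  have hone : ∀ (b : Grid d m) (n : ℕ), P {ξ | (ξ ∩ gridBox m L b).ncard = n} =
      poissonMeasure r {n} := by
    intro b n
    have := hcount 1 (fun _ => gridBox m L b) (fun _ => isBounded_gridBox b)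
      (fun _ => measurableSet_gridBox b) (fun i j hij => absurd (Subsingleton.elim i j) hij)
      (fun _ => n)
    simp only [forall_const, Finset.univ_unique, Finset.prod_const, Finset.card_singleton,
      pow_one, hvol] at this
    rw [this, poissonMeasure_singleton, hrr, neg_mul]
  have hlaw : ∀ b : Grid d m,
      P.map (fun ξ : Config d => (ξ ∩ gridBox m L b).ncard) = poissonMeasure r := by
    intro b
    refine Measure.ext_of_singleton fun n => ?_
    rw [Measure.map_apply (hmeas b) (measurableSet_singleton n), ← hone b n]
    rfl
  refine ⟨?_, hmeas, fun b => ⟨(hmeas b).aemeasurable, hlaw b⟩⟩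
  rw [iIndepFun_iff_map_fun_eq_pi_map fun b => (hmeas b).aemeasurable]
  refine Measure.ext_of_singleton fun u => ?_
  rw [Measure.map_apply (measurable_pi_lambda _ hmeas) (measurableSet_singleton u),
    Measure.pi_singleton]
  set e := Fintype.equivFin (Grid d m) with he
  have h := hcount _ (fun j => gridBox m L (e.symm j)) (fun _ => isBounded_gridBox _)
    (fun _ => measurableSet_gridBox _)
    (fun i j hij => hdisj _ _ (e.symm.injective.ne hij)) (fun j => u (e.symm j))
  have hset : (fun (ξ : Config d) (b : Grid d m) => (ξ ∩ gridBox m L b).ncard) ⁻¹' {u} =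
      {ξ | ∀ j, (ξ ∩ gridBox m L (e.symm j)).ncard = u (e.symm j)} := by
    ext ξ
    simp only [Set.mem_preimage, Set.mem_singleton_iff, Set.mem_ofPred_eq, funext_iff]
    exact (e.symm.forall_congr_right (q := fun b => (ξ ∩ gridBox m L b).ncard = u b)).symm
  rw [hset, h]
  simp only [hlaw, poissonMeasure_singleton, hvol, hrr, neg_mul]
  exact e.symm.prod_comp fun b => ENNReal.ofReal
    (Real.exp (-(ρ * (L / 2 ^ m) ^ d)) * (ρ * (L / 2 ^ m) ^ d) ^ u b / (u b).factorial)

end GridOfCube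

section Asymptotics

variable {m : ℕ} {ρ : ℝ}

lemma eventually_mul_pow_le_exp (A : ℝ) (k : ℕ) {b : ℝ} (hb : 0 < b) :
    ∀ᶠ m : ℕ in atTop, A * (m : ℝ) ^ k ≤ Real.exp (b * m) := by
  have h := ((isLittleO_pow_exp_pos_mul_atTop k hb).comp_tendsto
    tendsto_natCast_atTop_atTop).def (c := (|A| + 1)⁻¹) (by positivity)
  filter_upwards [h] with m hm
  simp only [Function.comp_apply, Real.norm_eq_abs, Real.abs_exp] at hm
  rw [abs_of_nonneg (by positivity), le_inv_mul_iff₀ (by positivity)] at hm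
  refine le_trans (mul_le_mul_of_nonneg_right ?_ (by positivity)) hm
  linarith [le_abs_self A]

/-- cost per unit volume of a sparse block. -/
def blockRate (d : ℕ) : ℝ := crossCost d + d + 1

lemma one_le_blockRate (d : ℕ) : 1 ≤ blockRate d := by
  have := crossCost_nonneg d
  have : (0 : ℝ) ≤ d := Nat.cast_nonneg d
  unfold blockRate
  linarith

/-- level of the largest blocks examined in a grid of level `m`. -/
def blockLevel (d m : ℕ) : ℕ := Nat.log (2 ^ d) ⌊m / (40 * blockRate d)⌋₊

/-- constant in the bound on the line sums. -/
def lineConst (d : ℕ) : ℝ := 2 * (2 + 16 * 4 ^ d) + 1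

lemma blockLevel_spec (hd : 2 ≤ d) (hm : 2 ^ d ≤ m / (40 * blockRate d)) :
    0 < blockLevel d m ∧ (2 ^ blockLevel d m) ^ d ≤ m / (40 * blockRate d) ∧
      m / (40 * blockRate d) ≤ 2 ^ d * (2 ^ blockLevel d m) ^ d := by
  have h0 : (0 : ℝ) ≤ m / (40 * blockRate d) := le_trans (by positivity) hm
  set x := (m : ℝ) / (40 * blockRate d) with hx
  have hfl : 2 ^ d ≤ ⌊x⌋₊ := Nat.le_floor (by exact_mod_cast hm)
  have hb : 1 < 2 ^ d := Nat.one_lt_two_pow (by omega)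
  have hcomm : ∀ K : ℕ, ((2 : ℝ) ^ K) ^ d = ((2 ^ d) ^ K : ℕ) := fun K => by
    push_cast
    rw [← pow_mul, ← pow_mul, mul_comm]
  refine ⟨Nat.log_pos hb hfl, ?_, ?_⟩
  · rw [hcomm]
    have hne : ⌊x⌋₊ ≠ 0 := by
      have : 0 < 2 ^ d := by positivity
      omega
    exact (Nat.cast_le.2 (Nat.pow_log_le_self (2 ^ d) hne)).trans (Nat.floor_le h0)
  · rw [hcomm]
    have h1 : ⌊x⌋₊ + 1 ≤ 2 ^ d * (2 ^ d) ^ blockLevel d m := by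
      have := Nat.lt_pow_succ_log_self hb ⌊x⌋₊
      rw [pow_succ'] at this
      exact this
    have h2 : x ≤ (⌊x⌋₊ + 1 : ℕ) := by
      push_cast
      exact (Nat.lt_floor_add_one x).le
    refine h2.trans ?_
    exact_mod_cast h1

/-- the conditions satisfied by all large grid levels. -/
structure IsLargeLevel (d : ℕ) (ρ : ℝ) (m : ℕ) : Prop where
  one_le : 1 ≤ m
  block : 2 ^ d ≤ m / (40 * blockRate d)
  weight : (1 + Real.exp (d ^ 2 + d) * 6 ^ d) ≤ Real.exp (9 / 20 * m)
  log_le : Real.log (ρ ^ 2 * (wgtFactor d * lineConst d)) ≤ m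
  count : 2 * (2 ^ d * ρ) + (d + 2) * m ≤ Real.exp (1 / 40 * m)
  line : (2 * d + 3) * 3 * (m : ℝ) ^ 3 ≤ Real.exp (1 / 5 * m)

lemma eventually_isLargeLevel (d : ℕ) (hρ : 0 ≤ ρ) : ∀ᶠ m : ℕ in atTop, IsLargeLevel d ρ m := by
  have hD := one_le_blockRate d
  have htend := tendsto_natCast_atTop_atTop (R := ℝ)
  filter_upwards [eventually_ge_atTop 1,
    htend.eventually_ge_atTop (2 ^ d * (40 * blockRate d)),
    htend.eventually_ge_atTop (Real.log (ρ ^ 2 * (wgtFactor d * lineConst d))),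
    eventually_mul_pow_le_exp (1 + Real.exp (d ^ 2 + d) * 6 ^ d) 0
      (by norm_num : (0 : ℝ) < 9 / 20),
    eventually_mul_pow_le_exp (2 * (2 ^ d * ρ) + (d + 2)) 1 (by norm_num : (0 : ℝ) < 1 / 40),
    eventually_mul_pow_le_exp ((2 * d + 3) * 3) 3 (by norm_num : (0 : ℝ) < 1 / 5)]
    with m h1 h2 h3 h4 h5 h6
  refine ⟨h1, ?_, by simpa using h4, h3, ?_, h6⟩
  · rwa [le_div_iff₀ (by positivity)]
  · refine le_trans ?_ h5
    have : (1 : ℝ) ≤ m := by exact_mod_cast h1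
    have h7 : 0 ≤ 2 ^ d * ρ := by positivity
    nlinarith

lemma exp_half_le_two_pow (m : ℕ) : Real.exp (1 / 2 * m) ≤ 2 ^ m := by
  rw [mul_comm, Real.exp_nat_mul]
  refine pow_le_pow_left₀ (Real.exp_pos _).le ?_ m
  have h1 : Real.exp (1 / 2) ^ 2 = Real.exp 1 := by
    rw [← Real.exp_nat_mul]; norm_num
  have h2 := Real.exp_one_lt_d9
  nlinarith [Real.exp_pos (1 / 2)]

lemma two_pow_le_exp (m : ℕ) : (2 : ℝ) ^ m ≤ Real.exp m := by
  rw [← mul_one (m : ℝ), Real.exp_nat_mul]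
  refine pow_le_pow_left₀ (by norm_num) ?_ m
  linarith [Real.exp_one_gt_d9]

namespace IsLargeLevel

lemma two_pow_blockLevel_le (h : IsLargeLevel d ρ m) (hd : 2 ≤ d) :
    (2 : ℝ) ^ blockLevel d m ≤ m := by
  have hD := one_le_blockRate d
  calc (2 : ℝ) ^ blockLevel d m ≤ (2 ^ blockLevel d m) ^ d :=
        le_self_pow₀ (one_le_pow₀ (by norm_num)) (by omega)
    _ ≤ m / (40 * blockRate d) := (blockLevel_spec hd h.block).2.1
    _ ≤ m := div_le_self (Nat.cast_nonneg _) (by linarith)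

lemma blockLevel_le (h : IsLargeLevel d ρ m) (hd : 2 ≤ d) : blockLevel d m ≤ m := by
  have h1 : 2 ^ blockLevel d m ≤ m := by exact_mod_cast h.two_pow_blockLevel_le hd
  exact Nat.lt_two_pow_self.le.trans h1

lemma mul_block_le (h : IsLargeLevel d ρ m) (hd : 2 ≤ d) {c : ℝ}
    (hc : c ≤ blockRate d) : c * (2 ^ blockLevel d m) ^ d ≤ 1 / 40 * m := by
  have hD := one_le_blockRate d
  calc _ ≤ blockRate d * (m / (40 * blockRate d)) :=
        mul_le_mul hc (blockLevel_spec hd h.block).2.1 (by positivity) (by linarith)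
    _ = 1 / 40 * m := by field_simp

lemma costBound_le (h : IsLargeLevel d ρ m) (hd : 2 ≤ d) :
    2 ^ blockLevel d m * costBound d (blockRate d) (blockLevel d m) (Real.exp (1 / 40 * m)) ≤
      3 * (m : ℝ) ^ 2 * Real.exp (1 / 20 * m) := by
  have hm : (1 : ℝ) ≤ m := by exact_mod_cast h.one_le
  have hK : (blockLevel d m : ℝ) ≤ m := by exact_mod_cast h.blockLevel_le hd
  have hD := one_le_blockRate d
  have h1 : Real.exp (2 * blockRate d * (2 ^ blockLevel d m) ^ d) ≤ Real.exp (1 / 20 * m) := by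
    rw [Real.exp_le_exp, mul_assoc]
    linarith [h.mul_block_le hd le_rfl]
  have h2 : Real.exp (1 / 40 * m) ^ 2 = Real.exp (1 / 20 * m) := by
    rw [← Real.exp_nat_mul]
    congr 1
    push_cast
    ring
  have h3 : 1 ≤ Real.exp (1 / 20 * m) := Real.one_le_exp (by positivity)
  have h4 : costBound d (blockRate d) (blockLevel d m) (Real.exp (1 / 40 * m)) ≤
      3 * m * Real.exp (1 / 20 * m) := by
    unfold costBound
    rw [h2]
    have := mul_le_mul hK h1 (Real.exp_pos _).le (by positivity)
    nlinarith
  calc _ ≤ m * (3 * m * Real.exp (1 / 20 * m)) :=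
        mul_le_mul (h.two_pow_blockLevel_le hd) h4 (costBound_pos _ _ _ _).le (by positivity)
    _ = _ := by ring

lemma maxWgt_le (h : IsLargeLevel d ρ m) (hd : 2 ≤ d) (hρ : 4 ≤ ρ) :
    maxWgt d (Real.exp (1 / 40 * m)) *
      (2 / ρ * Real.exp (crossCost d * (2 ^ blockLevel d m) ^ d)) ≤ 4 ^ ((m + 1) / 2) := by
  have hc := crossCost_nonneg d
  have h1 : Real.exp (crossCost d * (2 ^ blockLevel d m) ^ d) ≤ Real.exp (1 / 40 * m) := by
    rw [Real.exp_le_exp]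
    refine h.mul_block_le hd ?_
    have : (0 : ℝ) ≤ d := Nat.cast_nonneg d
    unfold blockRate
    linarith
  have h2 : maxWgt d (Real.exp (1 / 40 * m)) ≤
      Real.exp (9 / 20 * m) * Real.exp (1 / 40 * m) := by
    refine le_trans ?_ (mul_le_mul_of_nonneg_right h.weight (Real.exp_pos _).le)
    have : 1 ≤ Real.exp (1 / 40 * m) := Real.one_le_exp (by positivity)
    unfold maxWgt
    linarith
  have h3 : 2 / ρ ≤ 1 := by rw [div_le_one (by linarith)]; linarith
  calc _ ≤ (Real.exp (9 / 20 * m) * Real.exp (1 / 40 * m)) * (1 * Real.exp (1 / 40 * m)) := by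
        refine mul_le_mul h2 ?_ (by positivity) (by positivity)
        exact mul_le_mul h3 h1 (Real.exp_pos _).le zero_le_one
    _ = Real.exp (1 / 2 * m) := by
        rw [one_mul, ← Real.exp_add, ← Real.exp_add]
        congr 1
        ring
    _ ≤ 2 ^ m := exp_half_le_two_pow m
    _ ≤ 2 ^ (2 * ((m + 1) / 2)) := pow_le_pow_right₀ (by norm_num) (by omega)
    _ = 4 ^ ((m + 1) / 2) := by rw [pow_mul]; norm_num

lemma log_term_le (h : IsLargeLevel d ρ m) (hd : 2 ≤ d) (hρ : 4 ≤ ρ) :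
    4 ^ ((m + 1) / 2) * Real.log (ρ ^ 2 * (wgtFactor d * lineConst d) * (2 ^ m) ^ d *
      Real.exp (crossCost d * (2 ^ blockLevel d m) ^ d)) ≤ 4 * (d + 2) * 4 ^ m := by
  have hc := crossCost_nonneg d
  have hwf := one_le_wgtFactor d
  have hl : 0 < lineConst d := by unfold lineConst; positivity
  have hm0 : (0 : ℝ) ≤ m := Nat.cast_nonneg m
  have h1 : crossCost d * (2 ^ blockLevel d m) ^ d ≤ 1 / 40 * m := by
    refine h.mul_block_le hd ?_
    have : (0 : ℝ) ≤ d := Nat.cast_nonneg d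
    unfold blockRate
    linarith
  have h2 : Real.log (((2 : ℝ) ^ m) ^ d) ≤ d * m := by
    rw [Real.log_pow, Real.log_pow]
    have : Real.log 2 ≤ 1 := by linarith [Real.log_two_lt_d9]
    have : m * Real.log 2 ≤ m := mul_le_of_le_one_right hm0 this
    exact mul_le_mul_of_nonneg_left this (Nat.cast_nonneg d)
  have h3 : Real.log (ρ ^ 2 * (wgtFactor d * lineConst d) * (2 ^ m) ^ d *
      Real.exp (crossCost d * (2 ^ blockLevel d m) ^ d)) ≤ (d + 2) * m := by
    rw [Real.log_mul (by positivity) (by positivity), Real.log_exp,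
      Real.log_mul (by positivity) (by positivity)]
    linarith [h.log_le]
  have h4 : (4 : ℝ) ^ ((m + 1) / 2) ≤ 2 * 2 ^ m := by
    calc (4 : ℝ) ^ ((m + 1) / 2) = 2 ^ (2 * ((m + 1) / 2)) := by rw [pow_mul]; norm_num
      _ ≤ 2 ^ (m + 1) := pow_le_pow_right₀ (by norm_num) (by omega)
      _ = 2 * 2 ^ m := by ring
  have h5 : (m : ℝ) ≤ 2 ^ m := by exact_mod_cast Nat.lt_two_pow_self.le
  have h6 : (4 : ℝ) ^ m = 2 ^ m * 2 ^ m := by rw [← mul_pow]; norm_num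
  calc _ ≤ (2 * 2 ^ m) * ((d + 2) * (2 : ℝ) ^ m) := by
        refine (mul_le_mul_of_nonneg_left h3 (by positivity)).trans ?_
        exact mul_le_mul h4 (mul_le_mul_of_nonneg_left h5 (by positivity)) (by positivity)
          (by positivity)
    _ ≤ _ := by
        rw [h6]
        have : (0 : ℝ) ≤ (d + 2) * (2 ^ m * 2 ^ m) := by positivity
        linarith

end IsLargeLevel

/-- intensity above which the mixing bound is proved. -/
def densityThreshold (d : ℕ) : ℝ :=
  4 + 10 * (2 * blockRate d * 2 ^ d + 1) + 10 * 2 ^ d * (d + 2) * (40 * blockRate d)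

open ProbabilityTheory in
open scoped NNReal in
theorem IsPoissonField.measureReal_not_regularCounts_le_exp {Ω : Type*} {mΩ : MeasurableSpace Ω}
    {P : Measure Ω} [IsProbabilityMeasure P] {N : Grid d m → Ω → ℕ} {r : ℝ≥0}
    (hN : IsPoissonField N r P) (hd : 2 ≤ d) (hρ : densityThreshold d ≤ ρ) (hr : ρ ≤ r)
    (hr' : (r : ℝ) ≤ 2 ^ d * ρ) (h : IsLargeLevel d ρ m) :
    P.real {ω | ¬ RegularCounts (blockRate d) (lineConst d) ρ (blockLevel d m) ((m + 1) / 2)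
      (Real.exp (1 / 40 * m)) fun b => N b ω} ≤ 3 * Real.exp (-(2 * m)) := by
  have hD := one_le_blockRate d
  have hD0 : 0 ≤ blockRate d := by linarith
  have hm : (1 : ℝ) ≤ m := by exact_mod_cast h.one_le
  have hX : 0 ≤ blockRate d * 2 ^ d := by positivity
  have hY : 0 ≤ 10 * 2 ^ d * (d + 2) * (40 * blockRate d) := by positivity
  have hpow : (2 : ℝ) ^ (m * d) ≤ Real.exp (d * m) := by
    refine (two_pow_le_exp (m * d)).trans_eq ?_
    push_cast
    rw [mul_comm]
  unfold densityThreshold at hρ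
  refine (hN.measureReal_not_regularCounts_le (D := blockRate d) (by omega) hr hr' (by linarith)
    (Real.exp_pos _).le (by linarith) hD0 (h.blockLevel_le hd) ((m + 1) / 2)).trans ?_
  have t1 : (2 : ℝ) ^ (m * d) * Real.exp (-(ρ / 10 * (2 ^ blockLevel d m) ^ d)) ≤
      Real.exp (-(2 * m)) := by
    refine (mul_le_mul_of_nonneg_right hpow (Real.exp_pos _).le).trans ?_
    rw [← Real.exp_add, Real.exp_le_exp]
    have h1 := (blockLevel_spec hd h.block).2.2
    rw [div_le_iff₀ (by positivity)] at h1
    have h2 : 2 ^ d * (d + 2) * (40 * blockRate d) ≤ ρ / 10 := by linarith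
    have h3 := mul_le_mul_of_nonneg_right h2
      (by positivity : (0 : ℝ) ≤ (2 ^ blockLevel d m) ^ d)
    have h4 := mul_le_mul_of_nonneg_left h1 (by positivity : (0 : ℝ) ≤ d + 2)
    linarith
  have t2 : (2 : ℝ) ^ (m * d) * Real.exp (2 * r - Real.exp (1 / 40 * m)) ≤
      Real.exp (-(2 * m)) := by
    refine (mul_le_mul_of_nonneg_right hpow (Real.exp_pos _).le).trans ?_
    rw [← Real.exp_add, Real.exp_le_exp]
    linarith [h.count]
  have t3 : (m + 1) * (d * (2 ^ (m * d) * Real.exp (-(2 ^ ((m + 1) / 2) / (2 ^ blockLevel d m *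
      costBound d (blockRate d) (blockLevel d m) (Real.exp (1 / 40 * m))))))) ≤
      Real.exp (-(2 * m)) := by
    have hB := costBound_pos d (blockRate d) (blockLevel d m) (Real.exp (1 / 40 * m))
    set R := 2 ^ blockLevel d m *
      costBound d (blockRate d) (blockLevel d m) (Real.exp (1 / 40 * m)) with hR
    have hR0 : 0 < R := by positivity
    have h1 : (2 * d + 3) * m ≤ 2 ^ ((m + 1) / 2) / R := by
      rw [le_div_iff₀ hR0]
      calc _ ≤ (2 * d + 3) * m * (3 * (m : ℝ) ^ 2 * Real.exp (1 / 20 * m)) :=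
            mul_le_mul_of_nonneg_left (h.costBound_le hd) (by positivity)
        _ = (2 * d + 3) * 3 * (m : ℝ) ^ 3 * Real.exp (1 / 20 * m) := by ring
        _ ≤ Real.exp (1 / 5 * m) * Real.exp (1 / 20 * m) :=
            mul_le_mul_of_nonneg_right h.line (Real.exp_pos _).le
        _ = Real.exp (1 / 4 * m) := by
            rw [← Real.exp_add]
            congr 1
            ring
        _ ≤ 2 ^ ((m + 1) / 2) := by
            refine le_of_sq_le_sq ?_ (by positivity)
            calc Real.exp (1 / 4 * m) ^ 2 = Real.exp (1 / 2 * m) := by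
                  rw [← Real.exp_nat_mul]
                  congr 1
                  push_cast
                  ring
              _ ≤ 2 ^ m := exp_half_le_two_pow m
              _ ≤ 2 ^ ((m + 1) / 2 * 2) := pow_le_pow_right₀ (by norm_num) (by omega)
              _ = _ := pow_mul _ _ _
    have h2 : (m : ℝ) + 1 ≤ Real.exp m := Real.add_one_le_exp _
    have h3 : (d : ℝ) ≤ Real.exp (d * m) := by
      refine le_trans ?_ (Real.add_one_le_exp _)
      have : (0 : ℝ) ≤ d := Nat.cast_nonneg d
      nlinarith
    calc _ ≤ Real.exp m * (Real.exp (d * m) * (Real.exp (d * m) *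
          Real.exp (-(2 ^ ((m + 1) / 2) / R)))) := by gcongr
      _ = Real.exp (m + (d * m + (d * m + -(2 ^ ((m + 1) / 2) / R)))) := by
          rw [← Real.exp_add, ← Real.exp_add, ← Real.exp_add]
      _ ≤ _ := by
          rw [Real.exp_le_exp]
          linarith
  linarith

end Asymptotics

section Main

variable {ρ : ℝ}

lemma two_mul_lineConst_le_exp (d : ℕ) : 2 * lineConst d ≤ Real.exp (6 * blockRate d) := by
  have hc := crossCost_nonneg d
  have h4 : (1 : ℝ) ≤ 4 ^ d := one_le_pow₀ (by norm_num)
  have h2 : (4 : ℝ) ^ d ≤ Real.exp (2 * d) := by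
    rw [mul_comm, Real.exp_nat_mul]
    refine pow_le_pow_left₀ (by norm_num) ?_ d
    have h := two_pow_le_exp 2
    norm_num at h
    exact h
  have h3 : (74 : ℝ) ≤ Real.exp 6 := by
    have h5 : Real.exp 6 = Real.exp 1 ^ 6 := by
      rw [← Real.exp_nat_mul]
      norm_num
    have h6 := pow_le_pow_left₀ (by norm_num) Real.exp_one_gt_d9.le 6
    rw [h5]
    refine le_trans ?_ h6
    norm_num
  calc 2 * lineConst d ≤ 74 * 4 ^ d := by
        unfold lineConst
        linarith
    _ ≤ Real.exp 6 * Real.exp (2 * d) := mul_le_mul h3 h2 (by positivity) (by positivity)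
    _ = Real.exp (6 + 2 * d) := (Real.exp_add _ _).symm
    _ ≤ Real.exp (6 * blockRate d) := by
        have : (0 : ℝ) ≤ d := Nat.cast_nonneg d
        rw [Real.exp_le_exp, blockRate]
        linarith

lemma two_pow_log_spec {L : ℕ} (hL : 0 < L) :
    ((2 ^ Nat.log 2 L : ℝ)) ≤ L ∧ (L : ℝ) ≤ 2 * 2 ^ Nat.log 2 L := by
  constructor
  · exact_mod_cast Nat.pow_log_le_self 2 hL.ne'
  · have := Nat.lt_pow_succ_log_self (b := 2) (by norm_num) L
    rw [pow_succ'] at this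
    exact_mod_cast this.le

lemma tendsto_log_two : Tendsto (fun L : ℕ => Nat.log 2 L) atTop atTop := by
  refine tendsto_atTop_atTop.2 fun b => ⟨2 ^ b, fun L hL => ?_⟩
  have : 0 < 2 ^ b := by positivity
  exact (Nat.le_log_iff_pow_le (by norm_num) (by omega)).2 hL

/-- regularity of the cell counts of the cube of side `L`. -/
def RegularAt (d : ℕ) (ρ : ℝ) (L : ℕ) (ξ : Config d) : Prop :=
  RegularCounts (blockRate d) (lineConst d) ρ (blockLevel d (Nat.log 2 L))
    ((Nat.log 2 L + 1) / 2) (Real.exp (1 / 40 * (Nat.log 2 L : ℕ)))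
    fun b : Grid d (Nat.log 2 L) => (ξ ∩ gridBox (Nat.log 2 L) L b).ncard

lemma IsPoissonPP.measure_not_regularAt_le {P : Measure (Config d)} (hP : IsPoissonPP d ρ P)
    (hd : 2 ≤ d) (hρ : densityThreshold d ≤ ρ) (hρ0 : 0 ≤ ρ) {L : ℕ} (hL : 0 < L)
    (h : IsLargeLevel d ρ (Nat.log 2 L)) :
    P {ξ | ¬ RegularAt d ρ L ξ} ≤ ENNReal.ofReal (12 * (1 / (L : ℝ) ^ 2)) := by
  have := hP.1
  obtain ⟨h1, h2⟩ := two_pow_log_spec hL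
  have hL0 : (0 : ℝ) < L := by exact_mod_cast hL
  set m := Nat.log 2 L with hm
  have hq1 : 1 ≤ (L / 2 ^ m : ℝ) := (one_le_div (by positivity)).2 h1
  have hq2 : (L / 2 ^ m : ℝ) ≤ 2 := (div_le_iff₀ (by positivity)).2 h2
  have hr : (Real.toNNReal (ρ * (L / 2 ^ m) ^ d) : ℝ) = ρ * (L / 2 ^ m) ^ d :=
    Real.coe_toNNReal _ (by positivity)
  have key := (hP.isPoissonField hρ0 hL0 m).measureReal_not_regularCounts_le_exp hd hρ
    (by rw [hr]; exact le_mul_of_one_le_right hρ0 (one_le_pow₀ hq1))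
    (by rw [hr, mul_comm]
        exact mul_le_mul_of_nonneg_right (pow_le_pow_left₀ (by positivity) hq2 d) hρ0) h
  rw [← ofReal_measureReal]
  refine ENNReal.ofReal_le_ofReal (key.trans ?_)
  have h3 : (L : ℝ) / 2 ≤ Real.exp m := by
    refine le_trans ?_ (two_pow_le_exp m)
    linarith
  have h4 : Real.exp (-(2 * m)) = 1 / Real.exp m ^ 2 := by
    rw [Real.exp_neg, ← Real.exp_nat_mul, one_div]
    norm_num
  have h5 : 1 / Real.exp m ^ 2 ≤ 1 / ((L : ℝ) / 2) ^ 2 :=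
    one_div_le_one_div_of_le (by positivity) (pow_le_pow_left₀ (by positivity) h3 2)
  rw [h4]
  refine (mul_le_mul_of_nonneg_left h5 (by norm_num)).trans_eq ?_
  field_simp
  norm_num

lemma eventually_isLargeLevel_log (d : ℕ) (hρ : 0 ≤ ρ) :
    ∀ᶠ L : ℕ in atTop, IsLargeLevel d ρ (Nat.log 2 L) :=
  tendsto_log_two.eventually (eventually_isLargeLevel d hρ)

lemma IsPoissonPP.ae_eventually_regularAt {P : Measure (Config d)} (hP : IsPoissonPP d ρ P)
    (hd : 2 ≤ d) (hρ : densityThreshold d ≤ ρ) (hρ0 : 0 ≤ ρ) :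
    ∀ᵐ ξ ∂P, ∀ᶠ L : ℕ in atTop, RegularAt d ρ L ξ := by
  obtain ⟨L₀, hL₀⟩ := eventually_atTop.1 (eventually_isLargeLevel_log d hρ0)
  have hsum : ∑' n : ℕ, P {ξ | ¬ RegularAt d ρ (n + (L₀ + 1)) ξ} ≠ ∞ := by
    refine ne_top_of_le_ne_top ?_ (ENNReal.tsum_le_tsum fun n =>
      hP.measure_not_regularAt_le hd hρ hρ0 (by omega) (hL₀ (n + (L₀ + 1)) (by omega)))
    have hs : Summable fun n : ℕ => 12 * (1 / (((n + (L₀ + 1) : ℕ) : ℝ)) ^ 2) :=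
      ((summable_nat_add_iff (f := fun n : ℕ => 1 / (n : ℝ) ^ 2) (L₀ + 1)).2
        (Real.summable_one_div_nat_pow.2 (by norm_num))).mul_left 12
    rw [← ENNReal.ofReal_tsum_of_nonneg (fun n => by positivity) hs]
    exact ENNReal.ofReal_ne_top
  filter_upwards [ae_eventually_notMem hsum] with ξ hξ
  rw [eventually_atTop] at hξ ⊢
  obtain ⟨n₀, hn₀⟩ := hξ
  refine ⟨n₀ + (L₀ + 1), fun L hL => ?_⟩
  have := hn₀ (L - (L₀ + 1)) (by omega)
  rw [Nat.sub_add_cancel (by omega)] at this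
  simpa using this

/-- constant in the mixing time bound. -/
def mixConst (d : ℕ) : ℝ :=
  2 * (poincareConst d (lineConst d) *
    (4 * (d + 2) + |2 * (d + 1) + Real.log (2 * nashConst d (lineConst d)) + 1|))

lemma RegularAt.mixTime_le {ξ : Config d} {L : ℕ} (hreg : RegularAt d ρ L ξ) (hd : 2 ≤ d)
    (hρ : 4 ≤ ρ) (hL : 0 < L) (h : IsLargeLevel d ρ (Nat.log 2 L)) (i : ℕ)
    (hfin : (ξ ∩ cube d L).Finite) :
    mixTime (d : ℝ) hfin.toFinset i ≤ ENNReal.ofReal (mixConst d * (L : ℝ) ^ 2) := by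
  obtain ⟨h1, h2⟩ := two_pow_log_spec hL
  have hL0 : (0 : ℝ) < L := by exact_mod_cast hL
  have ha : 1 ≤ lineConst d := by
    unfold lineConst
    have : (0 : ℝ) < 4 ^ d := by positivity
    linarith
  unfold RegularAt at hreg
  set m := Nat.log 2 L with hm
  have hβ : IsGridMap hfin.toFinset (gridOf m L) :=
    isGridMap_gridOf hL0 h1 h2 fun x hx => (hfin.mem_toFinset.1 hx).2
  have hN : RegularCounts (blockRate d) (lineConst d) ρ (blockLevel d m) ((m + 1) / 2)
      (Real.exp (1 / 40 * m)) (boxCount hfin.toFinset (gridOf (d := d) m L)) := by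
    have : boxCount hfin.toFinset (gridOf (d := d) m L) =
        fun b => (ξ ∩ gridBox m L b).ncard :=
      funext fun b => boxCount_gridOf hfin.coe_toFinset b
    rwa [this]
  refine (mixTime_le_of_regularCounts hd hβ i hρ ha (blockLevel_spec hd h.block).1
    (by unfold blockRate; linarith) (two_mul_lineConst_le_exp d)
    (by have := h.one_le; omega) hN (h.maxWgt_le hd hρ)).trans (ENNReal.ofReal_le_ofReal ?_)
  have hlog := h.log_term_le hd hρ
  have hpc : 0 ≤ poincareConst d (lineConst d) := by
    have := one_le_wgtFactor d
    unfold poincareConst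
    positivity
  have h4 : (4 : ℝ) ^ m ≤ (L : ℝ) ^ 2 := by
    calc (4 : ℝ) ^ m = (2 ^ m) ^ 2 := by rw [← pow_mul, mul_comm, pow_mul]; norm_num
      _ ≤ _ := pow_le_pow_left₀ (by positivity) h1 2
  unfold mixConst
  set T := 2 * ((d : ℝ) + 1) + Real.log (2 * nashConst d (lineConst d)) + 1
  have hT : T * 4 ^ m ≤ |T| * 4 ^ m := mul_le_mul_of_nonneg_right (le_abs_self T) (by positivity)
  have hfinal : 4 ^ ((m + 1) / 2) * Real.log (ρ ^ 2 * (wgtFactor d * lineConst d) * (2 ^ m) ^ d *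
      Real.exp (crossCost d * (2 ^ blockLevel d m) ^ d)) + T * 4 ^ m ≤
      (4 * (d + 2) + |T|) * (L : ℝ) ^ 2 := by
    refine le_trans ?_ (mul_le_mul_of_nonneg_left h4 (by positivity))
    linarith
  have := mul_le_mul_of_nonneg_left hfinal hpc
  linarith

end Main

/-- Theorem 1.3(3): diffusive mixing time bound for `α = d` at high density. -/
theorem stmt_6 (hd : 2 ≤ d) :
    ∃ C : ℝ, 0 < C ∧ ∃ ρ₁ : ℝ, 0 < ρ₁ ∧ ∀ ρ : ℝ, ρ₁ ≤ ρ →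
      ∀ P : Measure (Config d), IsPoissonPP d ρ P →
        ∀ i ∈ ({1, 2, 3} : Set ℕ),
          ∀ᵐ ξ ∂P, ∀ᶠ L : ℕ in atTop, ∀ hfin : (ξ ∩ cube d L).Finite,
            mixTime (d : ℝ) hfin.toFinset i ≤ ENNReal.ofReal (C * (L : ℝ) ^ 2) := by
  have hD := one_le_blockRate d
  have h4 : 4 ≤ densityThreshold d := by
    have : 0 ≤ 10 * (2 * blockRate d * 2 ^ d + 1) := by positivity
    have : 0 ≤ 10 * 2 ^ d * (d + 2) * (40 * blockRate d) := by positivity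
    unfold densityThreshold
    linarith
  refine ⟨max 1 (mixConst d), by positivity, densityThreshold d, by linarith,
    fun ρ hρ P hP i _ => ?_⟩
  filter_upwards [hP.ae_eventually_regularAt hd hρ (by linarith)] with ξ hξ
  filter_upwards [hξ, eventually_gt_atTop 0, eventually_isLargeLevel_log d (by linarith)]
    with L hreg hL hlarge hfin
  refine (hreg.mixTime_le hd (by linarith) hL hlarge i hfin).trans (ENNReal.ofReal_le_ofReal ?_)
  exact mul_le_mul_of_nonneg_right (le_max_right _ _) (by positivity)

end
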